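/- arXiv:1206.3763 — 4 statements merged into one kernel-verified Lean document; each statement's English description precedes it below -/
import Mathlib

section
/- Let n→∞ with p=p(n)→∞ and p/n→γ∈(0,∞). For each n let X_1,…,X_n be iid random vectors in ℝ^p with E[X_i]=0 and E‖X_i‖²=1 whose common distribution satisfies the following high-concentration property: there are absolute constants C,b>0 and a rate c(p)≥C_0 p^{b/2} such that for every 1-Lipschitz function F:ℝ^p→ℝ and every median m_F of F(X_i), P(|F(X_i)−m_F|>t)≤C·exp(−c(p)t^b) for all t>0. Let f:ℝ→ℝ be differentiable at 0 and continuous at 1, let A be the n×n matrix with entries A_{ij}=f(X_i^T X_j) (including the diagonal), and let B=(f(1)−f(0)−f′(0))I_n+f′(0)·(X_i^T X_j)_{i,j}. Then A and B have the same limiting spectral distribution; in particular, almost surely, for every complex z with Im z>0, m_A(z)−m_B(z)→0 as n→∞. -/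
open MeasureTheory ProbabilityTheory Filter Matrix
open scoped RealInnerProductSpace ENNReal

/-- Stieltjes transform of an `n × n` real matrix:
`m_M(z) = n⁻¹ · Tr((M − z·I)⁻¹)`. -/
noncomputable def stieltjesTransform {n : ℕ} (M : Matrix (Fin n) (Fin n) ℝ) (z : ℂ) : ℂ :=
  (n : ℂ)⁻¹ * ((M.map (fun x : ℝ => (x : ℂ)) - z • (1 : Matrix (Fin n) (Fin n) ℂ))⁻¹).trace

lemma res_lower {n : ℕ} (M : Matrix (Fin n) (Fin n) ℝ) (hM : M.IsSymm) (z : ℂ) (hz : 0 < z.im)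
    (x : Fin n → ℂ) :
    z.im * ‖WithLp.toLp 2 x‖ ≤ ‖WithLp.toLp 2 ((M.map (fun x : ℝ => (x : ℂ))
      - z • (1 : Matrix (Fin n) (Fin n) ℂ)) *ᵥ x)‖ := by
  set N := M.map (fun x : ℝ => (x : ℂ)) with hN
  have hNH : Nᴴ = N := by
    ext i j
    simp [hN, Matrix.conjTranspose_apply]
    exact hM.apply i j
  have h1 : (star x ⬝ᵥ (N *ᵥ x)).im = 0 := by
    have : star (star x ⬝ᵥ (N *ᵥ x)) = star x ⬝ᵥ (N *ᵥ x) := by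
      rw [← Matrix.star_dotProduct, Matrix.star_mulVec, hNH, ← Matrix.dotProduct_mulVec]
    exact Complex.conj_eq_iff_im.mp this
  have h2 : star x ⬝ᵥ x = ((‖WithLp.toLp 2 x‖ ^ 2 : ℝ) : ℂ) := by
    rw [EuclideanSpace.norm_sq_eq]
    simp [dotProduct, Complex.conj_mul']
  have h3 : star x ⬝ᵥ ((N - z • (1 : Matrix (Fin n) (Fin n) ℂ)) *ᵥ x)
      = star x ⬝ᵥ (N *ᵥ x) - z * ((‖WithLp.toLp 2 x‖ ^ 2 : ℝ) : ℂ) := by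
    rw [Matrix.sub_mulVec, dotProduct_sub, Matrix.smul_mulVec, Matrix.one_mulVec, dotProduct_smul,
      h2, smul_eq_mul]
  have h4 : ‖star x ⬝ᵥ ((N - z • (1 : Matrix (Fin n) (Fin n) ℂ)) *ᵥ x)‖ ≤
      ‖WithLp.toLp 2 x‖ * ‖WithLp.toLp 2 ((N - z • (1 : Matrix (Fin n) (Fin n) ℂ)) *ᵥ x)‖ := by
    have := norm_inner_le_norm (𝕜 := ℂ) (WithLp.toLp 2 x)
      (WithLp.toLp 2 ((N - z • (1 : Matrix (Fin n) (Fin n) ℂ)) *ᵥ x))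
    rwa [EuclideanSpace.inner_toLp_toLp, dotProduct_comm] at this
  have h5 : z.im * ‖WithLp.toLp 2 x‖ ^ 2 ≤
      ‖star x ⬝ᵥ ((N - z • (1 : Matrix (Fin n) (Fin n) ℂ)) *ᵥ x)‖ := by
    have := Complex.abs_im_le_norm (star x ⬝ᵥ ((N - z • (1 : Matrix (Fin n) (Fin n) ℂ)) *ᵥ x))
    refine le_trans ?_ this
    rw [h3, Complex.sub_im, h1, Complex.im_mul_ofReal, zero_sub, abs_neg]
    exact le_abs_self _
  rcases eq_or_lt_of_le (norm_nonneg (WithLp.toLp 2 x)) with h | h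
  · rw [← h]; simp
  · have := h5.trans h4
    nlinarith

lemma res_unit {n : ℕ} (M : Matrix (Fin n) (Fin n) ℝ) (hM : M.IsSymm) (z : ℂ) (hz : 0 < z.im) :
    IsUnit (M.map (fun x : ℝ => (x : ℂ)) - z • (1 : Matrix (Fin n) (Fin n) ℂ)).det := by
  rw [isUnit_iff_ne_zero]
  intro h
  obtain ⟨v, hv, hv0⟩ := Matrix.exists_mulVec_eq_zero_iff.mpr h
  have := res_lower M hM z hz v
  rw [hv0] at this
  simp only [WithLp.toLp_zero, norm_zero] at this
  apply hv
  have h2 : ‖WithLp.toLp 2 v‖ = 0 := le_antisymm (by nlinarith [norm_nonneg (WithLp.toLp 2 v)])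
    (norm_nonneg _)
  rw [norm_eq_zero] at h2
  simpa using h2

lemma res_upper {n : ℕ} (M : Matrix (Fin n) (Fin n) ℝ) (hM : M.IsSymm) (z : ℂ) (hz : 0 < z.im)
    (y : Fin n → ℂ) :
    ‖WithLp.toLp 2 ((M.map (fun x : ℝ => (x : ℂ))
      - z • (1 : Matrix (Fin n) (Fin n) ℂ))⁻¹ *ᵥ y)‖ ≤ ‖WithLp.toLp 2 y‖ / z.im := by
  have := res_lower M hM z hz ((M.map (fun x : ℝ => (x : ℂ))
      - z • (1 : Matrix (Fin n) (Fin n) ℂ))⁻¹ *ᵥ y)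
  rw [Matrix.mulVec_mulVec, Matrix.mul_nonsing_inv _ (res_unit M hM z hz), Matrix.one_mulVec] at this
  rw [le_div_iff₀ hz]; linarith

lemma res_ident {n : ℕ} (A B : Matrix (Fin n) (Fin n) ℂ) (hA : IsUnit A.det) (hB : IsUnit B.det) :
    A⁻¹ - B⁻¹ = A⁻¹ * (B - A) * B⁻¹ := by
  rw [mul_sub, sub_mul, Matrix.mul_assoc, Matrix.mul_nonsing_inv _ hB,
    Matrix.nonsing_inv_mul _ hA]
  simp

lemma stieltjes_frob {n : ℕ} (A B : Matrix (Fin n) (Fin n) ℝ) (hA : A.IsSymm) (hB : B.IsSymm)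
    (z : ℂ) (hz : 0 < z.im) :
    ‖stieltjesTransform A z - stieltjesTransform B z‖ ≤
      Real.sqrt ((n : ℝ)⁻¹ * ∑ i, ∑ j, (A i j - B i j) ^ 2) / z.im ^ 2 := by
  set NA := (A.map (fun x : ℝ => (x : ℂ)) - z • (1 : Matrix (Fin n) (Fin n) ℂ)) with hNA
  set NB := (B.map (fun x : ℝ => (x : ℂ)) - z • (1 : Matrix (Fin n) (Fin n) ℂ)) with hNB
  have hd : stieltjesTransform A z - stieltjesTransform B z
      = (n : ℂ)⁻¹ * ∑ i, ∑ j, ((B i j - A i j : ℝ) : ℂ) * (NB⁻¹ * NA⁻¹) j i := by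
    unfold stieltjesTransform
    rw [← mul_sub, ← Matrix.trace_sub, res_ident _ _ (res_unit A hA z hz) (res_unit B hB z hz),
      Matrix.mul_assoc, Matrix.trace_mul_comm, Matrix.mul_assoc]
    congr 1
    simp only [Matrix.trace, Matrix.diag, Matrix.mul_apply (M := _ - _)]
    refine Finset.sum_congr rfl fun i _ => Finset.sum_congr rfl fun j _ => ?_
    simp [hNA, hNB]
  set R := NB⁻¹ * NA⁻¹ with hR
  have hcol : ∀ i, ∑ j, ‖R j i‖ ^ 2 ≤ 1 / z.im ^ 4 := by
    intro i
    have h1 := res_upper B hB z hz (NA⁻¹ *ᵥ Pi.single i 1)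
    have h2 := res_upper A hA z hz (Pi.single i 1)
    rw [Matrix.mulVec_mulVec] at h1
    have h3 : ‖WithLp.toLp 2 (R *ᵥ Pi.single i 1)‖ ^ 2 = ∑ j, ‖R j i‖ ^ 2 := by
      rw [EuclideanSpace.norm_sq_eq]; simp
    have h4 : ‖WithLp.toLp 2 (Pi.single i (1:ℂ) : Fin n → ℂ)‖ = 1 := by
      simp
    rw [h4] at h2
    rw [← h3]
    have h5 : ‖WithLp.toLp 2 (R *ᵥ Pi.single i 1)‖ ≤ 1 / z.im ^ 2 := by
      refine h1.trans ((div_le_div_of_nonneg_right h2 hz.le).trans (le_of_eq ?_))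
      field_simp
    calc _ ≤ (1 / z.im ^ 2) ^ 2 := pow_le_pow_left₀ (norm_nonneg _) h5 2
      _ = _ := by field_simp
  have hsum : ‖∑ i, ∑ j, ((B i j - A i j : ℝ) : ℂ) * R j i‖ ≤
      Real.sqrt (∑ i, ∑ j, (A i j - B i j) ^ 2) * Real.sqrt (n * (1 / z.im ^ 4)) := by
    calc _ ≤ ∑ i, ∑ j, |A i j - B i j| * ‖R j i‖ := by
            refine (norm_sum_le _ _).trans (Finset.sum_le_sum fun i _ => ?_)
            refine (norm_sum_le _ _).trans (Finset.sum_le_sum fun j _ => ?_)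
            rw [norm_mul, Complex.norm_real, Real.norm_eq_abs, abs_sub_comm]
      _ = ∑ x : Fin n × Fin n, |A x.1 x.2 - B x.1 x.2| * ‖R x.2 x.1‖ := by
            rw [Fintype.sum_prod_type]
      _ ≤ Real.sqrt (∑ x : Fin n × Fin n, |A x.1 x.2 - B x.1 x.2| ^ 2) *
            Real.sqrt (∑ x : Fin n × Fin n, ‖R x.2 x.1‖ ^ 2) := Real.sum_mul_le_sqrt_mul_sqrt _ _ _
      _ ≤ _ := by
            rw [Fintype.sum_prod_type, Fintype.sum_prod_type]
            simp only [sq_abs]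
            gcongr
            calc _ ≤ ∑ i : Fin n, 1 / z.im ^ 4 := Finset.sum_le_sum fun i _ => hcol i
              _ = _ := by simp
  rw [hd, norm_mul]
  refine (mul_le_mul_of_nonneg_left hsum (norm_nonneg _)).trans ?_
  rcases Nat.eq_zero_or_pos n with h0 | h0
  · subst h0; simp
  have hn : (0:ℝ) < n := by exact_mod_cast h0
  have e1 : Real.sqrt ((n:ℝ) * (1 / z.im ^ 4)) = Real.sqrt n * (1 / z.im ^ 2) := by
    rw [Real.sqrt_mul hn.le, show (1:ℝ) / z.im ^ 4 = (1 / z.im ^ 2) ^ 2 by field_simp,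
      Real.sqrt_sq (by positivity)]
  rw [e1, Real.sqrt_mul (by positivity), norm_inv, Complex.norm_natCast, Real.sqrt_inv]
  have e2 : Real.sqrt n ≠ 0 := (Real.sqrt_pos.mpr hn).ne'
  apply le_of_eq
  have e3 : (n:ℝ)⁻¹ = (Real.sqrt n)⁻¹ * (Real.sqrt n)⁻¹ := by
    rw [← mul_inv, Real.mul_self_sqrt hn.le]
  rw [e3]
  field_simp

lemma stieltjes_rank {n : ℕ} (A B : Matrix (Fin n) (Fin n) ℝ) (hA : A.IsSymm) (hB : B.IsSymm)
    (k : ℝ) (hAB : ∀ i j, B i j - A i j = k)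
    (z : ℂ) (hz : 0 < z.im) :
    ‖stieltjesTransform A z - stieltjesTransform B z‖ ≤ (n : ℝ)⁻¹ * (2 / z.im) := by
  set NA := (A.map (fun x : ℝ => (x : ℂ)) - z • (1 : Matrix (Fin n) (Fin n) ℂ)) with hNA
  set NB := (B.map (fun x : ℝ => (x : ℂ)) - z • (1 : Matrix (Fin n) (Fin n) ℂ)) with hNB
  set e : Fin n → ℂ := fun _ => 1 with he
  set u : Fin n → ℂ := (k : ℂ) • (NA⁻¹ *ᵥ e) with hu
  set w : Fin n → ℂ := e ᵥ* NB⁻¹ with hw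
  have hdiff : NA⁻¹ - NB⁻¹ = Matrix.vecMulVec u w := by
    rw [res_ident _ _ (res_unit A hA z hz) (res_unit B hB z hz)]
    have : NB - NA = (k : ℂ) • Matrix.vecMulVec e e := by
      ext i j
      simp [hNA, hNB, he, Matrix.vecMulVec_apply, ← hAB i j]
    rw [this, hu, hw, Matrix.mul_smul, Matrix.smul_mul, Matrix.mul_vecMulVec,
      Matrix.vecMulVec_mul, Matrix.smul_vecMulVec]
  have htr : (NA⁻¹ - NB⁻¹).trace = u ⬝ᵥ w := by
    rw [hdiff, Matrix.trace_vecMulVec]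
  have hb1 : ‖u ⬝ᵥ w‖ ≤ ‖WithLp.toLp 2 u‖ * ‖WithLp.toLp 2 (star w)‖ := by
    have := norm_inner_le_norm (𝕜 := ℂ) (WithLp.toLp 2 (star w)) (WithLp.toLp 2 u)
    rw [EuclideanSpace.inner_toLp_toLp, star_star] at this
    linarith
  have hb2 : ‖WithLp.toLp 2 u‖ * ‖WithLp.toLp 2 (star w)‖ ^ 2 ≤
      2 / z.im * ‖WithLp.toLp 2 (star w)‖ := by
    have h1 : (NA⁻¹ - NB⁻¹) *ᵥ (star w) = ((‖WithLp.toLp 2 (star w)‖ ^ 2 : ℝ) : ℂ) • u := by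
      rw [hdiff, Matrix.vecMulVec_mulVec, EuclideanSpace.norm_sq_eq]
      ext i
      simp [dotProduct, Complex.mul_conj', mul_comm]
    have h2 : ‖WithLp.toLp 2 ((NA⁻¹ - NB⁻¹) *ᵥ (star w))‖ ≤
        2 / z.im * ‖WithLp.toLp 2 (star w)‖ := by
      rw [Matrix.sub_mulVec, WithLp.toLp_sub]
      refine (norm_sub_le _ _).trans ?_
      have := res_upper A hA z hz (star w)
      have := res_upper B hB z hz (star w)
      calc _ ≤ ‖WithLp.toLp 2 (star w)‖ / z.im + ‖WithLp.toLp 2 (star w)‖ / z.im := by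
              gcongr
        _ = _ := by ring
    rw [h1, WithLp.toLp_smul, norm_smul, Complex.norm_real, Real.norm_eq_abs, abs_of_nonneg
      (by positivity)] at h2
    linarith
  have hb3 : ‖u ⬝ᵥ w‖ ≤ 2 / z.im := by
    refine hb1.trans ?_
    rcases eq_or_lt_of_le (norm_nonneg (WithLp.toLp 2 (star w))) with h | h
    · rw [← h]; simp; positivity
    · refine le_of_mul_le_mul_right ?_ h
      linarith
  unfold stieltjesTransform
  rw [← mul_sub, ← Matrix.trace_sub, htr, norm_mul, norm_inv, Complex.norm_natCast]
  gcongr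

lemma stieltjes_diff {n : ℕ} (A B : Matrix (Fin n) (Fin n) ℝ) (hA : A.IsSymm) (hB : B.IsSymm)
    (k : ℝ) (z : ℂ) (hz : 0 < z.im) :
    ‖stieltjesTransform A z - stieltjesTransform B z‖ ≤ (n : ℝ)⁻¹ * (2 / z.im) +
      Real.sqrt ((n : ℝ)⁻¹ * ∑ i, ∑ j, (A i j - B i j - k) ^ 2) / z.im ^ 2 := by
  set A' : Matrix (Fin n) (Fin n) ℝ := Matrix.of (fun i j => A i j - k) with hA'
  have hs : A'.IsSymm := by
    ext i j; simp [hA', hA.apply i j]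
  have h1 := stieltjes_rank A A' hA hs (-k) (by intro i j; simp [hA']) z hz
  have h2 := stieltjes_frob A' B hs hB z hz
  have e : ∀ i j, A' i j - B i j = A i j - B i j - k := by intro i j; simp [hA']; ring
  simp only [e] at h2
  calc _ ≤ ‖stieltjesTransform A z - stieltjesTransform A' z‖ +
      ‖stieltjesTransform A' z - stieltjesTransform B z‖ := norm_sub_le_norm_sub_add_norm_sub _ _ _
    _ ≤ _ := add_le_add h1 h2

lemma exists_median {Ω : Type*} [MeasurableSpace Ω] (μ : Measure Ω) [IsProbabilityMeasure μ]
    (Y : Ω → ℝ) (hY : Measurable Y) :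
    ∃ m : ℝ, (1 / 2 : ℝ≥0∞) ≤ μ {ω | m ≤ Y ω} ∧ (1 / 2 : ℝ≥0∞) ≤ μ {ω | Y ω ≤ m} := by
  have : IsProbabilityMeasure (μ.map Y) := Measure.isProbabilityMeasure_map hY.aemeasurable
  set G := cdf (μ.map Y) with hG
  set S : Set ℝ := {t | 1 / 2 ≤ G t} with hS
  have hne : S.Nonempty := by
    have := (tendsto_cdf_atTop (μ.map Y)).eventually (lt_mem_nhds (show (1/2:ℝ) < 1 by norm_num))
    obtain ⟨t, ht⟩ := this.exists
    exact ⟨t, ht.le⟩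
  have hbd : BddBelow S := by
    have := (tendsto_cdf_atBot (μ.map Y)).eventually (gt_mem_nhds (show (0:ℝ) < 1/2 by norm_num))
    obtain ⟨t, ht⟩ := this.exists
    refine ⟨t, fun s hs => ?_⟩
    by_contra hlt
    push Not at hlt
    have := G.mono hlt.le
    have hs' : 1 / 2 ≤ G s := hs
    linarith
  set m := sInf S with hm
  have h1 : ∀ t, m < t → 1 / 2 ≤ G t := by
    intro t ht
    obtain ⟨s, hs, hst⟩ := exists_lt_of_csInf_lt hne ht
    exact le_trans hs (G.mono hst.le)
  have h2 : ∀ t, t < m → G t ≤ 1 / 2 := by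
    intro t ht
    by_contra hlt
    push Not at hlt
    exact absurd (csInf_le hbd (show t ∈ S from hlt.le)) (not_le.mpr ht)
  have h3 : 1 / 2 ≤ G m := by
    have := (G.right_continuous m).mono Set.Ioi_subset_Ici_self
    exact ge_of_tendsto this (eventually_nhdsWithin_of_forall fun t ht => h1 t ht)
  have h4 : Function.leftLim G m ≤ 1 / 2 := by
    exact le_of_tendsto (G.mono.tendsto_leftLim m)
      (eventually_nhdsWithin_of_forall fun t ht => h2 t ht)
  have half : (1 / 2 : ℝ≥0∞) = ENNReal.ofReal (1 / 2) := by
    rw [ENNReal.ofReal_div_of_pos (by norm_num)]; simp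
  refine ⟨m, ?_, ?_⟩
  · have e := G.measure_Ici (tendsto_cdf_atTop _) m
    rw [hG, measure_cdf, Measure.map_apply hY measurableSet_Ici] at e
    change _ ≤ μ (Y ⁻¹' Set.Ici m)
    rw [e, half]
    apply ENNReal.ofReal_le_ofReal
    linarith
  · rw [hG, cdf_eq_real, measureReal_def, Measure.map_apply hY measurableSet_Iic] at h3
    change _ ≤ μ (Y ⁻¹' Set.Iic m)
    rw [half]
    exact ENNReal.ofReal_le_of_le_toReal h3

noncomputable def Kc (C b C₀ : ℝ) : ℝ :=
  2 * (C * ∫ t in Set.Ioi (0:ℝ), t ^ (1:ℝ) * Real.exp (-C₀ * t ^ b))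

lemma Kc_nonneg (C b C₀ : ℝ) (hC : 0 < C) : 0 ≤ Kc C b C₀ := by
  unfold Kc
  have : 0 ≤ ∫ t in Set.Ioi (0:ℝ), t ^ (1:ℝ) * Real.exp (-C₀ * t ^ b) := by
    refine setIntegral_nonneg measurableSet_Ioi fun t ht => ?_
    have : (0:ℝ) < t := ht
    positivity
  positivity

lemma second_moment {Ω : Type*} [MeasurableSpace Ω] (μ : Measure Ω) [IsProbabilityMeasure μ]
    (Y : Ω → ℝ) (hY : Measurable Y) (m : ℝ) (C b C₀ : ℝ) (hC : 0 < C) (hb : 0 < b) (hC₀ : 0 < C₀)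
    (q cc : ℝ) (hq : 0 < q) (hcc : C₀ * q ^ (b / 2) ≤ cc)
    (h : ∀ t : ℝ, 0 < t → (μ {ω | t < |Y ω - m|}).toReal ≤ C * Real.exp (-cc * t ^ b)) :
    Integrable (fun ω => (Y ω - m) ^ 2) μ ∧ ∫ ω, (Y ω - m) ^ 2 ∂μ ≤ Kc C b C₀ / q := by
  set W : Ω → ℝ := fun ω => Real.sqrt q * |Y ω - m| with hW
  have hsq : 0 < Real.sqrt q := Real.sqrt_pos.mpr hq
  have hWm : Measurable W := by fun_prop
  have htail : ∀ t : ℝ, 0 < t → μ {ω | t < W ω} ≤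
      ENNReal.ofReal (C * Real.exp (-C₀ * t ^ b)) := by
    intro t ht
    have e : {ω | t < W ω} = {ω | t / Real.sqrt q < |Y ω - m|} := by
      ext ω
      simp only [hW, Set.mem_ofPred_eq, div_lt_iff₀ hsq]
      rw [mul_comm]
    rw [e]
    refine ENNReal.le_ofReal_iff_toReal_le (measure_ne_top _ _) (by positivity) |>.mpr ?_
    refine (h _ (by positivity)).trans ?_
    have e2 : q ^ (b / 2) * (t / Real.sqrt q) ^ b = t ^ b := by
      rw [Real.div_rpow ht.le hsq.le, Real.sqrt_eq_rpow, ← Real.rpow_mul hq.le,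
        show 1 / 2 * b = b / 2 by ring]
      have : q ^ (b / 2) ≠ 0 := (Real.rpow_pos_of_pos hq _).ne'
      field_simp
    have e3 : C₀ * t ^ b ≤ cc * (t / Real.sqrt q) ^ b := by
      rw [← e2, ← mul_assoc]
      gcongr
    gcongr C * Real.exp ?_
    linarith
  have hlin : ∫⁻ ω, ENNReal.ofReal (W ω ^ (2:ℝ)) ∂μ ≤ ENNReal.ofReal (Kc C b C₀) := by
    rw [lintegral_rpow_eq_lintegral_meas_lt_mul μ
      (Eventually.of_forall fun ω => by positivity) hWm.aemeasurable (by norm_num : (0:ℝ) < 2)]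
    have hint := (integrableOn_rpow_mul_exp_neg_mul_rpow (s := 1) (by norm_num) hb hC₀).const_mul C
    unfold Kc
    rw [ENNReal.ofReal_mul (by norm_num), ← integral_const_mul,
      ofReal_integral_eq_lintegral_ofReal hint]
    · gcongr 1
      refine setLIntegral_mono' measurableSet_Ioi fun t ht => ?_
      have ht' : (0:ℝ) < t := ht
      calc _ ≤ ENNReal.ofReal (C * Real.exp (-C₀ * t ^ b)) * ENNReal.ofReal (t ^ ((2:ℝ) - 1)) := by
              gcongr
              exact htail t ht
        _ = _ := by
              rw [← ENNReal.ofReal_mul (by positivity)]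
              congr 1
              norm_num
              ring
    · refine (ae_restrict_iff' measurableSet_Ioi).mpr (Eventually.of_forall fun t ht => ?_)
      have ht' : (0:ℝ) < t := ht
      simp only [Pi.zero_apply]
      positivity
  have hW2 : ∀ ω, W ω ^ (2:ℝ) = q * (Y ω - m) ^ 2 := by
    intro ω
    rw [Real.rpow_two, hW]
    simp only [mul_pow, Real.sq_sqrt hq.le, sq_abs]
  simp only [hW2] at hlin
  have hi : Integrable (fun ω => q * (Y ω - m) ^ 2) μ := by
    refine ⟨by fun_prop, ?_⟩
    rw [hasFiniteIntegral_iff_ofReal (Eventually.of_forall fun ω => by positivity)]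
    exact hlin.trans_lt ENNReal.ofReal_lt_top
  have hi2 : Integrable (fun ω => (Y ω - m) ^ 2) μ := by
    have := hi.const_mul q⁻¹
    simpa [← mul_assoc, inv_mul_cancel₀ hq.ne'] using this
  refine ⟨hi2, ?_⟩
  rw [← ofReal_integral_eq_lintegral_ofReal hi (Eventually.of_forall fun ω => by positivity),
    ENNReal.ofReal_le_ofReal_iff (Kc_nonneg C b C₀ hC), integral_const_mul] at hlin
  rw [le_div_iff₀ hq]; linarith

lemma cond_bound {Ω α β : Type*} [MeasurableSpace Ω] [MeasurableSpace α] [MeasurableSpace β]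
    (μ : Measure Ω) [IsProbabilityMeasure μ] (X : Ω → α) (Y : Ω → β) (hX : Measurable X)
    (hY : Measurable Y) (hXY : IndepFun X Y μ) (S : Set (α × β)) (hS : MeasurableSet S) (D : ℝ≥0∞)
    (h : ∀ v, μ {ω | (v, Y ω) ∈ S} ≤ D) : μ {ω | (X ω, Y ω) ∈ S} ≤ D := by
  have : IsProbabilityMeasure (μ.map X) := Measure.isProbabilityMeasure_map hX.aemeasurable
  have e := (indepFun_iff_map_prod_eq_prod_map_map hX.aemeasurable hY.aemeasurable).mp hXY
  have e2 : μ {ω | (X ω, Y ω) ∈ S} = (μ.map (fun ω => (X ω, Y ω))) S := by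
    rw [Measure.map_apply (hX.prodMk hY) hS]; rfl
  rw [e2, e, Measure.prod_apply hS]
  calc _ ≤ ∫⁻ _, D ∂(μ.map X) := by
        refine lintegral_mono fun v => ?_
        rw [Measure.map_apply hY (measurable_prodMk_left hS)]
        exact h v
    _ = D := by simp

lemma chernoff {Ω ι : Type*} [MeasurableSpace Ω] (μ : Measure Ω) [IsProbabilityMeasure μ]
    (Y : ι → Ω → ℝ) (hY : ∀ i, Measurable (Y i)) (hI : iIndepFun Y μ)
    (h0 : ∀ i ω, 0 ≤ Y i ω) (h1 : ∀ i ω, Y i ω ≤ 1) (s : Finset ι) (q : ℝ)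
    (hq : ∀ i ∈ s, ∫ ω, Y i ω ∂μ ≤ q) (r : ℝ) :
    μ {ω | r ≤ ∑ i ∈ s, Y i ω} ≤ ENNReal.ofReal (Real.exp (-r + 2 * q * s.card)) := by
  have hexp : ∀ i, Integrable (fun ω => Real.exp (1 * Y i ω)) μ := by
    intro i
    refine Integrable.of_bound (C := Real.exp 1) (by fun_prop) (Eventually.of_forall fun ω => ?_)
    rw [Real.norm_eq_abs, Real.abs_exp, Real.exp_le_exp, one_mul]
    exact h1 i ω
  have hYi : ∀ i, Integrable (Y i) μ := by
    intro i
    refine Integrable.of_bound (C := 1) (by fun_prop) (Eventually.of_forall fun ω => ?_)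
    rw [Real.norm_eq_abs, abs_of_nonneg (h0 i ω)]
    exact h1 i ω
  have hmgf : ∀ i ∈ s, mgf (Y i) μ 1 ≤ Real.exp (2 * q) := by
    intro i hi
    have : mgf (Y i) μ 1 ≤ ∫ ω, (1 + 2 * Y i ω) ∂μ := by
      refine integral_mono (hexp i) ((integrable_const _).add ((hYi i).const_mul 2)) fun ω => ?_
      have := Real.abs_exp_sub_one_le (x := Y i ω) (by rw [abs_of_nonneg (h0 i ω)]; exact h1 i ω)
      rw [abs_of_nonneg (h0 i ω)] at this
      have := (abs_le.mp this).2
      simp only [one_mul]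
      linarith
    rw [integral_add (integrable_const _) ((hYi i).const_mul 2), integral_const_mul] at this
    simp only [integral_const, probReal_univ, smul_eq_mul, mul_one] at this
    have := hq i hi
    have := Real.add_one_le_exp (2 * q)
    linarith
  have hch := measure_ge_le_exp_mul_mgf (μ := μ) (X := ∑ i ∈ s, Y i) (t := 1) r (by norm_num)
    (hI.integrable_exp_mul_sum hY (fun i _ => hexp i))
  rw [hI.mgf_sum hY] at hch
  have hprod : ∏ i ∈ s, mgf (Y i) μ 1 ≤ Real.exp (2 * q * s.card) := by
    calc _ ≤ ∏ i ∈ s, Real.exp (2 * q) := Finset.prod_le_prod (fun i _ => mgf_nonneg) hmgf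
      _ = _ := by rw [Finset.prod_const, ← Real.exp_nat_mul]; ring_nf
  refine ENNReal.le_ofReal_iff_toReal_le (measure_ne_top _ _) (by positivity) |>.mpr ?_
  have e : {ω | r ≤ ∑ i ∈ s, Y i ω} = {ω | r ≤ (∑ i ∈ s, Y i) ω} := by
    ext ω; simp
  rw [e, Real.exp_add]
  refine hch.trans ?_
  rw [neg_one_mul]
  gcongr

lemma bc_lemma {Ω : Type*} [MeasurableSpace Ω] (μ : Measure Ω) [IsProbabilityMeasure μ]
    (p : ℕ → ℕ) (γ : ℝ) (hγ : 0 < γ)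
    (hpγ : Tendsto (fun n => (p n : ℝ) / (n : ℝ)) atTop (nhds γ))
    (s : (n : ℕ) → Fin n → Fin n → Set Ω) (D a σ : ℝ) (hD : 0 < D) (ha : 0 < a) (hσ : 0 < σ)
    (h : ∀ᶠ n in atTop, ∀ i j, μ (s n i j) ≤ ENNReal.ofReal (D * Real.exp (-a * (p n : ℝ) ^ σ))) :
    ∀ᵐ ω ∂μ, ∀ᶠ n in atTop, ∀ i j, ω ∉ s n i j := by
  set a' := a * (γ / 2) ^ σ with ha'
  have ha'0 : 0 < a' := by positivity
  have hpn : ∀ᶠ n : ℕ in atTop, γ / 2 * n ≤ p n := by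
    filter_upwards [hpγ.eventually (lt_mem_nhds (show γ / 2 < γ by linarith)),
      eventually_gt_atTop 0] with n hn h0
    have : (0:ℝ) < n := by exact_mod_cast h0
    rw [lt_div_iff₀ this] at hn
    exact hn.le
  have hlo : ∀ᶠ n : ℕ in atTop, (n:ℝ) ^ (4:ℕ) ≤ Real.exp (a' * (n:ℝ) ^ σ) := by
    have h1 := (isLittleO_rpow_exp_pos_mul_atTop (4 / σ) ha'0).bound (show (0:ℝ) < 1 by norm_num)
    have h2 : Tendsto (fun n : ℕ => (n:ℝ) ^ σ) atTop atTop :=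
      (tendsto_rpow_atTop hσ).comp tendsto_natCast_atTop_atTop
    filter_upwards [h2.eventually h1] with n hn
    rw [← Real.rpow_mul (by positivity), mul_div_cancel₀ _ hσ.ne', one_mul, Real.norm_eq_abs,
      Real.norm_eq_abs, Real.abs_exp, abs_of_nonneg (by positivity)] at hn
    exact_mod_cast hn
  have hS : ∀ᶠ n : ℕ in atTop, μ (⋃ i, ⋃ j, s n i j) ≤ ENNReal.ofReal (D * (1 / (n:ℝ) ^ 2)) := by
    filter_upwards [h, hpn, hlo, eventually_gt_atTop 0] with n h1 h2 h3 h0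
    have hn : (0:ℝ) < n := by exact_mod_cast h0
    have hb : D * Real.exp (-a * (p n : ℝ) ^ σ) ≤ D * (1 / (n:ℝ) ^ 4) := by
      have e : a' * (n:ℝ) ^ σ ≤ a * (p n : ℝ) ^ σ := by
        rw [ha', mul_assoc, ← Real.mul_rpow (by positivity) (by positivity)]
        gcongr
      rw [neg_mul, Real.exp_neg, ← one_div]
      gcongr
      exact h3.trans (Real.exp_le_exp.mpr e)
    calc μ (⋃ i, ⋃ j, s n i j) ≤ ∑ i, μ (⋃ j, s n i j) := measure_iUnion_fintype_le _ _
      _ ≤ ∑ i, ∑ j, μ (s n i j) := Finset.sum_le_sum fun i _ => measure_iUnion_fintype_le _ _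
      _ ≤ ∑ i : Fin n, ∑ j : Fin n, ENNReal.ofReal (D * (1 / (n:ℝ) ^ 4)) :=
          Finset.sum_le_sum fun i _ => Finset.sum_le_sum fun j _ =>
            (h1 i j).trans (ENNReal.ofReal_le_ofReal hb)
      _ = ENNReal.ofReal (D * (1 / (n:ℝ) ^ 2)) := by
          simp only [Finset.sum_const, Finset.card_univ, Fintype.card_fin, nsmul_eq_mul]
          rw [← ENNReal.ofReal_natCast, ← ENNReal.ofReal_mul (by positivity),
            ← ENNReal.ofReal_mul (by positivity)]
          congr 1
          field_simp
  obtain ⟨N, hN⟩ := eventually_atTop.mp hS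
  have hsum : ∑' n, μ (if N ≤ n then ⋃ i, ⋃ j, s n i j else ∅) ≠ ∞ := by
    have hs : Summable (fun n : ℕ => D * (1 / (n:ℝ) ^ 2)) :=
      (Real.summable_one_div_nat_pow.mpr (by norm_num)).mul_left D
    refine ne_top_of_le_ne_top hs.tsum_ofReal_ne_top (ENNReal.tsum_le_tsum fun n => ?_)
    split_ifs with hn
    · exact hN n hn
    · simp
  filter_upwards [ae_eventually_notMem hsum] with ω hω
  filter_upwards [hω, eventually_ge_atTop N] with n hn hNn i j hij
  rw [if_pos hNn] at hn
  exact hn (Set.mem_iUnion.mpr ⟨i, Set.mem_iUnion.mpr ⟨j, hij⟩⟩)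

lemma det_lemma (G : (n : ℕ) → Fin n → Fin n → ℝ) (a : ℕ → ℝ) (ha : Tendsto a atTop (nhds 0))
    (L : ℝ) (hL : 0 ≤ L)
    (h1 : ∀ᶠ n in atTop, ∀ i, |G n i i - 1| ≤ a n)
    (h2 : ∀ᶠ n in atTop, ∀ i j, i ≠ j → |G n i j| ≤ a n)
    (h3 : ∀ᶠ n in atTop, ∀ i, ∑ j ∈ Finset.univ.erase i, (G n i j) ^ 2 ≤ L)
    (f : ℝ → ℝ) (f'0 : ℝ) (hf0 : HasDerivAt f f'0 0) (hf1 : ContinuousAt f 1) :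
    Tendsto (fun n : ℕ => (n : ℝ)⁻¹ * ∑ i, ∑ j, (f (G n i j) -
      ((f 1 - f 0 - f'0) * (if i = j then 1 else 0) + f'0 * G n i j) - f 0) ^ 2) atTop (nhds 0) := by
  rw [Metric.tendsto_nhds]
  intro η hη
  set ε := Real.sqrt (η / (2 * (1 + L))) with hε
  have hε0 : 0 < ε := Real.sqrt_pos.mpr (by positivity)
  have hεsq : ε ^ 2 * (1 + L) = η / 2 := by
    rw [hε, Real.sq_sqrt (by positivity)]; field_simp
  have d0 : ∀ᶠ x in nhds (0:ℝ), |f x - f 0 - f'0 * x| ≤ ε * |x| := by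
    have := (hasDerivAt_iff_isLittleO.mp hf0).bound hε0
    filter_upwards [this] with x hx
    simpa [mul_comm] using hx
  have d1 : ∀ᶠ x in nhds (1:ℝ), |f x - f 1 - f'0 * (x - 1)| ≤ ε := by
    have hc : ContinuousAt (fun x => |f x - f 1 - f'0 * (x - 1)|) 1 := by fun_prop
    have := hc.eventually (gt_mem_nhds (show |f 1 - f 1 - f'0 * (1 - 1)| < ε by simpa using hε0))
    filter_upwards [this] with x hx using hx.le
  obtain ⟨δ0, hδ0, d0⟩ := Metric.eventually_nhds_iff.mp d0
  obtain ⟨δ1, hδ1, d1⟩ := Metric.eventually_nhds_iff.mp d1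
  filter_upwards [h1, h2, h3, ha.eventually (gt_mem_nhds hδ0), ha.eventually (gt_mem_nhds hδ1),
    eventually_gt_atTop 0] with n h1 h2 h3 ha0 ha1 hn0
  have hn : (0:ℝ) < n := by exact_mod_cast hn0
  have hrow : ∀ i, ∑ j, (f (G n i j) -
      ((f 1 - f 0 - f'0) * (if i = j then 1 else 0) + f'0 * G n i j) - f 0) ^ 2 ≤ η / 2 := by
    intro i
    rw [← Finset.add_sum_erase _ _ (Finset.mem_univ i), ← hεsq, mul_add, mul_one]
    refine add_le_add ?_ ?_
    · have := d1 (y := G n i i) (by rw [Real.dist_eq]; exact (h1 i).trans_lt ha1)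
      have e : f (G n i i) - ((f 1 - f 0 - f'0) * (if i = i then 1 else 0) + f'0 * G n i i) - f 0
        = f (G n i i) - f 1 - f'0 * (G n i i - 1) := by simp; ring
      rw [e, ← sq_abs]
      exact pow_le_pow_left₀ (abs_nonneg _) this 2
    · calc _ ≤ ∑ j ∈ Finset.univ.erase i, ε ^ 2 * (G n i j) ^ 2 := by
            refine Finset.sum_le_sum fun j hj => ?_
            have hij : i ≠ j := (Finset.ne_of_mem_erase hj).symm
            have := d0 (y := G n i j) (by rw [Real.dist_eq, sub_zero]; exact (h2 i j hij).trans_lt ha0)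
            rw [if_neg hij]
            have e : f (G n i j) - ((f 1 - f 0 - f'0) * 0 + f'0 * G n i j) - f 0
              = f (G n i j) - f 0 - f'0 * G n i j := by ring
            rw [e, ← sq_abs, ← sq_abs (G n i j), ← mul_pow]
            exact pow_le_pow_left₀ (abs_nonneg _) this 2
        _ = ε ^ 2 * ∑ j ∈ Finset.univ.erase i, (G n i j) ^ 2 := by rw [Finset.mul_sum]
        _ ≤ _ := by gcongr; exact h3 i
  rw [Real.dist_eq, sub_zero, abs_of_nonneg (by positivity)]
  calc _ ≤ (n:ℝ)⁻¹ * ∑ i : Fin n, η / 2 := by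
        gcongr with i _
        exact hrow i
    _ = η / 2 := by simp; field_simp
    _ < η := by linarith

lemma sq_expand {Ω : Type*} [MeasurableSpace Ω] (μ : Measure Ω) [IsProbabilityMeasure μ]
    (Y : Ω → ℝ) (hY : Integrable Y μ) (hY2 : Integrable (fun ω => Y ω ^ 2) μ) (k : ℝ) :
    ∫ ω, (Y ω - k) ^ 2 ∂μ = ∫ ω, Y ω ^ 2 ∂μ - 2 * k * ∫ ω, Y ω ∂μ + k ^ 2 := by
  have h : (fun ω => (Y ω - k) ^ 2) = fun ω => (Y ω ^ 2 - 2 * k * Y ω) + k ^ 2 := by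
    ext ω; ring
  have i1 : Integrable (fun ω => 2 * k * Y ω) μ := hY.const_mul _
  have i2 : Integrable (fun ω => Y ω ^ 2 - 2 * k * Y ω) μ := hY2.sub i1
  rw [h, integral_add i2 (integrable_const _), integral_sub hY2 i1, integral_const_mul]
  simp

lemma vec_facts {Ω : Type*} [MeasurableSpace Ω] (μ : Measure Ω) [IsProbabilityMeasure μ]
    {d : ℕ} (hd : 0 < d) (X : Ω → EuclideanSpace ℝ (Fin d)) (hX : Measurable X)
    (hmean : ∫ ω, X ω ∂μ = 0) (hnorm : ∫ ω, ‖X ω‖ ^ 2 ∂μ = 1)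
    (C b C₀ cc : ℝ) (hC : 0 < C) (hb : 0 < b) (hC₀ : 0 < C₀) (hc : C₀ * (d : ℝ) ^ (b / 2) ≤ cc)
    (hconc : ∀ (F : EuclideanSpace ℝ (Fin d) → ℝ), LipschitzWith 1 F →
      ∀ m : ℝ, (1 / 2 : ℝ≥0∞) ≤ μ {ω | m ≤ F (X ω)} →
        (1 / 2 : ℝ≥0∞) ≤ μ {ω | F (X ω) ≤ m} →
        ∀ t : ℝ, 0 < t →
          (μ {ω | t < |F (X ω) - m|}).toReal ≤ C * Real.exp (-cc * t ^ b)) :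
    (∀ v, Integrable (fun ω => (inner ℝ v (X ω)) ^ 2) μ ∧
      ∫ ω, (inner ℝ v (X ω)) ^ 2 ∂μ ≤ Kc C b C₀ / d * ‖v‖ ^ 2) ∧
    (∀ t : ℝ, 0 < t → Kc C b C₀ / d ≤ t ^ 2 →
      (∀ v, μ {ω | 2 * t * ‖v‖ < |inner ℝ v (X ω)|} ≤ ENNReal.ofReal (C * Real.exp (-cc * t ^ b)))
      ∧ μ {ω | 2 * t < |‖X ω‖ - 1|} ≤ ENNReal.ofReal (C * Real.exp (-cc * t ^ b))) := by
  have hdR : (0:ℝ) < d := by exact_mod_cast hd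
  have hn2 : Integrable (fun ω => ‖X ω‖ ^ 2) μ := by
    by_contra h
    rw [integral_undef h] at hnorm
    norm_num at hnorm
  have hL2 : MemLp X 2 μ := (memLp_two_iff_integrable_sq_norm hX.aestronglyMeasurable).mpr hn2
  have hI : Integrable X μ := hL2.integrable (by norm_num)
  -- the linear case, unit vectors
  have hlin : ∀ v : EuclideanSpace ℝ (Fin d), ‖v‖ = 1 →
      (Integrable (fun ω => (inner ℝ v (X ω)) ^ 2) μ ∧
      ∫ ω, (inner ℝ v (X ω)) ^ 2 ∂μ ≤ Kc C b C₀ / d) ∧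
      ∀ t : ℝ, 0 < t → Kc C b C₀ / d ≤ t ^ 2 →
      μ {ω | 2 * t < |inner ℝ v (X ω)|} ≤ ENNReal.ofReal (C * Real.exp (-cc * t ^ b)) := by
    intro v hv
    set Y : Ω → ℝ := fun ω => inner ℝ v (X ω) with hY
    have hYm : Measurable Y := by fun_prop
    obtain ⟨m, hm1, hm2⟩ := exists_median μ Y hYm
    have hlip : LipschitzWith 1 (fun x : EuclideanSpace ℝ (Fin d) => inner ℝ v x) := by
      refine LipschitzWith.of_dist_le_mul fun x y => ?_
      rw [Real.dist_eq, ← inner_sub_right, dist_eq_norm]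
      have := abs_real_inner_le_norm v (x - y)
      simpa [hv] using this
    have hcon := hconc _ hlip m hm1 hm2
    obtain ⟨hi, hle⟩ := second_moment μ Y hYm m C b C₀ hC hb hC₀ d cc hdR hc hcon
    have hYI : Integrable Y μ := hI.const_inner v
    have hY0 : ∫ ω, Y ω ∂μ = 0 := by
      rw [hY, integral_inner hI, hmean, inner_zero_right]
    have hYsq : Integrable (fun ω => (Y ω) ^ 2) μ := by
      have : (fun ω => (Y ω) ^ 2) = fun ω => (Y ω - m) ^ 2 + (2 * m * Y ω - m ^ 2) := by
        ext ω; ring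
      rw [this]
      exact hi.add ((hYI.const_mul _).sub (integrable_const _))
    have hexp : ∫ ω, (Y ω - m) ^ 2 ∂μ = ∫ ω, (Y ω) ^ 2 ∂μ + m ^ 2 := by
      rw [sq_expand μ Y hYI hYsq, hY0]; ring
    have hYsq0 : 0 ≤ ∫ ω, (Y ω) ^ 2 ∂μ := integral_nonneg fun ω => by positivity
    refine ⟨⟨hYsq, by nlinarith [sq_nonneg m]⟩, fun t ht hKt => ?_⟩
    have hmt : |m| ≤ t := by
      rw [← abs_of_pos ht]; exact sq_le_sq.mp (by linarith)
    refine le_trans (measure_mono ?_)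
      ((ENNReal.le_ofReal_iff_toReal_le (measure_ne_top _ _) (by positivity)).mpr (hcon t ht))
    intro ω hω
    have hω' : 2 * t < |Y ω| := hω
    change t < |Y ω - m|
    have := abs_sub_abs_le_abs_sub (Y ω) m
    linarith
  have hscale : ∀ v : EuclideanSpace ℝ (Fin d), v ≠ 0 → ∃ u : EuclideanSpace ℝ (Fin d), ‖u‖ = 1 ∧
      ∀ x, inner ℝ v x = ‖v‖ * inner ℝ u x := by
    intro v hv
    have hv' : ‖v‖ ≠ 0 := norm_ne_zero_iff.mpr hv
    refine ⟨‖v‖⁻¹ • v, norm_smul_inv_norm hv, fun x => ?_⟩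
    rw [real_inner_smul_left, ← mul_assoc, mul_inv_cancel₀ hv', one_mul]
  refine ⟨fun v => ?_, fun t ht hKt => ⟨fun v => ?_, ?_⟩⟩
  · by_cases hv : v = 0
    · subst hv; simp
    obtain ⟨u, hu, hvu⟩ := hscale v hv
    obtain ⟨⟨h1, h2⟩, -⟩ := hlin u hu
    simp only [hvu, mul_pow]
    refine ⟨h1.const_mul _, ?_⟩
    rw [integral_const_mul, mul_comm]
    gcongr
  · by_cases hv : v = 0
    · subst hv; simp
    obtain ⟨u, hu, hvu⟩ := hscale v hv
    have hv' : 0 < ‖v‖ := norm_pos_iff.mpr hv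
    refine le_trans (measure_mono ?_) ((hlin u hu).2 t ht hKt)
    intro ω hω
    have hω' : 2 * t * ‖v‖ < |inner ℝ v (X ω)| := hω
    rw [hvu, abs_mul, abs_of_pos hv', mul_comm] at hω'
    exact lt_of_mul_lt_mul_left hω' hv'.le
  · set Y : Ω → ℝ := fun ω => ‖X ω‖ with hY
    have hYm : Measurable Y := by fun_prop
    obtain ⟨m, hm1, hm2⟩ := exists_median μ Y hYm
    have hcon := hconc _ lipschitzWith_one_norm m hm1 hm2
    obtain ⟨hi, hle⟩ := second_moment μ Y hYm m C b C₀ hC hb hC₀ d cc hdR hc hcon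
    have hm0 : 0 ≤ m := by
      by_contra h
      push Not at h
      have : {ω | Y ω ≤ m} = ∅ := by
        ext ω
        simp only [Set.mem_ofPred_eq, Set.mem_empty_iff_false, iff_false, not_le]
        exact h.trans_le (norm_nonneg _)
      rw [this] at hm2
      simp at hm2
    have hYI : Integrable Y μ := hI.norm
    have hexp : ∀ k : ℝ, ∫ ω, (Y ω - k) ^ 2 ∂μ = 1 - 2 * k * ∫ ω, Y ω ∂μ + k ^ 2 := by
      intro k
      rw [sq_expand μ Y hYI hn2, hnorm]
    have hY1 : ∫ ω, Y ω ∂μ ≤ 1 := by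
      have h0 : 0 ≤ ∫ ω, (Y ω - 1) ^ 2 ∂μ := integral_nonneg fun ω => by positivity
      rw [hexp] at h0
      linarith
    have hmt : |m - 1| ≤ t := by
      rw [← abs_of_pos ht]
      apply sq_le_sq.mp
      rw [hexp] at hle
      nlinarith
    refine le_trans (measure_mono ?_)
      ((ENNReal.le_ofReal_iff_toReal_le (measure_ne_top _ _) (by positivity)).mpr (hcon t ht))
    intro ω hω
    have hω' : 2 * t < |Y ω - 1| := hω
    change t < |Y ω - m|
    have := abs_sub_le (Y ω) m 1
    linarith

lemma row_bound {Ω : Type*} [MeasurableSpace Ω] (μ : Measure Ω) [IsProbabilityMeasure μ]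
    {n d : ℕ} (hd : 0 < d) (X : Fin n → Ω → EuclideanSpace ℝ (Fin d)) (hX : ∀ i, Measurable (X i))
    (hI : iIndepFun X μ) (K M : ℝ) (hK : 0 ≤ K) (hM : 0 < M)
    (h2 : ∀ i v, Integrable (fun ω => (inner ℝ v (X i ω)) ^ 2) μ ∧
      ∫ ω, (inner ℝ v (X i ω)) ^ 2 ∂μ ≤ K / d * ‖v‖ ^ 2) (i : Fin n) :
    μ {ω | n * (2 * K + 1) * ‖X i ω‖ ^ 2 < ∑ j ∈ Finset.univ.erase i,
      min (d * (inner ℝ (X i ω) (X j ω)) ^ 2) (M * ‖X i ω‖ ^ 2)} ≤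
      ENNReal.ofReal (Real.exp (-(n / M))) := by
  have hdR : (0:ℝ) < d := by exact_mod_cast hd
  set T : Finset (Fin n) := Finset.univ.erase i with hT
  have hind := hI.indepFun_finset {i} T (by simp [hT]) hX
  have hind2 : IndepFun (X i) (fun ω (j : T) => X j ω) μ := by
    have hφ : Measurable (fun g : (({i} : Finset (Fin n)) → EuclideanSpace ℝ (Fin d)) =>
      g ⟨i, by simp⟩) := measurable_pi_apply _
    have := hind.comp hφ measurable_id
    exact this
  set S : Set (EuclideanSpace ℝ (Fin d) × (T → EuclideanSpace ℝ (Fin d))) :=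
    {x | n * (2 * K + 1) * ‖x.1‖ ^ 2 < ∑ j : T,
      min (d * (inner ℝ x.1 (x.2 j)) ^ 2) (M * ‖x.1‖ ^ 2)} with hS
  have hSm : MeasurableSet S := by
    apply measurableSet_lt <;> fun_prop
  have key := cond_bound μ (X i) (fun ω (j : T) => X j ω) (hX i) (by fun_prop) hind2 S hSm
    (ENNReal.ofReal (Real.exp (-(n / M)))) ?_
  · refine le_trans (le_of_eq ?_) key
    congr 1
    ext ω
    simp only [hS, Set.mem_ofPred_eq]
    rw [Finset.sum_coe_sort T (fun j => min (d * (inner ℝ (X i ω) (X j ω)) ^ 2) (M * ‖X i ω‖ ^ 2))]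
  intro v
  by_cases hv : v = 0
  · subst hv
    simp [hS]
  have hv' : 0 < ‖v‖ ^ 2 := by have := norm_pos_iff.mpr hv; positivity
  set g : EuclideanSpace ℝ (Fin d) → ℝ := fun x => min (d * (inner ℝ v x) ^ 2 / (M * ‖v‖ ^ 2)) 1
    with hg
  have hgm : Measurable g := by fun_prop
  have hch := chernoff μ (fun j => g ∘ X j) (fun j => hgm.comp (hX j)) (hI.comp _ fun _ => hgm)
    (fun j ω => by simp only [hg, Function.comp]; positivity)
    (fun j ω => by simp only [hg, Function.comp]; exact min_le_right _ _) T (K / M) ?_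
    (n * (2 * K + 1) / M)
  · refine le_trans (measure_mono ?_) (hch.trans (ENNReal.ofReal_le_ofReal
      (Real.exp_le_exp.mpr ?_)))
    · intro ω hω
      have hω' : n * (2 * K + 1) * ‖v‖ ^ 2 < ∑ j : T,
        min (d * (inner ℝ v (X j ω)) ^ 2) (M * ‖v‖ ^ 2) := hω
      rw [Finset.sum_coe_sort T (fun j => min (d * (inner ℝ v (X j ω)) ^ 2) (M * ‖v‖ ^ 2))] at hω'
      change n * (2 * K + 1) / M ≤ ∑ j ∈ T, g (X j ω)
      have e : ∀ j, min (d * (inner ℝ v (X j ω)) ^ 2) (M * ‖v‖ ^ 2) = g (X j ω) * (M * ‖v‖ ^ 2) := by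
        intro j
        simp only [hg]
        rw [min_mul_of_nonneg _ _ (by positivity), one_mul, div_mul_cancel₀ _ (by positivity)]
      simp only [e] at hω'
      rw [← Finset.sum_mul, ← mul_assoc] at hω'
      rw [div_le_iff₀ hM]
      exact (lt_of_mul_lt_mul_right hω' hv'.le).le
    · have hcard : (T.card : ℝ) ≤ n := by
        have := Finset.card_le_univ T
        rw [Fintype.card_fin] at this
        exact_mod_cast this
      have : 2 * (K / M) * T.card ≤ 2 * (K / M) * n := by gcongr
      have e : -(n * (2 * K + 1) / M) + 2 * (K / M) * n = -(n / M) := by field_simp; ring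
      linarith
  · intro j _
    obtain ⟨hi, hle⟩ := h2 j v
    calc ∫ ω, (g ∘ X j) ω ∂μ ≤ ∫ ω, d / (M * ‖v‖ ^ 2) * (inner ℝ v (X j ω)) ^ 2 ∂μ := by
          refine integral_mono_of_nonneg (Eventually.of_forall fun ω => ?_) (hi.const_mul _)
            (Eventually.of_forall fun ω => ?_)
          · simp only [hg, Function.comp, Pi.zero_apply]; positivity
          · simp only [hg, Function.comp]
            refine (min_le_left _ _).trans (le_of_eq (by ring))
      _ = d / (M * ‖v‖ ^ 2) * ∫ ω, (inner ℝ v (X j ω)) ^ 2 ∂μ := integral_const_mul _ _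
      _ ≤ d / (M * ‖v‖ ^ 2) * (K / d * ‖v‖ ^ 2) := by gcongr
      _ = K / M := by field_simp


/-- Theorem 1.1(i) in the high-concentration setting (inner-product kernel, diagonal
included): `X_1, …, X_n ∈ ℝ^p` are iid, normalized by `E[X_i] = 0`, `E‖X_i‖² = 1`,
whose distribution satisfies the concentration property: for absolute constants
`C, b > 0` and a rate `c(p) ≥ C₀ p^{b/2}`, for every `1`-Lipschitz `F : ℝ^p → ℝ` and
every median `m_F` of `F(X_i)`, `P(|F(X_i) − m_F| > t) ≤ C exp(−c(p) t^b)` for `t > 0`.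
If `f` is differentiable at `0` and continuous at `1`, `A_{ij} = f(X_i^T X_j)` and
`B = (f(1) − f(0) − f′(0)) I_n + f′(0) (X_i^T X_j)_{ij}`, then almost surely
`m_A(z) − m_B(z) → 0` for every `z` in the upper half-plane, i.e. `A` and `B` have the
same limiting spectral distribution. -/
theorem inner_product_kernel_concentration_diagonal
    {Ω : Type*} [MeasureSpace Ω] [IsProbabilityMeasure (ℙ : Measure Ω)]
    -- the dimension p = p(n) → ∞ with p/n → γ ∈ (0,∞)
    (p : ℕ → ℕ) (γ : ℝ) (hγ : 0 < γ)
    (hp : Tendsto (fun n => (p n : ℝ)) atTop atTop)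
    (hpγ : Tendsto (fun n => (p n : ℝ) / (n : ℝ)) atTop (nhds γ))
    -- the iid random vectors X n 1, ..., X n n in ℝ^(p n)
    (X : (n : ℕ) → Fin n → Ω → EuclideanSpace ℝ (Fin (p n)))
    (hXmeas : ∀ n i, Measurable (X n i))
    (ν : (n : ℕ) → Measure (EuclideanSpace ℝ (Fin (p n))))
    (hindep : ∀ n, iIndepFun (X n) ℙ)
    (hdist : ∀ n (i : Fin n), Measure.map (X n i) ℙ = ν n)
    -- normalization: E[X_i] = 0 and E‖X_i‖² = 1
    (hmean : ∀ n (i : Fin n), ∫ ω, X n i ω ∂(ℙ : Measure Ω) = 0)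
    (hnorm : ∀ n (i : Fin n), ∫ ω, ‖X n i ω‖ ^ 2 ∂(ℙ : Measure Ω) = 1)
    -- the high-concentration property with rate c(p) ≥ C₀ p^(b/2)
    (C b C₀ : ℝ) (hC : 0 < C) (hb : 0 < b) (hC₀ : 0 < C₀) (c : ℕ → ℝ)
    (hc : ∀ q : ℕ, C₀ * (q : ℝ) ^ (b / 2) ≤ c q)
    (hconc : ∀ n (i : Fin n) (F : EuclideanSpace ℝ (Fin (p n)) → ℝ), LipschitzWith 1 F →
      ∀ m : ℝ, (1 / 2 : ℝ≥0∞) ≤ ℙ {ω | m ≤ F (X n i ω)} →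
        (1 / 2 : ℝ≥0∞) ≤ ℙ {ω | F (X n i ω) ≤ m} →
        ∀ t : ℝ, 0 < t →
          (ℙ {ω | t < |F (X n i ω) - m|}).toReal ≤ C * Real.exp (-(c (p n)) * t ^ b))
    -- the envelope f, differentiable at 0 and continuous at 1
    (f : ℝ → ℝ) (f'0 : ℝ) (hf0 : HasDerivAt f f'0 0) (hf1 : ContinuousAt f 1)
    -- the matrices A and B
    (A B : (n : ℕ) → Ω → Matrix (Fin n) (Fin n) ℝ)
    (hA : ∀ n ω i j, A n ω i j = f ⟪X n i ω, X n j ω⟫)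
    (hB : ∀ n ω, B n ω = (f 1 - f 0 - f'0) • (1 : Matrix (Fin n) (Fin n) ℝ)
      + f'0 • Matrix.of (fun i j => ⟪X n i ω, X n j ω⟫)) :
    ∀ᵐ ω ∂(ℙ : Measure Ω), ∀ z : ℂ, 0 < z.im →
      Tendsto (fun n => stieltjesTransform (A n ω) z - stieltjesTransform (B n ω) z)
        atTop (nhds 0) := by
  set K := Kc C b C₀ with hK
  have hK0 : 0 ≤ K := Kc_nonneg C b C₀ hC
  set t : ℕ → ℝ := fun n => (p n : ℝ) ^ (-(1 / 4) : ℝ) with ht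
  have ht0 : Tendsto t atTop (nhds 0) := (tendsto_rpow_neg_atTop (by norm_num)).comp hp
  have hppos : ∀ᶠ n in atTop, 0 < p n := by
    filter_upwards [hp.eventually (eventually_gt_atTop 0)] with n hn
    exact_mod_cast hn
  have hKp : ∀ᶠ n in atTop, K ≤ (p n : ℝ) ^ (1 / 2 : ℝ) :=
    ((tendsto_rpow_atTop (by norm_num : (0:ℝ) < 1 / 2)).comp hp).eventually (eventually_ge_atTop K)
  have hpn1 : ∀ᶠ n : ℕ in atTop, γ / 2 * n ≤ p n := by
    filter_upwards [hpγ.eventually (lt_mem_nhds (show γ / 2 < γ by linarith)),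
      eventually_gt_atTop 0] with n hn h0
    have : (0:ℝ) < n := by exact_mod_cast h0
    rw [lt_div_iff₀ this] at hn
    exact hn.le
  have hpn2 : ∀ᶠ n : ℕ in atTop, (p n : ℝ) ≤ 2 * γ * n := by
    filter_upwards [hpγ.eventually (gt_mem_nhds (show γ < 2 * γ by linarith)),
      eventually_gt_atTop 0] with n hn h0
    have : (0:ℝ) < n := by exact_mod_cast h0
    rw [div_lt_iff₀ this] at hn
    exact hn.le
  have htsq : ∀ n, 0 < p n → t n ^ 2 * (p n : ℝ) ^ (1 / 2 : ℝ) = 1 := by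
    intro n hn
    have hn' : (0:ℝ) < p n := by exact_mod_cast hn
    rw [ht, ← Real.rpow_natCast, ← Real.rpow_mul hn'.le, ← Real.rpow_add hn']
    norm_num
  have hphalf : ∀ n, (p n : ℝ) = (p n : ℝ) ^ (1 / 2 : ℝ) * (p n : ℝ) ^ (1 / 2 : ℝ) := by
    intro n
    rw [← Real.sqrt_eq_rpow, Real.mul_self_sqrt (by positivity)]
  have hfacts := fun n (hn : 0 < p n) (i : Fin n) => vec_facts ℙ hn (X n i) (hXmeas n i) (hmean n i)
    (hnorm n i) C b C₀ (c (p n)) hC hb hC₀ (hc _) (hconc n i)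
  have hKt : ∀ n, 0 < p n → K ≤ (p n : ℝ) ^ (1 / 2 : ℝ) → K / p n ≤ t n ^ 2 := by
    intro n hn h
    have hn' : (0:ℝ) < p n := by exact_mod_cast hn
    rw [div_le_iff₀ hn', hphalf n, ← mul_assoc, htsq n hn, one_mul]
    exact h
  have hexp : ∀ n, 0 < p n → C * Real.exp (-(c (p n)) * t n ^ b) ≤
      C * Real.exp (-C₀ * (p n : ℝ) ^ (b / 4)) := by
    intro n hn
    have hn' : (0:ℝ) < p n := by exact_mod_cast hn
    have e : (p n : ℝ) ^ (b / 4) = (p n : ℝ) ^ (b / 2) * t n ^ b := by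
      rw [ht, ← Real.rpow_mul hn'.le, ← Real.rpow_add hn']
      congr 1; ring
    have : 0 ≤ t n ^ b := by positivity
    have h2 := mul_le_mul_of_nonneg_right (hc (p n)) this
    gcongr C * Real.exp ?_
    rw [e]; linarith
  -- the three families of bad events
  have ae1 := bc_lemma (ℙ : Measure Ω) p γ hγ hpγ
    (fun n i _ => {ω | 2 * t n < |‖X n i ω‖ - 1|}) C C₀ (b / 4) hC hC₀ (by positivity) (by
      filter_upwards [hppos, hKp] with n hn hk i j
      have hn' : (0:ℝ) < p n := by exact_mod_cast hn
      exact (((hfacts n hn i).2 (t n) (Real.rpow_pos_of_pos hn' _) (hKt n hn hk)).2).trans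
        (ENNReal.ofReal_le_ofReal (hexp n hn)))
  have ae2 := bc_lemma (ℙ : Measure Ω) p γ hγ hpγ
    (fun n i j => {ω | i ≠ j ∧ 2 * t n * ‖X n i ω‖ < |inner ℝ (X n i ω) (X n j ω)|})
    C C₀ (b / 4) hC hC₀ (by positivity) (by
      filter_upwards [hppos, hKp] with n hn hk i j
      have hn' : (0:ℝ) < p n := by exact_mod_cast hn
      by_cases hij : i = j
      · simp [hij]
      refine le_trans (measure_mono ?_) (cond_bound ℙ (X n i) (X n j) (hXmeas n i) (hXmeas n j)
        ((hindep n).indepFun hij) {x | 2 * t n * ‖x.1‖ < |inner ℝ x.1 x.2|}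
        (by apply measurableSet_lt <;> fun_prop) _ (fun v =>
        (((hfacts n hn j).2 (t n) (Real.rpow_pos_of_pos hn' _) (hKt n hn hk)).1 v).trans
        (ENNReal.ofReal_le_ofReal (hexp n hn))))
      intro ω hω
      exact hω.2)
  have ae3 := bc_lemma (ℙ : Measure Ω) p γ hγ hpγ
    (fun n i _ => {ω | n * (2 * K + 1) * ‖X n i ω‖ ^ 2 < ∑ j ∈ Finset.univ.erase i,
      min (p n * (inner ℝ (X n i ω) (X n j ω)) ^ 2)
        ((4 * (p n : ℝ) ^ (1 / 2 : ℝ)) * ‖X n i ω‖ ^ 2)})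
    1 (1 / (8 * γ)) (1 / 2) one_pos (by positivity) (by norm_num) (by
      filter_upwards [hppos, hpn2] with n hn hp2 i j
      have hn' : (0:ℝ) < p n := by exact_mod_cast hn
      have hh : 0 < (p n : ℝ) ^ (1 / 2 : ℝ) := Real.rpow_pos_of_pos hn' _
      refine (row_bound ℙ hn (X n) (hXmeas n) (hindep n) K (4 * (p n : ℝ) ^ (1 / 2 : ℝ)) hK0
        (by positivity) (fun i => (hfacts n hn i).1) i).trans (ENNReal.ofReal_le_ofReal ?_)
      rw [one_mul, Real.exp_le_exp, neg_mul, neg_le_neg_iff, le_div_iff₀ (by positivity)]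
      calc 1 / (8 * γ) * (p n : ℝ) ^ (1 / 2 : ℝ) * (4 * (p n : ℝ) ^ (1 / 2 : ℝ))
          = 1 / (2 * γ) * ((p n : ℝ) ^ (1 / 2 : ℝ) * (p n : ℝ) ^ (1 / 2 : ℝ)) := by ring
        _ = 1 / (2 * γ) * p n := by rw [← hphalf n]
        _ ≤ 1 / (2 * γ) * (2 * γ * n) := by gcongr
        _ = n := by field_simp)
  filter_upwards [ae1, ae2, ae3] with ω h1 h2 h3 z hz
  have htle : ∀ᶠ n in atTop, t n < 1 / 2 := ht0.eventually (gt_mem_nhds (by norm_num))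
  have hbase : ∀ᶠ n in atTop, ∀ i, |‖X n i ω‖ - 1| ≤ 2 * t n ∧ ‖X n i ω‖ ≤ 2 := by
    filter_upwards [h1, htle] with n h1 htn i
    have h := h1 i i
    simp only [Set.mem_ofPred_eq, not_lt] at h
    exact ⟨h, by linarith [(abs_le.mp h).2]⟩
  have hdet := det_lemma (fun n i j => inner ℝ (X n i ω) (X n j ω)) (fun n => 6 * t n)
    (by simpa using ht0.const_mul 6) (2 / γ * (2 * K + 1) * 4) (by positivity)
    (by
      filter_upwards [hbase] with n hb i
      obtain ⟨ha, hb⟩ := hb i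
      rw [real_inner_self_eq_norm_sq,
        show ‖X n i ω‖ ^ 2 - 1 = (‖X n i ω‖ - 1) * (‖X n i ω‖ + 1) by ring, abs_mul,
        abs_of_nonneg (a := ‖X n i ω‖ + 1) (by positivity)]
      have : |‖X n i ω‖ - 1| * (‖X n i ω‖ + 1) ≤ 2 * t n * 3 :=
        mul_le_mul ha (by linarith) (by positivity) (by positivity)
      linarith)
    (by
      filter_upwards [hbase, h2] with n hb h2 i j hij
      obtain ⟨ha, hb⟩ := hb i
      have h := h2 i j
      simp only [Set.mem_ofPred_eq, not_and, not_lt] at h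
      have h := h hij
      have htn : 0 ≤ t n := by positivity
      nlinarith)
    (by
      filter_upwards [hbase, h2, h3, hppos, hpn1] with n hb h2 h3 hn hp1 i
      have hn' : (0:ℝ) < p n := by exact_mod_cast hn
      obtain ⟨ha, hb⟩ := hb i
      have h := h3 i i
      simp only [Set.mem_ofPred_eq, not_lt] at h
      have e : ∀ j ∈ Finset.univ.erase i, min (p n * (inner ℝ (X n i ω) (X n j ω)) ^ 2)
          ((4 * (p n : ℝ) ^ (1 / 2 : ℝ)) * ‖X n i ω‖ ^ 2)
          = p n * (inner ℝ (X n i ω) (X n j ω)) ^ 2 := by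
        intro j hj
        apply min_eq_left
        have hij : i ≠ j := (Finset.ne_of_mem_erase hj).symm
        have h := h2 i j
        simp only [Set.mem_ofPred_eq, not_and, not_lt] at h
        have h := pow_le_pow_left₀ (abs_nonneg _) (h hij) 2
        rw [sq_abs] at h
        have hE : (p n : ℝ) * (2 * t n * ‖X n i ω‖) ^ 2
            = (4 * (p n : ℝ) ^ (1 / 2 : ℝ)) * ‖X n i ω‖ ^ 2 := by
          calc _ = (p n : ℝ) * (4 * t n ^ 2 * ‖X n i ω‖ ^ 2) := by ring
            _ = (p n : ℝ) ^ (1 / 2 : ℝ) * (p n : ℝ) ^ (1 / 2 : ℝ) *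
                (4 * t n ^ 2 * ‖X n i ω‖ ^ 2) := by rw [← hphalf n]
            _ = (t n ^ 2 * (p n : ℝ) ^ (1 / 2 : ℝ)) *
                ((4 * (p n : ℝ) ^ (1 / 2 : ℝ)) * ‖X n i ω‖ ^ 2) := by ring
            _ = _ := by rw [htsq n hn, one_mul]
        rw [← hE]
        gcongr
      rw [Finset.sum_congr rfl e, ← Finset.mul_sum] at h
      have hnp : (n : ℝ) ≤ 2 / γ * p n := by
        rw [div_mul_eq_mul_div, le_div_iff₀ hγ]; linarith
      have hx4 : ‖X n i ω‖ ^ 2 ≤ 4 := by nlinarith [norm_nonneg (X n i ω)]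
      refine le_of_mul_le_mul_left (h.trans ?_) hn'
      calc (n : ℝ) * (2 * K + 1) * ‖X n i ω‖ ^ 2 ≤ (2 / γ * p n) * (2 * K + 1) * 4 := by gcongr
        _ = _ := by ring)
    f f'0 hf0 hf1
  have hsA : ∀ n, (A n ω).IsSymm := by
    intro n
    ext i j
    rw [Matrix.transpose_apply, hA, hA, real_inner_comm]
  have hBe : ∀ n i j, B n ω i j = (f 1 - f 0 - f'0) * (if i = j then 1 else 0)
      + f'0 * inner ℝ (X n i ω) (X n j ω) := by
    intro n i j
    rw [hB]
    simp [Matrix.one_apply]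
  have hsB : ∀ n, (B n ω).IsSymm := by
    intro n
    ext i j
    rw [Matrix.transpose_apply, hBe, hBe, real_inner_comm]
    simp only [eq_comm]
  have hbound := fun n => stieltjes_diff (A n ω) (B n ω) (hsA n) (hsB n) (f 0) z hz
  simp only [hA, hBe] at hbound
  refine squeeze_zero_norm hbound ?_
  have l1 : Tendsto (fun n : ℕ => (n : ℝ)⁻¹ * (2 / z.im)) atTop (nhds 0) := by
    simpa using tendsto_inv_atTop_nhds_zero_nat.mul_const (2 / z.im)
  have l2 := (hdet.sqrt).div_const (z.im ^ 2)
  simpa using l1.add l2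
end

section
/- Let n→∞ with p=p(n)→∞ and p/n→γ∈(0,∞). For each n let X_1,…,X_n be iid random vectors in ℝ^p with E[X_i]=0 and E‖X_i‖²=1 whose common distribution satisfies the following high-concentration property: there are absolute constants C,b>0 and a rate c(p)≥C_0 p^{b/2} such that for every 1-Lipschitz function F:ℝ^p→ℝ and every median m_F of F(X_i), P(|F(X_i)−m_F|>t)≤C·exp(−c(p)t^b) for all t>0. Let f:ℝ→ℝ be differentiable at 2, let A be the n×n matrix with entries A_{ij}=f(‖X_i−X_j‖²) (including the diagonal), and let B=(f(0)−f(2)+2f′(2))I_n−2f′(2)·(X_i^T X_j)_{i,j}. Then A and B have the same limiting spectral distribution; in particular, almost surely, for every complex z with Im z>0, m_A(z)−m_B(z)→0 as n→∞. -/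
open MeasureTheory ProbabilityTheory Filter Matrix
open scoped RealInnerProductSpace ENNReal

lemma dk_trace_inner {n : ℕ} (M : Matrix (Fin n) (Fin n) ℂ) :
    M.trace = LinearMap.trace ℂ (EuclideanSpace ℂ (Fin n))
      ((Matrix.toEuclideanCLM (𝕜 := ℂ) M : EuclideanSpace ℂ (Fin n) →L[ℂ] _) : EuclideanSpace ℂ (Fin n) →ₗ[ℂ] EuclideanSpace ℂ (Fin n)) := by
  have := Matrix.trace_toLin_eq M (EuclideanSpace.basisFun (Fin n) ℂ).toBasis
  rw [← this]
  rfl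

lemma dk_rank_range {n : ℕ} (M : Matrix (Fin n) (Fin n) ℂ) :
    M.rank = Module.finrank ℂ (LinearMap.range
      ((Matrix.toEuclideanCLM (𝕜 := ℂ) M : EuclideanSpace ℂ (Fin n) →L[ℂ] _) : EuclideanSpace ℂ (Fin n) →ₗ[ℂ] EuclideanSpace ℂ (Fin n))) := by
  rw [Matrix.rank_eq_finrank_range_toLin M (EuclideanSpace.basisFun (Fin n) ℂ).toBasis
    (EuclideanSpace.basisFun (Fin n) ℂ).toBasis]
  rfl

/-- `|Tr D| ≤ rank(D) · ‖D‖`. -/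
lemma dk_trace_le_rank {n : ℕ} (M : Matrix (Fin n) (Fin n) ℂ) (c : ℝ)
    (hc : ∀ x, ‖Matrix.toEuclideanCLM (𝕜 := ℂ) M x‖ ≤ c * ‖x‖) :
    ‖M.trace‖ ≤ M.rank * c := by
  rw [dk_trace_inner, dk_rank_range]
  set T := ((Matrix.toEuclideanCLM (𝕜 := ℂ) M : EuclideanSpace ℂ (Fin n) →L[ℂ] _) : EuclideanSpace ℂ (Fin n) →ₗ[ℂ] EuclideanSpace ℂ (Fin n)) with hT
  have hcT : ∀ x, ‖T x‖ ≤ c * ‖x‖ := hc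
  rw [← LinearMap.trace_restrict_eq_of_forall_mem (LinearMap.range T) T (fun x => ⟨x, rfl⟩)]
  rw [LinearMap.trace_eq_sum_inner _ (stdOrthonormalBasis ℂ (LinearMap.range T))]
  refine (norm_sum_le _ _).trans ?_
  refine (Finset.sum_le_card_nsmul _ _ c ?_).trans ?_
  · intro i _
    refine (norm_inner_le_norm _ _).trans ?_
    rw [(stdOrthonormalBasis ℂ (LinearMap.range T)).norm_eq_one i, one_mul]
    refine (hcT _).trans ?_
    have := (stdOrthonormalBasis ℂ (LinearMap.range T)).norm_eq_one i
    rw [Submodule.coe_norm] at this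
    rw [Submodule.subtype_apply, this, mul_one]
  · simp

/-- Coercivity of `A - z` for Hermitian `A`. -/
lemma dk_coercive {n : ℕ} (A : Matrix (Fin n) (Fin n) ℂ) (hA : A.IsHermitian) (z : ℂ) (hz : 0 < z.im)
    (x : EuclideanSpace ℂ (Fin n)) :
    z.im * ‖x‖ ≤ ‖Matrix.toEuclideanCLM (𝕜 := ℂ) (A - z • 1) x‖ := by
  have hs : (Matrix.toEuclideanLin A).IsSymmetric := Matrix.isSymmetric_toEuclideanLin_iff.mpr hA
  have him : (inner ℂ x (Matrix.toEuclideanCLM (𝕜 := ℂ) A x)).im = 0 := hs.im_inner_self_apply x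
  rcases eq_or_ne x 0 with rfl | hx
  · simp
  have hx' : 0 < ‖x‖ := norm_pos_iff.mpr hx
  have h1 : inner ℂ x (Matrix.toEuclideanCLM (𝕜 := ℂ) (A - z • 1) x) =
      inner ℂ x (Matrix.toEuclideanCLM (𝕜 := ℂ) A x) - z * ((‖x‖ ^ 2 : ℝ) : ℂ) := by
    simp [inner_self_eq_norm_sq_to_K]
  have h2 : (inner ℂ x (Matrix.toEuclideanCLM (𝕜 := ℂ) (A - z • 1) x)).im = - (z.im * ‖x‖ ^ 2) := by
    rw [h1, Complex.sub_im, him, Complex.im_mul_ofReal]; ring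
  have h3 := Complex.abs_im_le_norm (inner ℂ x (Matrix.toEuclideanCLM (𝕜 := ℂ) (A - z • 1) x))
  rw [h2, abs_neg, abs_of_nonneg (by positivity)] at h3
  have h4 := h3.trans (norm_inner_le_norm _ _)
  nlinarith

lemma dk_isUnit {n : ℕ} (A : Matrix (Fin n) (Fin n) ℂ) (hA : A.IsHermitian) (z : ℂ) (hz : 0 < z.im) :
    IsUnit (A - z • 1).det := by
  rw [← Matrix.isUnit_iff_isUnit_det, ← Matrix.mulVec_injective_iff_isUnit]
  have : Function.Injective (Matrix.toEuclideanCLM (𝕜 := ℂ) (A - z • 1)) := by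
    refine (injective_iff_map_eq_zero _).mpr ?_
    intro x hx
    have := dk_coercive A hA z hz x
    rw [hx, norm_zero] at this
    have : ‖x‖ ≤ 0 := by nlinarith
    exact norm_le_zero_iff.mp this
  intro x y hxy
  have h := @this (WithLp.toLp 2 x) (WithLp.toLp 2 y) (by
    simp only [Matrix.toEuclideanCLM_toLp]
    exact congrArg _ hxy)
  simpa using h

lemma dk_resolvent_norm {n : ℕ} (A : Matrix (Fin n) (Fin n) ℂ) (hA : A.IsHermitian) (z : ℂ) (hz : 0 < z.im)
    (x : EuclideanSpace ℂ (Fin n)) :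
    ‖Matrix.toEuclideanCLM (𝕜 := ℂ) (A - z • 1)⁻¹ x‖ ≤ z.im⁻¹ * ‖x‖ := by
  have h := dk_coercive A hA z hz (Matrix.toEuclideanCLM (𝕜 := ℂ) (A - z • 1)⁻¹ x)
  have h2 : Matrix.toEuclideanCLM (𝕜 := ℂ) (A - z • 1) (Matrix.toEuclideanCLM (𝕜 := ℂ) (A - z • 1)⁻¹ x) = x := by
    rw [← mul_apply_eq_comp, ← map_mul, Matrix.mul_nonsing_inv _ (dk_isUnit A hA z hz)]
    simp
  rw [h2] at h
  rw [inv_mul_eq_div, le_div_iff₀ hz]; linarith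

lemma dk_resolvent_sub {n : ℕ} (A B : Matrix (Fin n) (Fin n) ℂ) (hA : A.IsHermitian) (hB : B.IsHermitian)
    (z : ℂ) (hz : 0 < z.im) :
    (A - z • 1)⁻¹ - (B - z • 1)⁻¹ = (A - z • 1)⁻¹ * (B - A) * (B - z • 1)⁻¹ := by
  have e : B - A = (B - z • 1) - (A - z • 1) := by abel
  rw [e, Matrix.mul_sub, Matrix.sub_mul, Matrix.mul_assoc,
    Matrix.mul_nonsing_inv _ (dk_isUnit B hB z hz), Matrix.nonsing_inv_mul _ (dk_isUnit A hA z hz)]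
  simp

lemma dk_rank_bound {n : ℕ} (A B : Matrix (Fin n) (Fin n) ℂ) (hA : A.IsHermitian) (hB : B.IsHermitian)
    (z : ℂ) (hz : 0 < z.im) :
    ‖((A - z • 1)⁻¹).trace - ((B - z • 1)⁻¹).trace‖ ≤ (B - A).rank * (2 * z.im⁻¹) := by
  rw [← Matrix.trace_sub]
  refine (dk_trace_le_rank _ (2 * z.im⁻¹) ?_).trans ?_
  · intro x
    rw [map_sub, _root_.sub_apply]
    have h1 := dk_resolvent_norm A hA z hz x
    have h2 := dk_resolvent_norm B hB z hz x
    have h3 := norm_sub_le (Matrix.toEuclideanCLM (𝕜 := ℂ) (A - z • 1)⁻¹ x) (Matrix.toEuclideanCLM (𝕜 := ℂ) (B - z • 1)⁻¹ x)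
    linarith
  · gcongr
    rw [dk_resolvent_sub A B hA hB z hz]
    exact (Matrix.rank_mul_le_left _ _).trans (Matrix.rank_mul_le_right _ _)

lemma dk_frob_bound {n : ℕ} (A B : Matrix (Fin n) (Fin n) ℂ) (hA : A.IsHermitian) (hB : B.IsHermitian)
    (z : ℂ) (hz : 0 < z.im) (q : ℝ) (hq : ∑ i, ∑ j, ‖(B - A) i j‖ ^ 2 ≤ q) :
    ‖((A - z • 1)⁻¹).trace - ((B - z • 1)⁻¹).trace‖ ≤ (z.im⁻¹) ^ 2 * Real.sqrt (n * q) := by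
  rw [← Matrix.trace_sub, dk_resolvent_sub A B hA hB z hz, Matrix.trace_mul_comm, ← Matrix.mul_assoc]
  rw [dk_trace_inner, LinearMap.trace_eq_sum_inner _ (EuclideanSpace.basisFun (Fin n) ℂ)]
  set P := Matrix.toEuclideanCLM (𝕜 := ℂ) (B - A) with hP
  set e := EuclideanSpace.basisFun (Fin n) ℂ with he
  have hPe : ∀ j, ‖P (e j)‖ ^ 2 = ∑ i, ‖(B - A) i j‖ ^ 2 := by
    intro j
    rw [EuclideanSpace.norm_sq_eq]
    refine Finset.sum_congr rfl fun i _ => ?_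
    simp [hP, he, Matrix.ofLp_toEuclideanCLM]
  have hsum : ∑ j, ‖P (e j)‖ ≤ Real.sqrt (n * q) := by
    refine Real.le_sqrt_of_sq_le ?_
    refine (sq_sum_le_card_mul_sum_sq).trans ?_
    simp only [Finset.card_univ, Fintype.card_fin]
    gcongr
    simp only [hPe]
    rw [Finset.sum_comm]; exact hq
  refine (norm_sum_le _ _).trans ?_
  refine le_trans ?_ (mul_le_mul_of_nonneg_left hsum (by positivity))
  rw [Finset.mul_sum]
  refine Finset.sum_le_sum fun j _ => ?_
  refine (norm_inner_le_norm _ _).trans ?_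
  rw [e.norm_eq_one j, one_mul]
  have : (Matrix.toEuclideanCLM (𝕜 := ℂ) ((B - z • 1)⁻¹ * (A - z • 1)⁻¹ * (B - A))) (e j)
     = Matrix.toEuclideanCLM (𝕜 := ℂ) (B - z • 1)⁻¹ (Matrix.toEuclideanCLM (𝕜 := ℂ) (A - z • 1)⁻¹ (P (e j))) := by
    rw [map_mul, map_mul]; rfl
  change ‖(Matrix.toEuclideanCLM (𝕜 := ℂ) ((B - z • 1)⁻¹ * (A - z • 1)⁻¹ * (B - A))) (e j)‖ ≤ _
  rw [this]
  refine (dk_resolvent_norm B hB z hz _).trans ?_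
  rw [pow_two, mul_assoc]
  exact mul_le_mul_of_nonneg_left (dk_resolvent_norm A hA z hz _) (by positivity)

lemma dk_rank_add {n : ℕ} (A B : Matrix (Fin n) (Fin n) ℂ) : (A + B).rank ≤ A.rank + B.rank := by
  rw [dk_rank_range, dk_rank_range, dk_rank_range, map_add]
  refine le_trans (Submodule.finrank_mono ?_) (Submodule.finrank_add_le_finrank_add_finrank _ _)
  rintro _ ⟨x, rfl⟩
  exact Submodule.add_mem_sup ⟨x, rfl⟩ ⟨x, rfl⟩


/-- Existence of a median. -/
lemma dk_median {E : Type*} [MeasurableSpace E] (ν : Measure E) [IsProbabilityMeasure ν] (F : E → ℝ)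
    (hF : Measurable F) : ∃ m : ℝ, (1 / 2 : ℝ≥0∞) ≤ ν {x | m ≤ F x} ∧ (1 / 2 : ℝ≥0∞) ≤ ν {x | F x ≤ m} := by
  set μ := ν.map F with hμ
  have : IsProbabilityMeasure μ := Measure.isProbabilityMeasure_map hF.aemeasurable
  set S : Set ℝ := {t | (1 / 2 : ℝ) ≤ cdf μ t} with hS
  have hne : S.Nonempty := by
    obtain ⟨t, ht⟩ := ((tendsto_cdf_atTop μ).eventually (eventually_ge_nhds (by norm_num : (1/2 : ℝ) < 1))).exists
    exact ⟨t, ht⟩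
  have hbdd : BddBelow S := by
    obtain ⟨t, ht⟩ := ((tendsto_cdf_atBot μ).eventually (eventually_lt_nhds (by norm_num : (0 : ℝ) < 1/2))).exists
    refine ⟨t, fun s hs => ?_⟩
    by_contra hlt
    push Not at hlt
    have := monotone_cdf μ hlt.le
    have h2 : (1 / 2 : ℝ) ≤ cdf μ s := hs
    linarith
  have hhalf : ENNReal.ofReal (1/2) = (1 / 2 : ℝ≥0∞) := by
    rw [ENNReal.ofReal_div_of_pos (by norm_num)]; simp
  have hle : (1 / 2 : ℝ≥0∞) ≤ μ (Set.Iic (sInf S)) := by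
    have h1 : (1 / 2 : ℝ) ≤ cdf μ (sInf S) := by
      have hc : Tendsto (cdf μ) (nhdsWithin (sInf S) (Set.Ioi (sInf S))) (nhds (cdf μ (sInf S))) :=
        ((cdf μ).right_continuous (sInf S)).mono Set.Ioi_subset_Ici_self
      refine ge_of_tendsto hc ?_
      filter_upwards [self_mem_nhdsWithin] with t ht
      obtain ⟨s, hs, hst⟩ := exists_lt_of_csInf_lt hne ht
      exact le_trans hs (monotone_cdf μ hst.le)
    rw [← ofReal_cdf, ← hhalf]
    exact ENNReal.ofReal_le_ofReal h1
  have hlt : μ (Set.Iio (sInf S)) ≤ 1 / 2 := by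
    obtain ⟨u, hu, hu2, hu3⟩ := exists_seq_strictMono_tendsto (sInf S)
    have hU : Set.Iio (sInf S) = ⋃ k, Set.Iic (u k) := by
      ext x; simp only [Set.mem_Iio, Set.mem_iUnion, Set.mem_Iic]
      constructor
      · intro hx
        obtain ⟨k, hk⟩ := (hu3.eventually (eventually_gt_nhds hx)).exists
        exact ⟨k, hk.le⟩
      · rintro ⟨k, hk⟩; exact hk.trans_lt (hu2 k)
    rw [hU, Monotone.measure_iUnion (fun a b hab => Set.Iic_subset_Iic.mpr (hu.monotone hab))]
    refine iSup_le fun k => ?_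
    rw [← ofReal_cdf, ← hhalf]
    refine ENNReal.ofReal_le_ofReal ?_
    by_contra hcon
    push Not at hcon
    exact absurd (csInf_le hbdd (show u k ∈ S from hcon.le)) (not_le.mpr (hu2 k))
  refine ⟨sInf S, ?_, ?_⟩
  · have h1 : ν {x | sInf S ≤ F x} = μ (Set.Ici (sInf S)) := by
      rw [hμ, Measure.map_apply hF measurableSet_Ici]; rfl
    rw [h1, ← Set.compl_Iio, prob_compl_eq_one_sub measurableSet_Iio]
    refine le_trans ?_ (tsub_le_tsub_left hlt 1)
    simp
  · have h1 : ν {x | F x ≤ sInf S} = μ (Set.Iic (sInf S)) := by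
      rw [hμ, Measure.map_apply hF measurableSet_Iic]; rfl
    rw [h1]; exact hle

/-- Moments from stretched exponential tails. -/
lemma dk_moment {E : Type*} [MeasurableSpace E] (ν : Measure E) [IsProbabilityMeasure ν] (a : E → ℝ)
    (ha : Measurable a) (C b c : ℝ) (hC : 0 < C) (hb : 0 < b) (hc : 0 < c)
    (htail : ∀ t : ℝ, 0 < t → ν {x | t < |a x|} ≤ ENNReal.ofReal (C * Real.exp (-c * t ^ b)))
    (k : ℕ) (hk : 0 < k) :
    Integrable (fun x => |a x| ^ k) ν ∧
      ∫ x, |a x| ^ k ∂ν ≤ k * C * (c ^ (-(k : ℝ) / b) * (1 / b) * Real.Gamma ((k : ℝ) / b)) := by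
  have hk' : (0 : ℝ) < k := by exact_mod_cast hk
  have hnn : 0 ≤ c ^ (-(k : ℝ) / b) * (1 / b) * Real.Gamma ((k : ℝ) / b) := by
    have := Real.Gamma_pos_of_pos (div_pos hk' hb)
    positivity
  have hl : ∫⁻ x, ENNReal.ofReal (|a x| ^ k) ∂ν ≤
      ENNReal.ofReal (k * C * (c ^ (-(k : ℝ) / b) * (1 / b) * Real.Gamma ((k : ℝ) / b))) := by
    have h := lintegral_rpow_eq_lintegral_meas_lt_mul ν (f := fun x => |a x|)
      (ae_of_all _ fun x => abs_nonneg _) (measurable_norm.comp ha).aemeasurable hk'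
    simp only [Real.rpow_natCast] at h
    rw [h]
    have h2 : ∫⁻ t in Set.Ioi (0 : ℝ), ν {x | t < |a x|} * ENNReal.ofReal (t ^ ((k : ℝ) - 1)) ≤
        ∫⁻ t in Set.Ioi (0 : ℝ), ENNReal.ofReal (C * (t ^ ((k : ℝ) - 1) * Real.exp (-c * t ^ b))) := by
      refine setLIntegral_mono' measurableSet_Ioi fun t ht => ?_
      have ht' : (0 : ℝ) < t := ht
      refine (mul_le_mul_left (htail t ht) _).trans ?_
      rw [← ENNReal.ofReal_mul (by positivity)]
      refine ENNReal.ofReal_le_ofReal (le_of_eq (by ring))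
    have hIntg : IntegrableOn (fun t : ℝ => t ^ ((k : ℝ) - 1) * Real.exp (-c * t ^ b)) (Set.Ioi 0) :=
      integrableOn_rpow_mul_exp_neg_mul_rpow (by linarith) hb hc
    rw [← ofReal_integral_eq_lintegral_ofReal (hIntg.const_mul C)
      ((ae_restrict_iff' measurableSet_Ioi).mpr (ae_of_all _ fun t ht => by
        have ht' : (0 : ℝ) < t := ht
        positivity)), integral_const_mul,
      integral_rpow_mul_exp_neg_mul_rpow hb (by linarith) hc] at h2
    refine (mul_le_mul_right h2 _).trans ?_
    rw [← ENNReal.ofReal_mul hk'.le]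
    refine ENNReal.ofReal_le_ofReal (le_of_eq ?_)
    simp only [sub_add_cancel]
    ring
  have hmeas : AEStronglyMeasurable (fun x => |a x| ^ k) ν := (Measurable.pow_const (measurable_norm.comp ha) k).aestronglyMeasurable
  have hIntg : Integrable (fun x => |a x| ^ k) ν := by
    refine ⟨hmeas, ?_⟩
    rw [hasFiniteIntegral_iff_ofReal (ae_of_all _ fun x => by positivity)]
    exact hl.trans_lt ENNReal.ofReal_lt_top
  refine ⟨hIntg, ?_⟩
  rw [integral_eq_lintegral_of_nonneg_ae (ae_of_all _ fun x => by positivity) hmeas]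
  exact ENNReal.toReal_le_of_le_ofReal (by positivity) hl


lemma dk_four (x y : ℝ) : (x + y) ^ 4 ≤ 8 * (x ^ 4 + y ^ 4) := by
  nlinarith [sq_nonneg (x - y), sq_nonneg (x + y), sq_nonneg (x^2 - y^2), sq_nonneg (x*(x-y)), sq_nonneg (y*(x-y)), sq_nonneg (x^2-x*y), sq_nonneg (x^2+y^2-2*x*y)]

/-- Fourth moment of `F² - E F²`. -/
lemma dk_sq_moment {E : Type*} [MeasurableSpace E] (ν : Measure E) [IsProbabilityMeasure ν] (F : E → ℝ)
    (hF : Measurable F) (hF0 : ∀ x, 0 ≤ F x) (hF2 : Integrable (fun x => F x ^ 2) ν) (m : ℝ)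
    (hm1 : (1 / 2 : ℝ≥0∞) ≤ ν {x | m ≤ F x}) (hm2 : (1 / 2 : ℝ≥0∞) ≤ ν {x | F x ≤ m})
    (D p : ℝ) (hD : 0 ≤ D) (hp : 1 ≤ p)
    (h4 : Integrable (fun x => |F x - m| ^ 4) ν) (h8 : Integrable (fun x => |F x - m| ^ 8) ν)
    (h4' : ∫ x, |F x - m| ^ 4 ∂ν ≤ D / p ^ 2) (h8' : ∫ x, |F x - m| ^ 8 ∂ν ≤ D / p ^ 4) (σ : ℝ)
    (hσ : ∫ x, F x ^ 2 ∂ν = σ) :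
    Integrable (fun x => (F x ^ 2 - σ) ^ 4) ν ∧
      ∫ x, (F x ^ 2 - σ) ^ 4 ∂ν ≤ 8192 * D * (1 + σ ^ 2) / p ^ 2 := by
  have hm0 : 0 ≤ m := by
    by_contra hneg
    push Not at hneg
    have : {x | F x ≤ m} = ∅ := by
      ext x; simp only [Set.mem_ofPred_eq, Set.mem_empty_iff_false, iff_false, not_le]
      exact hneg.trans_le (hF0 x)
    rw [this] at hm2
    simp at hm2
  have hσm : m ^ 2 ≤ 2 * σ := by
    have h := mul_meas_ge_le_integral_of_nonneg (ae_of_all ν fun x => sq_nonneg (F x)) hF2 (m ^ 2)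
    have hsub : {x | m ≤ F x} ⊆ {x | m ^ 2 ≤ F x ^ 2} := fun x hx => by
      have : m ≤ F x := hx
      exact pow_le_pow_left₀ hm0 this 2
    have hr : (1 / 2 : ℝ) ≤ ν.real {x | m ^ 2 ≤ F x ^ 2} := by
      have := ENNReal.toReal_mono (measure_ne_top ν _) (hm1.trans (measure_mono hsub))
      simpa [Measure.real] using this
    rw [hσ] at h
    nlinarith [sq_nonneg m]
  have e4 : ∀ x, |F x - m| ^ 4 = (F x - m) ^ 4 := fun x => Even.pow_abs (by decide) _
  have e8 : ∀ x, |F x - m| ^ 8 = (F x - m) ^ 8 := fun x => Even.pow_abs (by decide) _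
  simp only [e4] at h4 h4'
  simp only [e8] at h8 h8'
  have hpt : ∀ x, (F x ^ 2 - m ^ 2) ^ 4 ≤ 8 * ((F x - m) ^ 8 + 16 * m ^ 4 * (F x - m) ^ 4) := by
    intro x
    have := dk_four ((F x - m) ^ 2) (2 * m * (F x - m))
    calc (F x ^ 2 - m ^ 2) ^ 4 = ((F x - m) ^ 2 + (2 * m * (F x - m))) ^ 4 := by ring
      _ ≤ _ := this
      _ = _ := by ring
  have hbig : Integrable (fun x => 8 * ((F x - m) ^ 8 + 16 * m ^ 4 * (F x - m) ^ 4)) ν :=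
    (h8.add (h4.const_mul _)).const_mul 8
  have hi : Integrable (fun x => (F x ^ 2 - m ^ 2) ^ 4) ν := by
    refine hbig.mono' (by fun_prop) (ae_of_all _ fun x => ?_)
    rw [Real.norm_of_nonneg (by positivity)]
    exact hpt x
  have hI : ∫ x, (F x ^ 2 - m ^ 2) ^ 4 ∂ν ≤ 8 * (D / p ^ 4 + 16 * m ^ 4 * (D / p ^ 2)) := by
    refine (integral_mono hi hbig hpt).trans ?_
    rw [integral_const_mul, integral_add h8 (h4.const_mul _), integral_const_mul]
    gcongr
  have hJ : (σ - m ^ 2) ^ 4 ≤ ∫ x, (F x ^ 2 - m ^ 2) ^ 4 ∂ν := by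
    have hIntg : Integrable (fun x => F x ^ 2 - m ^ 2) ν := hF2.sub (integrable_const _)
    have := ConvexOn.map_integral_le (μ := ν) (f := fun x => F x ^ 2 - m ^ 2)
      (Even.convexOn_pow (𝕜 := ℝ) (n := 4) (by decide)) (by fun_prop) isClosed_univ
      (ae_of_all _ fun x => Set.mem_univ _) hIntg hi
    rw [integral_sub hF2 (integrable_const _), hσ] at this
    simpa using this
  have hpt2 : ∀ x, (F x ^ 2 - σ) ^ 4 ≤ 8 * ((F x ^ 2 - m ^ 2) ^ 4 + (σ - m ^ 2) ^ 4) := by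
    intro x
    have := dk_four (F x ^ 2 - m ^ 2) (-(σ - m ^ 2))
    calc (F x ^ 2 - σ) ^ 4 = (F x ^ 2 - m ^ 2 + -(σ - m ^ 2)) ^ 4 := by ring
      _ ≤ _ := this
      _ = _ := by ring
  have hbig2 : Integrable (fun x => 8 * ((F x ^ 2 - m ^ 2) ^ 4 + (σ - m ^ 2) ^ 4)) ν :=
    (hi.add (integrable_const _)).const_mul 8
  have hi2 : Integrable (fun x => (F x ^ 2 - σ) ^ 4) ν := by
    refine hbig2.mono' (by fun_prop) (ae_of_all _ fun x => ?_)
    rw [Real.norm_of_nonneg (by positivity)]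
    exact hpt2 x
  refine ⟨hi2, (integral_mono hi2 hbig2 hpt2).trans ?_⟩
  rw [integral_const_mul, integral_add hi (integrable_const _)]
  simp only [integral_const, probReal_univ, smul_eq_mul, one_mul]
  have hp2 : D / p ^ 4 ≤ D / p ^ 2 := by
    gcongr
    norm_num
  have hm4 : m ^ 4 ≤ 4 * σ ^ 2 := by nlinarith [sq_nonneg m]
  have hq : 0 ≤ D / p ^ 2 := by positivity
  have h16 : 16 * m ^ 4 * (D / p ^ 2) ≤ 64 * σ ^ 2 * (D / p ^ 2) := by
    have := mul_le_mul_of_nonneg_right hm4 hq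
    linarith
  have : 8192 * D * (1 + σ ^ 2) / p ^ 2 = 8192 * (D / p ^ 2) + 8192 * (σ ^ 2 * (D / p ^ 2)) := by
    field_simp
  rw [this]
  have : 0 ≤ σ ^ 2 * (D / p ^ 2) := by positivity
  linarith

/-- Fourth moment of `‖X - Y‖² - 2`. -/
lemma dk_pair_moment {p : ℕ} (hp : 1 ≤ p) (ν : Measure (EuclideanSpace ℝ (Fin p))) [IsProbabilityMeasure ν]
    (hmean : ∫ x, x ∂ν = 0) (hnorm : ∫ x, ‖x‖ ^ 2 ∂ν = 1) (D : ℝ) (hD : 0 ≤ D)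
    (hmom : ∀ F : EuclideanSpace ℝ (Fin p) → ℝ, LipschitzWith 1 F →
      ∀ m : ℝ, (1 / 2 : ℝ≥0∞) ≤ ν {x | m ≤ F x} → (1 / 2 : ℝ≥0∞) ≤ ν {x | F x ≤ m} →
      (Integrable (fun x => |F x - m| ^ 4) ν ∧ ∫ x, |F x - m| ^ 4 ∂ν ≤ D / (p : ℝ) ^ 2) ∧
      (Integrable (fun x => |F x - m| ^ 8) ν ∧ ∫ x, |F x - m| ^ 8 ∂ν ≤ D / (p : ℝ) ^ 4))
    (med : ∀ F : EuclideanSpace ℝ (Fin p) → ℝ, Measurable F →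
      ∃ m : ℝ, (1 / 2 : ℝ≥0∞) ≤ ν {x | m ≤ F x} ∧ (1 / 2 : ℝ≥0∞) ≤ ν {x | F x ≤ m}) :
    ∫⁻ y, ∫⁻ x, ENNReal.ofReal ((‖x - y‖ ^ 2 - 2) ^ 4) ∂ν ∂ν ≤
      ENNReal.ofReal (8 * ((8192 * D) * (12 + 2 * (8192 * D))) / (p : ℝ) ^ 2) := by
  have hp1 : (1 : ℝ) ≤ p := by exact_mod_cast hp
  have hIntg2 : Integrable (fun x : EuclideanSpace ℝ (Fin p) => ‖x‖ ^ 2) ν := by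
    by_contra h
    rw [integral_undef h] at hnorm
    norm_num at hnorm
  have hIntg1 : Integrable (fun x : EuclideanSpace ℝ (Fin p) => x) ν := by
    have : MemLp (fun x : EuclideanSpace ℝ (Fin p) => x) 2 ν :=
      (memLp_two_iff_integrable_sq_norm (by fun_prop)).mpr hIntg2
    exact this.integrable (by norm_num)
  set M := 8192 * D with hM
  have hM0 : 0 ≤ M := by positivity
  have expand : ∀ x y : EuclideanSpace ℝ (Fin p), ‖x - y‖ ^ 2 = ‖x‖ ^ 2 - 2 * ⟪y, x⟫ + ‖y‖ ^ 2 := by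
    intro x y
    rw [norm_sub_sq_real, real_inner_comm]
  have hinn : ∀ y : EuclideanSpace ℝ (Fin p), Integrable (fun x => (⟪y, x⟫ : ℝ)) ν := fun y =>
    hIntg1.const_inner y
  have hσint : ∀ y : EuclideanSpace ℝ (Fin p), Integrable (fun x => ‖x - y‖ ^ 2) ν := by
    intro y
    simp only [expand]
    exact (hIntg2.sub ((hinn y).const_mul 2)).add (integrable_const _)
  have hσ : ∀ y : EuclideanSpace ℝ (Fin p), ∫ x, ‖x - y‖ ^ 2 ∂ν = 1 + ‖y‖ ^ 2 := by
    intro y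
    simp only [expand]
    have hz : ∫ x, (⟪y, x⟫ : ℝ) ∂ν = 0 := by
      rw [integral_inner hIntg1, hmean, inner_zero_right]
    have hsub : Integrable (fun x => ‖x‖ ^ 2 - 2 * ⟪y, x⟫) ν := hIntg2.sub ((hinn y).const_mul 2)
    rw [integral_add hsub (integrable_const _),
      integral_sub hIntg2 ((hinn y).const_mul 2), integral_const_mul, hz, hnorm]
    simp
  have key : ∀ y : EuclideanSpace ℝ (Fin p),
      Integrable (fun x => (‖x - y‖ ^ 2 - (1 + ‖y‖ ^ 2)) ^ 4) ν ∧
      ∫ x, (‖x - y‖ ^ 2 - (1 + ‖y‖ ^ 2)) ^ 4 ∂ν ≤ M * (1 + (1 + ‖y‖ ^ 2) ^ 2) / (p : ℝ) ^ 2 := by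
    intro y
    have hL : LipschitzWith 1 (fun x : EuclideanSpace ℝ (Fin p) => ‖x - y‖) := by
      refine LipschitzWith.of_dist_le_mul fun a c => ?_
      rw [NNReal.coe_one, one_mul, Real.dist_eq, dist_eq_norm]
      refine (abs_norm_sub_norm_le _ _).trans (le_of_eq ?_)
      congr 1; abel
    have hmeas : Measurable (fun x : EuclideanSpace ℝ (Fin p) => ‖x - y‖) := by fun_prop
    obtain ⟨m, hm1, hm2⟩ := med _ hmeas
    obtain ⟨⟨h4, h4'⟩, h8, h8'⟩ := hmom _ hL m hm1 hm2
    exact dk_sq_moment ν _ hmeas (fun x => norm_nonneg _) (hσint y) m hm1 hm2 D p hD hp1 h4 h8 h4' h8' _ (hσ y)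
  have hu := key 0
  simp only [sub_zero, norm_zero, ne_eq, OfNat.ofNat_ne_zero, not_false_eq_true, zero_pow, add_zero, one_pow] at hu
  obtain ⟨hu1, hu2⟩ := hu
  have hin : ∀ y : EuclideanSpace ℝ (Fin p), ∫⁻ x, ENNReal.ofReal ((‖x - y‖ ^ 2 - 2) ^ 4) ∂ν ≤
      ENNReal.ofReal (8 * (M * (10 + (‖y‖ ^ 2 - 1) ^ 4) / (p : ℝ) ^ 2 + (‖y‖ ^ 2 - 1) ^ 4)) := by
    intro y
    obtain ⟨k1, k2⟩ := key y
    have hpt : ∀ x : EuclideanSpace ℝ (Fin p), (‖x - y‖ ^ 2 - 2) ^ 4 ≤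
        8 * ((‖x - y‖ ^ 2 - (1 + ‖y‖ ^ 2)) ^ 4 + (‖y‖ ^ 2 - 1) ^ 4) := by
      intro x
      have := dk_four (‖x - y‖ ^ 2 - (1 + ‖y‖ ^ 2)) (‖y‖ ^ 2 - 1)
      calc _ = (‖x - y‖ ^ 2 - (1 + ‖y‖ ^ 2) + (‖y‖ ^ 2 - 1)) ^ 4 := by ring
        _ ≤ _ := this
    have hb : Integrable (fun x => 8 * ((‖x - y‖ ^ 2 - (1 + ‖y‖ ^ 2)) ^ 4 + (‖y‖ ^ 2 - 1) ^ 4)) ν :=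
      (k1.add (integrable_const _)).const_mul 8
    refine (lintegral_mono fun x => ENNReal.ofReal_le_ofReal (hpt x)).trans ?_
    rw [← ofReal_integral_eq_lintegral_ofReal hb (ae_of_all _ fun x => by positivity)]
    refine ENNReal.ofReal_le_ofReal ?_
    rw [integral_const_mul, integral_add k1 (integrable_const _)]
    simp only [integral_const, probReal_univ, smul_eq_mul, one_mul]
    have h10 : 1 + (1 + ‖y‖ ^ 2) ^ 2 ≤ 10 + (‖y‖ ^ 2 - 1) ^ 4 := by
      nlinarith [sq_nonneg ((‖y‖ ^ 2 - 1) - 2), sq_nonneg ((‖y‖ ^ 2 - 1) ^ 2 - 1)]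
    have : M * (1 + (1 + ‖y‖ ^ 2) ^ 2) / (p : ℝ) ^ 2 ≤ M * (10 + (‖y‖ ^ 2 - 1) ^ 4) / (p : ℝ) ^ 2 := by gcongr
    linarith
  refine (lintegral_mono hin).trans ?_
  have hb2 : Integrable (fun y : EuclideanSpace ℝ (Fin p) =>
      8 * (M * (10 + (‖y‖ ^ 2 - 1) ^ 4) / (p : ℝ) ^ 2 + (‖y‖ ^ 2 - 1) ^ 4)) ν :=
    (((((integrable_const _).add hu1).const_mul M).div_const _).add hu1).const_mul 8
  rw [← ofReal_integral_eq_lintegral_ofReal hb2 (ae_of_all _ fun x => by positivity)]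
  refine ENNReal.ofReal_le_ofReal ?_
  have hc1 : Integrable (fun y : EuclideanSpace ℝ (Fin p) => 10 + (‖y‖ ^ 2 - 1) ^ 4) ν := (integrable_const _).add hu1
  rw [integral_const_mul, integral_add ((hc1.const_mul M).div_const _) hu1, integral_div, integral_const_mul,
    integral_add (integrable_const _) hu1]
  simp only [integral_const, probReal_univ, smul_eq_mul, one_mul]
  set U := ∫ x : EuclideanSpace ℝ (Fin p), (‖x‖ ^ 2 - 1) ^ 4 ∂ν with hU
  have hU2 : U ≤ 2 * M := by
    refine hu2.trans ?_
    rw [div_le_iff₀ (by positivity)]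
    nlinarith [one_le_pow₀ hp1 (n := 2)]
  have h1 : M * (10 + U) / (p : ℝ) ^ 2 ≤ M * (10 + 2 * M) / (p : ℝ) ^ 2 := by gcongr
  have h2 : 8 * (M * (12 + 2 * M)) / (p : ℝ) ^ 2 = 8 * (M * (10 + 2 * M) / (p : ℝ) ^ 2 + M * (1 + 1) / (p : ℝ) ^ 2) := by
    field_simp; ring
  rw [h2]
  linarith


/-- The pairs `(v, y)` for which `y` is bad given the past `v`. -/
def dkBad {E : Type*} {n : ℕ} (h : E → E → ℝ≥0∞) (G : Set E) (K : ℝ≥0∞) (J : Finset (Fin n)) :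
    Set ((Fin n → E) × E) :=
  {w | w.2 ∉ G ∨ K < ∑ j ∈ J, G.indicator (h w.2) (w.1 j)}

lemma dkBad_measurable {E : Type*} [MeasurableSpace E] {n : ℕ} (h : E → E → ℝ≥0∞)
    (hh : Measurable (Function.uncurry h)) (G : Set E) (hG : MeasurableSet G) (K : ℝ≥0∞)
    (J : Finset (Fin n)) : MeasurableSet (dkBad h G K J) := by
  have h1 : MeasurableSet {w : (Fin n → E) × E | w.2 ∉ G} := (measurable_snd hG).compl
  have h2 : MeasurableSet {w : (Fin n → E) × E | K < ∑ j ∈ J, G.indicator (h w.2) (w.1 j)} := by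
    refine measurableSet_lt measurable_const (Finset.measurable_sum _ fun j _ => ?_)
    have hm : Measurable (fun w : (Fin n → E) × E => w.1 j) := (measurable_pi_apply j).comp measurable_fst
    have : (fun w : (Fin n → E) × E => G.indicator (h w.2) (w.1 j)) =
        Set.indicator {w : (Fin n → E) × E | w.1 j ∈ G} (fun w => Function.uncurry h (w.2, w.1 j)) := by
      funext w
      by_cases hw : w.1 j ∈ G <;> simp [Set.indicator, hw]
    rw [this]
    exact (hh.comp (measurable_snd.prodMk hm)).indicator (hm hG)
  exact h1.union h2

lemma dkBad_congr {E : Type*} {n : ℕ} (h : E → E → ℝ≥0∞) (G : Set E) (K : ℝ≥0∞) (J : Finset (Fin n))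
    (v v' : Fin n → E) (y : E) (hv : ∀ j ∈ J, v j = v' j) :
    (v, y) ∈ dkBad h G K J ↔ (v', y) ∈ dkBad h G K J := by
  have : ∑ j ∈ J, G.indicator (h y) (v j) = ∑ j ∈ J, G.indicator (h y) (v' j) :=
    Finset.sum_congr rfl fun j hj => by rw [hv j hj]
  simp only [dkBad, Set.mem_ofPred_eq, this]

open Classical in
/-- Sequential exponential moment bound for the number of bad indices. -/
lemma dk_peel {Ω E : Type*} [MeasurableSpace Ω] [MeasurableSpace E] [Inhabited E] (μ : Measure Ω)
    [IsProbabilityMeasure μ] {n : ℕ} (X : Fin n → Ω → E) (hX : ∀ i, Measurable (X i))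
    (hind : iIndepFun X μ) (ν : Measure E) [IsProbabilityMeasure ν] (hν : ∀ i, μ.map (X i) = ν)
    (h : E → E → ℝ≥0∞) (hh : Measurable (Function.uncurry h)) (G : Set E) (hG : MeasurableSet G)
    (K q : ℝ≥0∞)
    (hq : ∀ (J : Finset (Fin n)) (v : Fin n → E), ν {y | (v, y) ∈ dkBad h G K J} ≤ q) :
    Measurable (fun ω => (3 : ℝ≥0∞) ^ (Finset.univ.filter (fun i : Fin n =>
      ((fun j => X j ω), X i ω) ∈ dkBad h G K (Finset.univ.filter (· < i)))).card) ∧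
    ∫⁻ ω, 3 ^ (Finset.univ.filter (fun i : Fin n =>
      ((fun j => X j ω), X i ω) ∈ dkBad h G K (Finset.univ.filter (· < i)))).card ∂μ ≤ (1 + 2 * q) ^ n := by
  set J : Fin n → Finset (Fin n) := fun i => Finset.univ.filter (· < i) with hJ
  set α : Fin n → (Fin n → E) × E → ℝ≥0∞ := fun i w => if w ∈ dkBad h G K (J i) then 3 else 1 with hα
  have hαm : ∀ i, Measurable (α i) := fun i =>
    Measurable.ite (dkBad_measurable h hh G hG K (J i)) measurable_const measurable_const
  set P : ℕ → (Fin n → E) → ℝ≥0∞ := fun k x =>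
    ∏ i ∈ Finset.univ.filter (fun i : Fin n => i.val < k), α i (x, x i) with hP
  have hPm : ∀ k, Measurable (P k) := fun k =>
    Finset.measurable_prod _ fun i _ => (hαm i).comp (measurable_id.prodMk (measurable_pi_apply i))
  have main : ∀ k ≤ n, ∫⁻ ω, P k (fun j => X j ω) ∂μ ≤ (1 + 2 * q) ^ k := by
    intro k
    induction k with
    | zero => intro _; simp [hP]
    | succ k ih =>
      intro hk
      have ihk := ih (by omega)
      set i0 : Fin n := ⟨k, by omega⟩ with hi0
      set V : Ω → Fin n → E := fun ω j => if j < i0 then X j ω else default with hV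
      have hVm : Measurable V := by
        refine measurable_pi_lambda _ fun j => ?_
        by_cases hj : j < i0
        · simp only [hV, hj, if_true]; exact hX j
        · simp only [hV, hj, if_false]; exact measurable_const
      have hVX : IndepFun V (X i0) μ := by
        have h0 := hind.indepFun_finset (Finset.univ.filter (· < i0)) {i0} (by simp) hX
        let φ : ((j : (Finset.univ.filter (· < i0) : Finset (Fin n))) → E) → Fin n → E :=
          fun v j => if hj : j < i0 then v ⟨j, by simpa using hj⟩ else default
        have hφ : Measurable φ := by
          refine measurable_pi_lambda _ fun j => ?_
          by_cases hj : j < i0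
          · simp only [φ, hj, dif_pos]; exact measurable_pi_apply _
          · simp only [φ, hj, dif_neg, not_false_eq_true]; exact measurable_const
        let ψ : ((j : ({i0} : Finset (Fin n))) → E) → E := fun v => v ⟨i0, by simp⟩
        have hψ : Measurable ψ := measurable_pi_apply _
        have h1 := h0.comp hφ hψ
        have e1 : V = φ ∘ (fun ω (j : (Finset.univ.filter (· < i0) : Finset (Fin n))) => X j ω) := by
          funext ω j
          simp only [hV, φ, Function.comp]
          split_ifs <;> rfl
        rw [e1]
        exact h1
      have hPk : ∀ ω, P k (fun j => X j ω) = P k (V ω) := by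
        intro ω
        refine Finset.prod_congr rfl fun i hi => ?_
        have hik : i.val < k := by simpa using hi
        have hVi : V ω i = X i ω := by
          simp only [hV]; rw [if_pos]; exact hik
        rw [hVi]
        simp only [hα]
        congr 1
        refine propext (dkBad_congr h G K (J i) _ _ _ fun j hj => ?_)
        have hji : j < i := by simpa [hJ] using hj
        have : j < i0 := lt_trans hji hik
        simp [hV, this]
      have hstep : ∀ ω, P (k + 1) (fun j => X j ω) = P k (V ω) * α i0 (V ω, X i0 ω) := by
        intro ω
        have hset : (Finset.univ.filter (fun i : Fin n => i.val < k + 1)) =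
            insert i0 (Finset.univ.filter (fun i : Fin n => i.val < k)) := by
          ext i
          simp only [Finset.mem_filter, Finset.mem_univ, true_and, Finset.mem_insert, hi0, Fin.ext_iff]
          omega
        have hnot : i0 ∉ Finset.univ.filter (fun i : Fin n => i.val < k) := by simp [hi0]
        rw [← hPk]
        simp only [hP]
        rw [hset, Finset.prod_insert hnot, mul_comm]
        congr 1
        simp only [hα]
        congr 1
        refine propext (dkBad_congr h G K (J i0) _ _ _ fun j hj => ?_)
        have hji : j < i0 := by simpa [hJ] using hj
        simp [hV, hji]
      calc ∫⁻ ω, P (k + 1) (fun j => X j ω) ∂μ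
          = ∫⁻ ω, (fun w : (Fin n → E) × E => P k w.1 * α i0 w) (V ω, X i0 ω) ∂μ :=
            lintegral_congr fun ω => hstep ω
        _ = ∫⁻ w, P k w.1 * α i0 w ∂((μ.map V).prod ν) := by
            rw [← hν i0, ← (indepFun_iff_map_prod_eq_prod_map_map hVm.aemeasurable (hX i0).aemeasurable).mp hVX,
              lintegral_map (f := fun w : (Fin n → E) × E => P k w.1 * α i0 w)
                (((hPm k).comp measurable_fst).mul (hαm i0)) (hVm.prodMk (hX i0))]
        _ = ∫⁻ v, ∫⁻ y, P k v * α i0 (v, y) ∂ν ∂(μ.map V) :=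
            lintegral_prod _ (((hPm k).comp measurable_fst).mul (hαm i0)).aemeasurable
        _ ≤ ∫⁻ v, P k v * (1 + 2 * q) ∂(μ.map V) := by
            refine lintegral_mono fun v => ?_
            simp only
            have hαv : Measurable (fun y => α i0 (v, y)) := (hαm i0).comp measurable_prodMk_left
            rw [lintegral_const_mul _ hαv]
            gcongr
            have hms : MeasurableSet {y | (v, y) ∈ dkBad h G K (J i0)} :=
              measurable_prodMk_left (dkBad_measurable h hh G hG K (J i0))
            have e : ∀ y, α i0 (v, y) = 1 + Set.indicator {y | (v, y) ∈ dkBad h G K (J i0)} (fun _ => 2) y := by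
              intro y
              by_cases hy : (v, y) ∈ dkBad h G K (J i0)
              · simp only [hα, hy, if_true, Set.indicator, Set.mem_ofPred_eq]; norm_num
              · simp [hα, hy, Set.indicator]
            simp only [e]
            rw [lintegral_add_left measurable_const, lintegral_indicator_const hms]
            simp only [lintegral_const, measure_univ, mul_one]
            gcongr
            exact hq _ _
        _ = (∫⁻ ω, P k (fun j => X j ω) ∂μ) * (1 + 2 * q) := by
            rw [lintegral_mul_const _ (hPm k), lintegral_map (hPm k) hVm]
            simp only [hPk]
        _ ≤ (1 + 2 * q) ^ (k + 1) := by
            rw [pow_succ]; gcongr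
  have hfin : ∀ ω, P n (fun j => X j ω) = 3 ^ (Finset.univ.filter (fun i : Fin n =>
      ((fun j => X j ω), X i ω) ∈ dkBad h G K (Finset.univ.filter (· < i)))).card := by
    intro ω
    have huniv : (Finset.univ.filter (fun i : Fin n => i.val < n)) = Finset.univ :=
      Finset.filter_true_of_mem (fun i _ => i.isLt)
    simp only [hP, hα]
    rw [huniv, Finset.prod_ite]
    simp [hJ]
  simp only [← hfin]
  exact ⟨(hPm n).comp (measurable_pi_lambda _ hX), main n le_rfl⟩


set_option maxHeartbeats 1000000 in
open Classical in
lemma dk_prob {Ω : Type*} [MeasurableSpace Ω] (μ : Measure Ω) [IsProbabilityMeasure μ] {n p : ℕ} (hn : 0 < n)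
    (X : Fin n → Ω → EuclideanSpace ℝ (Fin p)) (hX : ∀ i, Measurable (X i)) (hind : iIndepFun X μ)
    (ν : Measure (EuclideanSpace ℝ (Fin p))) [IsProbabilityMeasure ν] (hν : ∀ i, μ.map (X i) = ν)
    (M : ℝ) (hM : 0 ≤ M)
    (hmom : ∫⁻ y, ∫⁻ x, ENNReal.ofReal ((‖x - y‖ ^ 2 - 2) ^ 4) ∂ν ∂ν ≤ ENNReal.ofReal (M / (n : ℝ) ^ 2))
    (δ : ℝ) (hδ : 0 < δ) (K : ℝ) (hK : K = 64 * (M + 1) / δ ^ 2) :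
    μ {ω | ¬ ∃ S : Finset (Fin n), (S.card : ℝ) ≤ δ * n ∧ ∀ i ∉ S,
      ∑ j ∈ Finset.univ.filter (fun j => j < i ∧ j ∉ S), (n : ℝ) * (‖X i ω - X j ω‖ ^ 2 - 2) ^ 4 ≤
        K} ≤ ENNReal.ofReal (Real.exp (-(δ / 2)) ^ n) := by
  have hn' : (0 : ℝ) < n := by exact_mod_cast hn
  obtain ⟨K', hK'⟩ : ∃ K' : ℝ, K' = 8 * (M + 1) / δ := ⟨_, rfl⟩
  have hK'0 : 0 < K' := by rw [hK']; positivity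
  have hK0 : 0 < K := by rw [hK]; positivity
  have hKK : K = K' * (8 / δ) := by rw [hK, hK']; field_simp; norm_num
  obtain ⟨h, hh⟩ : ∃ h : EuclideanSpace ℝ (Fin p) → EuclideanSpace ℝ (Fin p) → ℝ≥0∞,
    h = fun x y => ENNReal.ofReal ((n : ℝ) * (‖x - y‖ ^ 2 - 2) ^ 4) := ⟨_, rfl⟩
  have hhm : Measurable (Function.uncurry h) := by
    have : Measurable (fun w : EuclideanSpace ℝ (Fin p) × EuclideanSpace ℝ (Fin p) =>
      ENNReal.ofReal ((n : ℝ) * (‖w.1 - w.2‖ ^ 2 - 2) ^ 4)) := by fun_prop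
    rw [hh]; exact this
  have hhm1 : ∀ x, Measurable (fun y => h y x) := fun x => hhm.comp (measurable_id.prodMk measurable_const)
  set w : EuclideanSpace ℝ (Fin p) → ℝ≥0∞ := fun x => ∫⁻ y, h y x ∂ν with hw
  have hwm : Measurable w := Measurable.lintegral_prod_left' hhm
  have hwint : ∫⁻ x, w x ∂ν ≤ ENNReal.ofReal (M / n) := by
    have e : ∀ x, w x = ENNReal.ofReal n * ∫⁻ y, ENNReal.ofReal ((‖y - x‖ ^ 2 - 2) ^ 4) ∂ν := by
      intro x
      simp only [hw, hh]
      rw [← lintegral_const_mul _ (by fun_prop)]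
      exact lintegral_congr fun y => ENNReal.ofReal_mul hn'.le
    simp only [e]
    rw [lintegral_const_mul' _ _ ENNReal.ofReal_ne_top]
    refine (mul_le_mul_right hmom _).trans ?_
    rw [← ENNReal.ofReal_mul hn'.le]
    refine ENNReal.ofReal_le_ofReal (le_of_eq (by field_simp))
  set G : Set (EuclideanSpace ℝ (Fin p)) := {x | w x ≤ ENNReal.ofReal (K' / n)} with hG
  have hGm : MeasurableSet G := measurableSet_le hwm measurable_const
  have hq : ∀ (J : Finset (Fin n)) (v : Fin n → EuclideanSpace ℝ (Fin p)),
      ν {y | (v, y) ∈ dkBad h G (ENNReal.ofReal K) J} ≤ ENNReal.ofReal (δ / 4) := by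
    intro J v
    have h1 : ν {y | y ∉ G} ≤ ENNReal.ofReal (δ / 8) := by
      have hsub : {y | y ∉ G} ⊆ {y | ENNReal.ofReal (K' / n) ≤ w y} := by
        intro y hy
        have hy' : ¬ (w y ≤ ENNReal.ofReal (K' / n)) := hy
        exact (not_le.mp hy').le
      refine (measure_mono hsub).trans ?_
      refine (meas_ge_le_lintegral_div hwm.aemeasurable (by simp; positivity) ENNReal.ofReal_ne_top).trans ?_
      refine (ENNReal.div_le_div_right hwint _).trans ?_
      rw [← ENNReal.ofReal_div_of_pos (by positivity)]
      refine ENNReal.ofReal_le_ofReal ?_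
      rw [hK']
      have : M / n / (8 * (M + 1) / δ / n) = (M / (M + 1)) * (δ / 8) := by
        field_simp
      rw [this]
      have : M / (M + 1) ≤ 1 := by rw [div_le_one (by positivity)]; linarith
      nlinarith
    have h2 : ν {y | ENNReal.ofReal K < ∑ j ∈ J, G.indicator (h y) (v j)} ≤ ENNReal.ofReal (δ / 8) := by
      have hgm : ∀ j, Measurable (fun y => G.indicator (h y) (v j)) := by
        intro j
        by_cases hj : v j ∈ G
        · simp only [Set.indicator_of_mem hj]; exact hhm1 _
        · simp only [Set.indicator_of_notMem hj]; exact measurable_const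
      have hgi : ∀ j, ∫⁻ y, G.indicator (h y) (v j) ∂ν ≤ ENNReal.ofReal (K' / n) := by
        intro j
        by_cases hj : v j ∈ G
        · simp only [Set.indicator_of_mem hj]; exact hj
        · simp [Set.indicator_of_notMem hj]
      have hsub : {y | ENNReal.ofReal K < ∑ j ∈ J, G.indicator (h y) (v j)} ⊆
          {y | ENNReal.ofReal K ≤ ∑ j ∈ J, G.indicator (h y) (v j)} := by
        intro y hy
        have hy' : ENNReal.ofReal K < ∑ j ∈ J, G.indicator (h y) (v j) := hy
        exact hy'.le
      refine (measure_mono hsub).trans ?_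
      refine (meas_ge_le_lintegral_div (Finset.measurable_sum _ fun j _ => hgm j).aemeasurable
        (by simp; positivity) ENNReal.ofReal_ne_top).trans ?_
      rw [lintegral_finsetSum _ fun j _ => hgm j]
      have hs : ∑ j ∈ J, ∫⁻ y, G.indicator (h y) (v j) ∂ν ≤ ENNReal.ofReal K' := by
        refine (Finset.sum_le_sum fun j _ => hgi j).trans ?_
        rw [Finset.sum_const, nsmul_eq_mul]
        have hc : (J.card : ℝ≥0∞) ≤ ENNReal.ofReal n := by
          rw [ENNReal.ofReal_natCast]
          exact_mod_cast (Finset.card_le_univ J).trans (by simp)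
        refine (mul_le_mul_left hc _).trans ?_
        rw [← ENNReal.ofReal_mul hn'.le]
        exact ENNReal.ofReal_le_ofReal (le_of_eq (by field_simp))
      refine (ENNReal.div_le_div_right hs _).trans ?_
      rw [← ENNReal.ofReal_div_of_pos hK0]
      refine ENNReal.ofReal_le_ofReal (le_of_eq ?_)
      rw [hKK]; field_simp
    have hsub : {y | (v, y) ∈ dkBad h G (ENNReal.ofReal K) J} ⊆
        {y | y ∉ G} ∪ {y | ENNReal.ofReal K < ∑ j ∈ J, G.indicator (h y) (v j)} := fun y hy => hy
    refine (measure_mono hsub).trans ((measure_union_le _ _).trans ((add_le_add h1 h2).trans ?_))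
    rw [← ENNReal.ofReal_add (by positivity) (by positivity)]
    exact ENNReal.ofReal_le_ofReal (by linarith)
  obtain ⟨hNm, hN⟩ := dk_peel μ X hX hind ν hν h hhm G hGm (ENNReal.ofReal K) (ENNReal.ofReal (δ / 4)) hq
  set N : Ω → Finset (Fin n) := fun ω => Finset.univ.filter (fun i : Fin n =>
      ((fun j => X j ω), X i ω) ∈ dkBad h G (ENNReal.ofReal K) (Finset.univ.filter (· < i))) with hNdef
  have hsub : {ω | ¬ ∃ S : Finset (Fin n), (S.card : ℝ) ≤ δ * n ∧ ∀ i ∉ S,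
      ∑ j ∈ Finset.univ.filter (fun j => j < i ∧ j ∉ S), (n : ℝ) * (‖X i ω - X j ω‖ ^ 2 - 2) ^ 4 ≤ K} ⊆
      {ω | ENNReal.ofReal (Real.exp (δ * n)) ≤ (3 : ℝ≥0∞) ^ (N ω).card} := by
    intro ω hω
    have hω' : ¬ ∃ S : Finset (Fin n), (S.card : ℝ) ≤ δ * n ∧ ∀ i ∉ S,
      ∑ j ∈ Finset.univ.filter (fun j => j < i ∧ j ∉ S), (n : ℝ) * (‖X i ω - X j ω‖ ^ 2 - 2) ^ 4 ≤ K := hω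
    show ENNReal.ofReal (Real.exp (δ * n)) ≤ (3 : ℝ≥0∞) ^ (N ω).card
    have hcard : ¬ ((N ω).card : ℝ) ≤ δ * n := by
      intro hc
      refine hω' ⟨N ω, hc, fun i hi => ?_⟩
      have hgood : ∀ j, j ∉ N ω → X j ω ∈ G ∧
          ∑ l ∈ Finset.univ.filter (· < j), G.indicator (h (X j ω)) (X l ω) ≤ ENNReal.ofReal K := by
        intro j hj
        have hj' : ¬ (X j ω ∉ G ∨ ENNReal.ofReal K < ∑ l ∈ Finset.univ.filter (· < j), G.indicator (h (X j ω)) (X l ω)) := by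
          intro hcon
          exact hj (Finset.mem_filter.mpr ⟨Finset.mem_univ _, hcon⟩)
        push Not at hj'
        exact hj'
      have hle : ENNReal.ofReal (∑ j ∈ Finset.univ.filter (fun j => j < i ∧ j ∉ N ω),
          (n : ℝ) * (‖X i ω - X j ω‖ ^ 2 - 2) ^ 4) ≤ ENNReal.ofReal K := by
        rw [ENNReal.ofReal_sum_of_nonneg (fun j _ => by positivity)]
        refine le_trans ?_ (hgood i hi).2
        refine le_trans (Finset.sum_le_sum (g := fun j => G.indicator (h (X i ω)) (X j ω)) fun j hj => ?_)
          (Finset.sum_le_sum_of_subset (fun j hj => ?_))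
        · have hjN := (Finset.mem_filter.mp hj).2.2
          rw [Set.indicator_of_mem (hgood j hjN).1, hh]
        · exact Finset.mem_filter.mpr ⟨Finset.mem_univ _, (Finset.mem_filter.mp hj).2.1⟩
      exact (ENNReal.ofReal_le_ofReal_iff hK0.le).mp hle
    push Not at hcard
    have h3 : Real.exp (δ * n) ≤ 3 ^ (N ω).card := by
      calc Real.exp (δ * n) ≤ Real.exp ((N ω).card) := Real.exp_le_exp.mpr hcard.le
        _ = Real.exp 1 ^ (N ω).card := by rw [← Real.exp_nat_mul, mul_one]
        _ ≤ 3 ^ (N ω).card := by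
          gcongr
          exact Real.exp_one_lt_three.le
    refine (ENNReal.ofReal_le_ofReal h3).trans (le_of_eq ?_)
    rw [ENNReal.ofReal_pow (by norm_num)]
    norm_num
  refine (measure_mono hsub).trans ?_
  refine (meas_ge_le_lintegral_div hNm.aemeasurable (by simp; positivity) ENNReal.ofReal_ne_top).trans ?_
  refine (ENNReal.div_le_div_right hN _).trans ?_
  have e1 : (1 + 2 * ENNReal.ofReal (δ / 4)) ^ n = ENNReal.ofReal ((1 + 2 * (δ / 4)) ^ n) := by
    rw [ENNReal.ofReal_pow (by positivity), ENNReal.ofReal_add (by norm_num) (by positivity),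
      ENNReal.ofReal_mul (by norm_num)]
    norm_num
  rw [e1, ← ENNReal.ofReal_div_of_pos (Real.exp_pos _)]
  refine ENNReal.ofReal_le_ofReal ?_
  rw [div_le_iff₀ (Real.exp_pos _)]
  have e2 : Real.exp (-(δ / 2)) ^ n * Real.exp (δ * n) = Real.exp (δ / 2) ^ n := by
    rw [← Real.exp_nat_mul, ← Real.exp_nat_mul, ← Real.exp_add]; congr 1; ring
  rw [e2]
  gcongr
  have := Real.add_one_le_exp (δ / 2)
  linarith


lemma dk_herm {n : ℕ} (M : Matrix (Fin n) (Fin n) ℝ) (hM : ∀ i j, M i j = M j i) :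
    (M.map (fun x : ℝ => (x : ℂ))).IsHermitian := by
  refine Matrix.IsHermitian.ext fun i j => ?_
  simp [hM i j]

/-- Deterministic comparison of the two Stieltjes transforms. -/
lemma dk_det {n p : ℕ} (hn : 0 < n) (x : Fin n → EuclideanSpace ℝ (Fin p)) (f : ℝ → ℝ) (f'2 : ℝ)
    (A B : Matrix (Fin n) (Fin n) ℝ) (hA : ∀ i j, A i j = f (‖x i - x j‖ ^ 2))
    (hB : B = (f 0 - f 2 + 2 * f'2) • (1 : Matrix (Fin n) (Fin n) ℝ)
      - (2 * f'2) • Matrix.of (fun i j => (⟪x i, x j⟫ : ℝ)))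
    (S : Finset (Fin n)) (ε Q : ℝ)
    (hR : ∀ i ∉ S, ∀ j ∉ S, j < i →
      |f (‖x i - x j‖ ^ 2) - f 2 - f'2 * (‖x i - x j‖ ^ 2 - 2)| ≤ ε * |‖x i - x j‖ ^ 2 - 2|)
    (hQ0 : 0 ≤ Q)
    (hQ : ∀ i ∉ S, ∑ j ∈ Finset.univ.filter (fun j => j < i ∧ j ∉ S), (‖x i - x j‖ ^ 2 - 2) ^ 2 ≤ Q)
    (z : ℂ) (hz : 0 < z.im) :
    ‖stieltjesTransform A z - stieltjesTransform B z‖ ≤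
      (n : ℝ)⁻¹ * ((2 * S.card + 2) * (2 * z.im⁻¹) + (z.im⁻¹) ^ 2 * Real.sqrt (n * (2 * n * (ε ^ 2 * Q)))) := by
  classical
  set R : Fin n → Fin n → ℝ := fun i j =>
    if i = j then 0 else f (‖x i - x j‖ ^ 2) - f 2 - f'2 * (‖x i - x j‖ ^ 2 - 2) with hRdef
  have hRsymm : ∀ i j, R i j = R j i := by
    intro i j
    simp only [hRdef, eq_comm (a := i) (b := j), norm_sub_rev (x i) (x j)]
  set u : Fin n → ℝ := fun i => ‖x i‖ ^ 2 - 1 with hu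
  have hdec : ∀ i j, A i j = B i j + (f 2 + f'2 * u i) + f'2 * u j + R i j := by
    intro i j
    rw [hA, hB]
    by_cases hij : i = j
    · subst hij
      simp [hRdef, hu]
      ring
    · simp only [hRdef, hu, if_neg hij, Matrix.sub_apply, Matrix.smul_apply, Matrix.one_apply_ne hij,
        Matrix.of_apply, smul_eq_mul, norm_sub_sq_real]
      ring
  have hBs : ∀ i j, B i j = B j i := by
    intro i j
    rw [hB]
    simp [Matrix.one_apply, eq_comm (a := i) (b := j), real_inner_comm]
  have hAs : ∀ i j, A i j = A j i := by
    intro i j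
    rw [hA, hA, norm_sub_rev]
  set Gd : Matrix (Fin n) (Fin n) ℝ := Matrix.of fun i j => if i ∉ S ∧ j ∉ S then R i j else 0 with hGd
  have hGs : ∀ i j, Gd i j = Gd j i := by
    intro i j
    simp only [hGd, Matrix.of_apply, hRsymm i j, and_comm]
  set A1 := B + Gd with hA1
  have hA1s : ∀ i j, A1 i j = A1 j i := by
    intro i j
    simp only [hA1, Matrix.add_apply, hBs i j, hGs i j]
  have hAh := dk_herm A hAs
  have hBh := dk_herm B hBs
  have hA1h := dk_herm A1 hA1s
  set Ac := A.map (fun x : ℝ => (x : ℂ)) with hAc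
  set Bc := B.map (fun x : ℝ => (x : ℂ)) with hBc
  set A1c := A1.map (fun x : ℝ => (x : ℂ)) with hA1c
  -- rank part
  set d : Fin n → ℂ := fun i => if i ∈ S then 1 else 0 with hd
  have hdr : (Matrix.diagonal d).rank ≤ S.card := by
    rw [Matrix.rank_diagonal]
    refine le_of_eq ?_
    rw [Fintype.card_subtype]
    congr 1
    ext i
    simp [hd]
  have hrank : (A1c - Ac).rank ≤ 2 * S.card + 2 := by
    have e : A1c - Ac = (Matrix.vecMulVec (fun i => -((f 2 + f'2 * u i : ℝ) : ℂ)) (fun _ => 1)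
        + Matrix.vecMulVec (fun _ => 1) (fun j => -((f'2 * u j : ℝ) : ℂ)))
        + (Matrix.diagonal d * Matrix.of (fun i j => -(R i j : ℂ))
        + Matrix.of (fun i j => if i ∈ S then 0 else -(R i j : ℂ)) * Matrix.diagonal d) := by
      ext i j
      simp only [Matrix.sub_apply, Matrix.add_apply, Matrix.diagonal_mul, Matrix.mul_diagonal,
        Matrix.vecMulVec_apply, Matrix.of_apply, hA1c, hAc, Matrix.map_apply, hA1, hGd, hd, hdec i j]
      by_cases hi : i ∈ S <;> by_cases hj : j ∈ S <;> simp [hi, hj] <;> ring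
    rw [e]
    refine (dk_rank_add _ _).trans ?_
    have h1 := (dk_rank_add (Matrix.vecMulVec (fun i => -((f 2 + f'2 * u i : ℝ) : ℂ)) (fun _ : Fin n => 1))
      (Matrix.vecMulVec (fun _ : Fin n => 1) (fun j => -((f'2 * u j : ℝ) : ℂ)))).trans
      (add_le_add (Matrix.rank_vecMulVec_le _ _) (Matrix.rank_vecMulVec_le _ _))
    have h2 := (dk_rank_add (Matrix.diagonal d * Matrix.of (fun i j => -(R i j : ℂ)))
      (Matrix.of (fun i j => if i ∈ S then 0 else -(R i j : ℂ)) * Matrix.diagonal d)).trans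
      (add_le_add ((Matrix.rank_mul_le_left _ _).trans hdr) ((Matrix.rank_mul_le_right _ _).trans hdr))
    omega
  -- Frobenius part
  have hfrob : ∑ i, ∑ j, ‖(Bc - A1c) i j‖ ^ 2 ≤ 2 * n * (ε ^ 2 * Q) := by
    set g : Fin n → Fin n → ℝ := fun i j =>
      if i ∉ S ∧ (j < i ∧ j ∉ S) then ε ^ 2 * (‖x i - x j‖ ^ 2 - 2) ^ 2 else 0 with hg
    have hg0 : ∀ i j, 0 ≤ g i j := by
      intro i j; simp only [hg]; split_ifs <;> positivity
    have hlt : ∀ i j, j < i → (Gd i j) ^ 2 ≤ g i j := by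
      intro i j hij
      simp only [hGd, Matrix.of_apply, hg]
      by_cases hi : i ∈ S
      · simp [hi]
      by_cases hj : j ∈ S
      · simp [hj]
      simp only [hi, hj, hij, not_false_eq_true, and_self, if_true, hRdef, if_neg hij.ne']
      rw [← sq_abs, ← sq_abs (‖x i - x j‖ ^ 2 - 2), ← mul_pow]
      exact pow_le_pow_left₀ (abs_nonneg _) (hR i hi j hj hij) 2
    have hle : ∀ i j, ‖(Bc - A1c) i j‖ ^ 2 ≤ g i j + g j i := by
      intro i j
      have e : (Bc - A1c) i j = ((-(Gd i j) : ℝ) : ℂ) := by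
        simp [hBc, hA1c, hA1]
      rw [e, Complex.norm_real, Real.norm_eq_abs, sq_abs, neg_sq]
      rcases lt_trichotomy i j with hij | hij | hij
      · rw [hGs i j]; linarith [hlt j i hij, hg0 i j]
      · subst hij
        have : Gd i i = 0 := by simp [hGd, hRdef]
        rw [this]; linarith [hg0 i i]
      · linarith [hlt i j hij, hg0 j i]
    have hsum : ∑ i, ∑ j, g i j ≤ n * (ε ^ 2 * Q) := by
      have : ∀ i ∈ (Finset.univ : Finset (Fin n)), ∑ j, g i j ≤ ε ^ 2 * Q := by
        intro i _
        by_cases hi : i ∈ S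
        · simp only [hg, hi, not_true_eq_false, false_and, if_false, Finset.sum_const_zero]; positivity
        · simp only [hg, hi, not_false_eq_true, true_and]
          rw [← Finset.sum_filter, ← Finset.mul_sum]
          exact mul_le_mul_of_nonneg_left (hQ i hi) (sq_nonneg _)
      refine (Finset.sum_le_card_nsmul _ _ _ this).trans ?_
      simp
    refine (Finset.sum_le_sum fun i _ => Finset.sum_le_sum fun j _ => hle i j).trans ?_
    simp only [Finset.sum_add_distrib]
    rw [Finset.sum_comm (f := fun i j => g j i)]
    linarith
  have b1 := dk_rank_bound Ac A1c hAh hA1h z hz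
  have b2 := dk_frob_bound A1c Bc hA1h hBh z hz _ hfrob
  have e : stieltjesTransform A z - stieltjesTransform B z =
      (n : ℂ)⁻¹ * ((((Ac - z • 1)⁻¹).trace - ((A1c - z • 1)⁻¹).trace) +
        (((A1c - z • 1)⁻¹).trace - ((Bc - z • 1)⁻¹).trace)) := by
    simp only [stieltjesTransform]
    ring
  rw [e, norm_mul, norm_inv, Complex.norm_natCast]
  gcongr
  refine (norm_add_le _ _).trans (add_le_add (b1.trans ?_) b2)
  gcongr
  exact_mod_cast hrank


/-- The constant in the moment bounds coming from the concentration property. -/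
noncomputable def dkConst (C b C₀ : ℝ) (k : ℕ) : ℝ :=
  k * C * (C₀ ^ (-(k : ℝ) / b) * (1 / b) * Real.Gamma ((k : ℝ) / b))

lemma dkConst_pos (C b C₀ : ℝ) (hC : 0 < C) (hb : 0 < b) (hC₀ : 0 < C₀) (k : ℕ) (hk : 0 < k) :
    0 < dkConst C b C₀ k := by
  have hk' : (0 : ℝ) < k := by exact_mod_cast hk
  have := Real.Gamma_pos_of_pos (div_pos hk' hb)
  unfold dkConst
  positivity

/-- The pair moment bound from the concentration property. -/
lemma dk_transfer {Ω : Type*} [MeasurableSpace Ω] (μ : Measure Ω) [IsProbabilityMeasure μ] {p : ℕ} (hp : 1 ≤ p)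
    (X : Ω → EuclideanSpace ℝ (Fin p)) (hX : Measurable X)
    (ν : Measure (EuclideanSpace ℝ (Fin p))) [IsProbabilityMeasure ν] (hν : μ.map X = ν)
    (hmean : ∫ ω, X ω ∂μ = 0) (hnorm : ∫ ω, ‖X ω‖ ^ 2 ∂μ = 1)
    (C b C₀ : ℝ) (hC : 0 < C) (hb : 0 < b) (hC₀ : 0 < C₀) (c : ℝ)
    (hc : C₀ * (p : ℝ) ^ (b / 2) ≤ c)
    (hconc : ∀ F : EuclideanSpace ℝ (Fin p) → ℝ, LipschitzWith 1 F →
      ∀ m : ℝ, (1 / 2 : ℝ≥0∞) ≤ μ {ω | m ≤ F (X ω)} →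
        (1 / 2 : ℝ≥0∞) ≤ μ {ω | F (X ω) ≤ m} →
        ∀ t : ℝ, 0 < t →
          (μ {ω | t < |F (X ω) - m|}).toReal ≤ C * Real.exp (-c * t ^ b))
    (D : ℝ) (hD : D = dkConst C b C₀ 4 + dkConst C b C₀ 8) :
    ∫⁻ y, ∫⁻ x, ENNReal.ofReal ((‖x - y‖ ^ 2 - 2) ^ 4) ∂ν ∂ν ≤
      ENNReal.ofReal (8 * ((8192 * D) * (12 + 2 * (8192 * D))) / (p : ℝ) ^ 2) := by
  have hp0 : (0 : ℝ) < p := by exact_mod_cast hp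
  have d4 := dkConst_pos C b C₀ hC hb hC₀ 4 (by norm_num)
  have d8 := dkConst_pos C b C₀ hC hb hC₀ 8 (by norm_num)
  have hcp : 0 < C₀ * (p : ℝ) ^ (b / 2) := by positivity
  have hpow : ∀ k : ℕ, ∀ l : ℕ, k = 2 * l → (C₀ * (p : ℝ) ^ (b / 2)) ^ (-(k : ℝ) / b) =
      C₀ ^ (-(k : ℝ) / b) * ((p : ℝ) ^ l)⁻¹ := by
    intro k l hkl
    rw [Real.mul_rpow hC₀.le (by positivity), ← Real.rpow_mul hp0.le]
    congr 1
    rw [← Real.rpow_natCast, ← Real.rpow_neg hp0.le]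
    congr 1
    rw [hkl]; push_cast; field_simp
  refine dk_pair_moment hp ν ?_ ?_ D (by rw [hD]; positivity) ?_ (fun F hF => dk_median ν F hF)
  · rw [← hν, integral_map hX.aemeasurable (by fun_prop)]; exact hmean
  · rw [← hν, integral_map hX.aemeasurable (by fun_prop)]; exact hnorm
  · intro F hF m h1 h2
    have hFm : Measurable F := hF.continuous.measurable
    have m1 : MeasurableSet {x | m ≤ F x} := measurableSet_le measurable_const hFm
    have m2 : MeasurableSet {x | F x ≤ m} := measurableSet_le hFm measurable_const
    rw [← hν, Measure.map_apply hX m1] at h1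
    rw [← hν, Measure.map_apply hX m2] at h2
    have htail : ∀ t : ℝ, 0 < t → ν {x | t < |F x - m|} ≤
        ENNReal.ofReal (C * Real.exp (-(C₀ * (p : ℝ) ^ (b / 2)) * t ^ b)) := by
      intro t ht
      have m3 : MeasurableSet {x | t < |F x - m|} :=
        measurableSet_lt measurable_const (by fun_prop)
      rw [← hν, Measure.map_apply hX m3]
      have := hconc F hF m h1 h2 t ht
      rw [← ENNReal.ofReal_toReal (measure_ne_top μ (X ⁻¹' {x | t < |F x - m|}))]
      refine ENNReal.ofReal_le_ofReal (this.trans ?_)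
      have ht' : 0 ≤ t ^ b := by positivity
      gcongr
    have q4 := dk_moment ν (fun x => F x - m) (by fun_prop) C b _ hC hb hcp htail 4 (by norm_num)
    have q8 := dk_moment ν (fun x => F x - m) (by fun_prop) C b _ hC hb hcp htail 8 (by norm_num)
    rw [hpow 4 2 (by norm_num)] at q4
    rw [hpow 8 4 (by norm_num)] at q8
    refine ⟨⟨q4.1, q4.2.trans ?_⟩, ⟨q8.1, q8.2.trans ?_⟩⟩
    · calc _ = dkConst C b C₀ 4 / (p : ℝ) ^ 2 := by unfold dkConst; ring
        _ ≤ _ := by gcongr; linarith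
    · calc _ = dkConst C b C₀ 8 / (p : ℝ) ^ 4 := by unfold dkConst; ring
        _ ≤ _ := by gcongr; linarith

open Classical in
/-- The deterministic conclusion for a fixed realization. -/
lemma dk_final (p : ℕ → ℕ) (x : (n : ℕ) → Fin n → EuclideanSpace ℝ (Fin (p n)))
    (f : ℝ → ℝ) (f'2 : ℝ) (hf2 : HasDerivAt f f'2 2)
    (A B : (n : ℕ) → Matrix (Fin n) (Fin n) ℝ)
    (hA : ∀ n i j, A n i j = f (‖x n i - x n j‖ ^ 2))
    (hB : ∀ n, B n = (f 0 - f 2 + 2 * f'2) • (1 : Matrix (Fin n) (Fin n) ℝ)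
      - (2 * f'2) • Matrix.of (fun i j => (⟪x n i, x n j⟫ : ℝ)))
    (K : ℕ → ℝ) (hK : ∀ k, 0 ≤ K k)
    (h : ∀ k : ℕ, ∀ᶠ n : ℕ in atTop, ∃ S : Finset (Fin n), (S.card : ℝ) ≤ (1 / ((k : ℝ) + 1)) * n ∧ ∀ i ∉ S,
      ∑ j ∈ Finset.univ.filter (fun j => j < i ∧ j ∉ S), (n : ℝ) * (‖x n i - x n j‖ ^ 2 - 2) ^ 4 ≤ K k)
    (z : ℂ) (hz : 0 < z.im) :
    Tendsto (fun n => stieltjesTransform (A n) z - stieltjesTransform (B n) z) atTop (nhds 0) := by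
  rw [Metric.tendsto_atTop']
  intro η hη
  obtain ⟨w, hw⟩ : ∃ w : ℝ, w = z.im⁻¹ := ⟨_, rfl⟩
  have hw0 : 0 < w := by rw [hw]; positivity
  obtain ⟨k, hk⟩ := exists_nat_one_div_lt (show 0 < η / (16 * w) by positivity)
  obtain ⟨δ, hδ⟩ : ∃ δ : ℝ, δ = 1 / ((k : ℝ) + 1) := ⟨_, rfl⟩
  have hδ1 : 4 * w * δ < η / 4 := by
    rw [← hδ, lt_div_iff₀ (by positivity)] at hk
    linarith
  obtain ⟨Kk, hKk⟩ : ∃ Kk : ℝ, Kk = K k := ⟨_, rfl⟩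
  have hKk0 : 0 ≤ Kk := hKk ▸ hK k
  obtain ⟨s, hs⟩ : ∃ s : ℝ, s = Real.sqrt (1 + Kk) := ⟨_, rfl⟩
  have hs0 : 0 < s := by rw [hs]; positivity
  have hs2 : s ^ 2 = 1 + Kk := by rw [hs]; exact Real.sq_sqrt (by positivity)
  obtain ⟨ε, hε⟩ : ∃ ε : ℝ, ε = η / (8 * w ^ 2 * s) := ⟨_, rfl⟩
  have hε0 : 0 < ε := by rw [hε]; positivity
  have hε1 : w ^ 2 * (ε * s) < η / 4 := by
    have : w ^ 2 * (ε * s) = η / 8 := by rw [hε]; field_simp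
    linarith
  have hlo := (hasDerivAt_iff_isLittleO.mp hf2).def hε0
  obtain ⟨r, hr0, hr⟩ := Metric.eventually_nhds_iff.mp hlo
  have e1 : ∀ᶠ n : ℕ in atTop, 4 * w / (n : ℝ) < η / 4 :=
    (tendsto_const_div_atTop_nhds_zero_nat (4 * w)).eventually_lt_const (by positivity)
  have e2 : ∀ᶠ n : ℕ in atTop, Kk / (n : ℝ) < r ^ 4 :=
    (tendsto_const_div_atTop_nhds_zero_nat Kk).eventually_lt_const (by positivity)
  have key : ∀ᶠ n : ℕ in atTop,
      dist (stieltjesTransform (A n) z - stieltjesTransform (B n) z) 0 < η := by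
    filter_upwards [h k, e1, e2, eventually_gt_atTop 0] with n hS h1 h2 hn
    obtain ⟨S, hSc, hS⟩ := hS
    rw [← hKk] at hS
    rw [← hδ] at hSc
    have hn' : (0 : ℝ) < n := by exact_mod_cast hn
    have hR : ∀ i ∉ S, ∀ j ∉ S, j < i →
        |f (‖x n i - x n j‖ ^ 2) - f 2 - f'2 * (‖x n i - x n j‖ ^ 2 - 2)| ≤ ε * |‖x n i - x n j‖ ^ 2 - 2| := by
      intro i hi j hj hij
      have h4 : (n : ℝ) * (‖x n i - x n j‖ ^ 2 - 2) ^ 4 ≤ Kk := by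
        refine le_trans ?_ (hS i hi)
        exact Finset.single_le_sum (f := fun j => (n : ℝ) * (‖x n i - x n j‖ ^ 2 - 2) ^ 4)
          (fun j _ => by positivity) (by simp [hij, hj])
      have h5 : |‖x n i - x n j‖ ^ 2 - 2| ^ 4 < r ^ 4 := by
        refine lt_of_le_of_lt ?_ h2
        rw [le_div_iff₀ hn', Even.pow_abs (by decide)]
        linarith
      have h6 := lt_of_pow_lt_pow_left₀ 4 hr0.le h5
      have h7 := hr (y := ‖x n i - x n j‖ ^ 2) (by rw [Real.dist_eq]; exact h6)
      rw [Real.norm_eq_abs, Real.norm_eq_abs, smul_eq_mul] at h7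
      rwa [mul_comm f'2]
    have hQ : ∀ i ∉ S, ∑ j ∈ Finset.univ.filter (fun j => j < i ∧ j ∉ S),
        (‖x n i - x n j‖ ^ 2 - 2) ^ 2 ≤ (1 + Kk) / 2 := by
      intro i hi
      have hle : ∀ j : Fin n, (‖x n i - x n j‖ ^ 2 - 2) ^ 2 ≤
          (1 / n) / 2 + ((n : ℝ) * (‖x n i - x n j‖ ^ 2 - 2) ^ 4) / 2 := by
        intro j
        obtain ⟨q, hq⟩ : ∃ q : ℝ, q = (‖x n i - x n j‖ ^ 2 - 2) ^ 2 := ⟨_, rfl⟩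
        have : (‖x n i - x n j‖ ^ 2 - 2) ^ 4 = q ^ 2 := by rw [hq]; ring
        rw [this, ← hq]
        have h9 : 0 ≤ (1 - n * q) ^ 2 / n := by positivity
        have h10 : (1 - n * q) ^ 2 / n = 1 / n - 2 * q + n * q ^ 2 := by field_simp; ring
        linarith
      calc _ ≤ ∑ j ∈ Finset.univ.filter (fun j => j < i ∧ j ∉ S),
            ((1 / (n : ℝ)) / 2 + ((n : ℝ) * (‖x n i - x n j‖ ^ 2 - 2) ^ 4) / 2) :=
            Finset.sum_le_sum fun j _ => hle j
        _ = (Finset.univ.filter (fun j => j < i ∧ j ∉ S)).card * ((1 / (n : ℝ)) / 2) +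
            (∑ j ∈ Finset.univ.filter (fun j => j < i ∧ j ∉ S),
              (n : ℝ) * (‖x n i - x n j‖ ^ 2 - 2) ^ 4) / 2 := by
            rw [Finset.sum_add_distrib, Finset.sum_const, nsmul_eq_mul, Finset.sum_div]
        _ ≤ n * ((1 / (n : ℝ)) / 2) + Kk / 2 := by
            have hcard : ((Finset.univ.filter (fun j => j < i ∧ j ∉ S)).card : ℝ) ≤ n := by
              have := Finset.card_le_univ (Finset.univ.filter (fun j => j < i ∧ j ∉ S))
              rw [Fintype.card_fin] at this
              exact_mod_cast this
            have := hS i hi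
            gcongr
        _ = (1 + Kk) / 2 := by field_simp
    have hdet := dk_det hn (x n) f f'2 (A n) (B n) (hA n) (hB n) S ε ((1 + Kk) / 2) hR (by positivity)
      (fun i hi => by convert hQ i hi) z hz
    rw [dist_zero_right]
    refine lt_of_le_of_lt hdet ?_
    have hsq : Real.sqrt (n * (2 * n * (ε ^ 2 * ((1 + Kk) / 2)))) = n * (ε * s) := by
      rw [← hs2, show (n : ℝ) * (2 * n * (ε ^ 2 * (s ^ 2 / 2))) = (n * (ε * s)) ^ 2 by ring]
      exact Real.sqrt_sq (by positivity)
    rw [hsq, ← hw]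
    calc (n : ℝ)⁻¹ * ((2 * S.card + 2) * (2 * w) + w ^ 2 * (n * (ε * s)))
        ≤ (n : ℝ)⁻¹ * ((2 * (δ * n) + 2) * (2 * w) + w ^ 2 * (n * (ε * s))) := by gcongr
      _ = 4 * w * δ + 4 * w / n + w ^ 2 * (ε * s) := by field_simp; ring
      _ < η := by linarith
  obtain ⟨N, hN⟩ := eventually_atTop.mp key
  exact ⟨N, fun n hn => hN n hn.le⟩

/-- Theorem 1.2 in the high-concentration setting (distance kernel, diagonal
included): `X_1, …, X_n ∈ ℝ^p` are iid, normalized by `E[X_i] = 0`, `E‖X_i‖² = 1`,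
whose distribution satisfies the concentration property: for absolute constants
`C, b > 0` and a rate `c(p) ≥ C₀ p^{b/2}`, for every `1`-Lipschitz `F : ℝ^p → ℝ` and
every median `m_F` of `F(X_i)`, `P(|F(X_i) − m_F| > t) ≤ C exp(−c(p) t^b)` for `t > 0`.
If `f` is differentiable at `2`, `A_{ij} = f(‖X_i − X_j‖²)` and
`B = (f(0) − f(2) + 2f′(2)) I_n − 2f′(2) (X_i^T X_j)_{ij}`, then almost surely
`m_A(z) − m_B(z) → 0` for every `z` in the upper half-plane, i.e. `A` and `B` have the
same limiting spectral distribution. -/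
theorem distance_kernel_concentration
    {Ω : Type*} [MeasureSpace Ω] [IsProbabilityMeasure (ℙ : Measure Ω)]
    -- the dimension p = p(n) → ∞ with p/n → γ ∈ (0,∞)
    (p : ℕ → ℕ) (γ : ℝ) (hγ : 0 < γ)
    (hp : Tendsto (fun n => (p n : ℝ)) atTop atTop)
    (hpγ : Tendsto (fun n => (p n : ℝ) / (n : ℝ)) atTop (nhds γ))
    -- the iid random vectors X n 1, ..., X n n in ℝ^(p n)
    (X : (n : ℕ) → Fin n → Ω → EuclideanSpace ℝ (Fin (p n)))
    (hXmeas : ∀ n i, Measurable (X n i))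
    (ν : (n : ℕ) → Measure (EuclideanSpace ℝ (Fin (p n))))
    (hindep : ∀ n, iIndepFun (X n) ℙ)
    (hdist : ∀ n (i : Fin n), Measure.map (X n i) ℙ = ν n)
    -- normalization: E[X_i] = 0 and E‖X_i‖² = 1
    (hmean : ∀ n (i : Fin n), ∫ ω, X n i ω ∂(ℙ : Measure Ω) = 0)
    (hnorm : ∀ n (i : Fin n), ∫ ω, ‖X n i ω‖ ^ 2 ∂(ℙ : Measure Ω) = 1)
    -- the high-concentration property with rate c(p) ≥ C₀ p^(b/2)
    (C b C₀ : ℝ) (hC : 0 < C) (hb : 0 < b) (hC₀ : 0 < C₀) (c : ℕ → ℝ)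
    (hc : ∀ q : ℕ, C₀ * (q : ℝ) ^ (b / 2) ≤ c q)
    (hconc : ∀ n (i : Fin n) (F : EuclideanSpace ℝ (Fin (p n)) → ℝ), LipschitzWith 1 F →
      ∀ m : ℝ, (1 / 2 : ℝ≥0∞) ≤ ℙ {ω | m ≤ F (X n i ω)} →
        (1 / 2 : ℝ≥0∞) ≤ ℙ {ω | F (X n i ω) ≤ m} →
        ∀ t : ℝ, 0 < t →
          (ℙ {ω | t < |F (X n i ω) - m|}).toReal ≤ C * Real.exp (-(c (p n)) * t ^ b))
    -- the envelope f, differentiable at 2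
    (f : ℝ → ℝ) (f'2 : ℝ) (hf2 : HasDerivAt f f'2 2)
    -- the matrices A and B
    (A B : (n : ℕ) → Ω → Matrix (Fin n) (Fin n) ℝ)
    (hA : ∀ n ω i j, A n ω i j = f (‖X n i ω - X n j ω‖ ^ 2))
    (hB : ∀ n ω, B n ω = (f 0 - f 2 + 2 * f'2) • (1 : Matrix (Fin n) (Fin n) ℝ)
      - (2 * f'2) • Matrix.of (fun i j => ⟪X n i ω, X n j ω⟫)) :
    ∀ᵐ ω ∂(ℙ : Measure Ω), ∀ z : ℂ, 0 < z.im →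
      Tendsto (fun n => stieltjesTransform (A n ω) z - stieltjesTransform (B n ω) z)
        atTop (nhds 0) := by
  classical
  obtain ⟨D, hD⟩ : ∃ D : ℝ, D = dkConst C b C₀ 4 + dkConst C b C₀ 8 := ⟨_, rfl⟩
  have hD0 : 0 < D := by
    rw [hD]
    exact add_pos (dkConst_pos C b C₀ hC hb hC₀ 4 (by norm_num)) (dkConst_pos C b C₀ hC hb hC₀ 8 (by norm_num))
  obtain ⟨M0, hM0⟩ : ∃ M0 : ℝ, M0 = 8 * ((8192 * D) * (12 + 2 * (8192 * D))) := ⟨_, rfl⟩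
  have hM0p : 0 < M0 := by rw [hM0]; positivity
  obtain ⟨M, hM⟩ : ∃ M : ℝ, M = M0 * (4 / γ ^ 2) := ⟨_, rfl⟩
  have hMp : 0 < M := by rw [hM]; positivity
  -- eventually the pair moments are controlled
  have hev : ∀ᶠ n : ℕ in atTop, 0 < n ∧ 1 ≤ p n ∧ γ / 2 * n ≤ p n := by
    have a1 : ∀ᶠ n : ℕ in atTop, (1 : ℝ) ≤ p n := hp.eventually_ge_atTop 1
    have a2 : ∀ᶠ n : ℕ in atTop, γ / 2 < (p n : ℝ) / n := hpγ.eventually_const_lt (by linarith)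
    filter_upwards [a1, a2, eventually_gt_atTop 0] with n b1 b2 b3
    have b3' : (0 : ℝ) < n := by exact_mod_cast b3
    refine ⟨b3, by exact_mod_cast b1, ?_⟩
    rw [lt_div_iff₀ b3'] at b2
    exact b2.le
  obtain ⟨N, hN⟩ := eventually_atTop.mp hev
  obtain ⟨K, hK⟩ : ∃ K : ℕ → ℝ, K = fun k : ℕ => 64 * (M + 1) / (1 / ((k : ℝ) + 1)) ^ 2 := ⟨_, rfl⟩
  have hprob : ∀ k n : ℕ, N ≤ n →
      (ℙ : Measure Ω) {ω | ¬ ∃ S : Finset (Fin n), (S.card : ℝ) ≤ (1 / ((k : ℝ) + 1)) * n ∧ ∀ i ∉ S,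
        ∑ j ∈ Finset.univ.filter (fun j => j < i ∧ j ∉ S), (n : ℝ) * (‖X n i ω - X n j ω‖ ^ 2 - 2) ^ 4 ≤
        K k} ≤ ENNReal.ofReal (Real.exp (-((1 / ((k : ℝ) + 1)) / 2)) ^ n) := by
    intro k n hn
    obtain ⟨n0, p1, pn⟩ := hN n hn
    have n0' : (0 : ℝ) < n := by exact_mod_cast n0
    have p0' : (0 : ℝ) < p n := by exact_mod_cast p1
    have hprobν : IsProbabilityMeasure (ν n) := by
      rw [← hdist n ⟨0, n0⟩]
      exact Measure.isProbabilityMeasure_map (hXmeas n _).aemeasurable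
    have hmom := dk_transfer ℙ p1 (X n ⟨0, n0⟩) (hXmeas n _) (ν n) (hdist n _) (hmean n _) (hnorm n _)
      C b C₀ hC hb hC₀ (c (p n)) (hc (p n)) (hconc n ⟨0, n0⟩) D hD
    have hmom2 : ∫⁻ y, ∫⁻ x, ENNReal.ofReal ((‖x - y‖ ^ 2 - 2) ^ 4) ∂(ν n) ∂(ν n) ≤
        ENNReal.ofReal (M / (n : ℝ) ^ 2) := by
      refine hmom.trans (ENNReal.ofReal_le_ofReal ?_)
      rw [← hM0]
      calc M0 / (p n : ℝ) ^ 2 ≤ M0 / (γ / 2 * n) ^ 2 := by gcongr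
        _ = M / (n : ℝ) ^ 2 := by rw [hM]; field_simp; norm_num
    have := dk_prob ℙ n0 (X n) (hXmeas n) (hindep n) (ν n) (hdist n) M hMp.le hmom2
      (1 / ((k : ℝ) + 1)) (by positivity) (K k) (by rw [hK])
    convert this
  have hBC : ∀ k : ℕ, ∀ᵐ ω ∂(ℙ : Measure Ω), ∀ᶠ n : ℕ in atTop,
      ∃ S : Finset (Fin n), (S.card : ℝ) ≤ (1 / ((k : ℝ) + 1)) * n ∧ ∀ i ∉ S,
        ∑ j ∈ Finset.univ.filter (fun j => j < i ∧ j ∉ S), (n : ℝ) * (‖X n i ω - X n j ω‖ ^ 2 - 2) ^ 4 ≤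
        K k := by
    intro k
    obtain ⟨q, hq⟩ : ∃ q : ℝ, q = Real.exp (-((1 / ((k : ℝ) + 1)) / 2)) := ⟨_, rfl⟩
    have hq0 : 0 ≤ q := by rw [hq]; positivity
    have hq1 : q < 1 := by
      rw [hq, Real.exp_lt_one_iff]
      have : 0 < 1 / ((k : ℝ) + 1) / 2 := by positivity
      linarith
    have hsum : ∑' n : ℕ, (ℙ : Measure Ω) {ω | N ≤ n ∧ ¬ ∃ S : Finset (Fin n),
        (S.card : ℝ) ≤ (1 / ((k : ℝ) + 1)) * n ∧ ∀ i ∉ S,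
        ∑ j ∈ Finset.univ.filter (fun j => j < i ∧ j ∉ S), (n : ℝ) * (‖X n i ω - X n j ω‖ ^ 2 - 2) ^ 4 ≤
        K k} ≠ ∞ := by
      refine ne_top_of_le_ne_top ?_ (ENNReal.tsum_le_tsum (g := fun n => ENNReal.ofReal (q ^ n)) ?_)
      · exact (summable_geometric_of_lt_one hq0 hq1).tsum_ofReal_ne_top
      · intro n
        by_cases hn : N ≤ n
        · rw [hq]
          refine le_trans (measure_mono ?_) (hprob k n hn)
          intro ω hω
          exact hω.2
        · simp [hn]
    filter_upwards [ae_eventually_notMem hsum] with ω hω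
    filter_upwards [hω, eventually_ge_atTop N] with n h1 h2
    by_contra h3
    exact h1 ⟨h2, h3⟩
  filter_upwards [ae_all_iff.mpr hBC] with ω hω z hz
  refine dk_final p (fun n i => X n i ω) f f'2 hf2 (fun n => A n ω) (fun n => B n ω)
    (fun n i j => hA n ω i j) (fun n => hB n ω) K (fun k => by rw [hK]; positivity) ?_ z hz
  intro k
  filter_upwards [hω k] with n hn
  convert hn
end

section
/- Let n→∞ with p=p(n)→∞. For each n let X_1,…,X_n be iid random vectors in ℝ^p, let g:ℝ^p×ℝ^p→ℝ be symmetric and measurable, and let f:ℝ→ℝ be continuous at b:=E[g(X_1,X_1)]. Assume that for every fixed δ>0, P(max_{1≤i≤n}|g(X_i,X_i)−b|>δ)→0 as n→∞. Let A_1 be the n×n matrix with entries (A_1)_{ij}=f(g(X_i,X_j)) for all i,j, and let A_2 agree with A_1 off the diagonal but have zero diagonal entries. Then for every fixed complex z with Im z>0, almost surely |m_{A_1}(z+f(b))−m_{A_2}(z)|→0 as n→∞. -/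
open MeasureTheory ProbabilityTheory Filter Matrix

section Helpers

/-- The shifted matrix `M - z`. -/
noncomputable def shiftMat {n : ℕ} (M : Matrix (Fin n) (Fin n) ℝ) (z : ℂ) :
    Matrix (Fin n) (Fin n) ℂ :=
  M.map (fun x : ℝ => (x : ℂ)) - z • (1 : Matrix (Fin n) (Fin n) ℂ)

/-- Imaginary part of the quadratic form of `M - z`. -/
lemma im_quad {n : ℕ} (M : Matrix (Fin n) (Fin n) ℝ) (hM : ∀ i j, M i j = M j i) (z : ℂ)
    (u : Fin n → ℂ) :
    (star u ⬝ᵥ (shiftMat M z *ᵥ u)).im = - z.im * ∑ k, Complex.normSq (u k) := by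
  have h1 : star u ⬝ᵥ (shiftMat M z *ᵥ u)
      = (∑ i, ∑ j, star (u i) * (M i j : ℂ) * u j) - z * ((∑ k, Complex.normSq (u k) : ℝ) : ℂ) := by
    unfold shiftMat
    rw [Matrix.sub_mulVec, dotProduct_sub, Matrix.smul_mulVec, Matrix.one_mulVec, dotProduct_smul]
    congr 1
    · simp [dotProduct, Matrix.mulVec, Finset.mul_sum, mul_assoc]
    · simp [dotProduct, Complex.normSq_eq_conj_mul_self]
  have h2 : (∑ i, ∑ j, star (u i) * (M i j : ℂ) * u j).im = 0 := by
    rw [← Complex.conj_eq_iff_im, map_sum]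
    simp_rw [map_sum]
    rw [Finset.sum_comm]
    refine Finset.sum_congr rfl fun i _ => Finset.sum_congr rfl fun j _ => ?_
    rw [hM j i]
    simp
    ring
  rw [h1, Complex.sub_im, h2, Complex.im_mul_ofReal]
  ring

lemma sum_normSq_eq_zero {n : ℕ} {u : Fin n → ℂ} (h : ∑ k, Complex.normSq (u k) = 0) : u = 0 := by
  rw [Finset.sum_eq_zero_iff_of_nonneg (fun i _ => Complex.normSq_nonneg _)] at h
  ext i
  simpa using h i (Finset.mem_univ i)

lemma shift_isUnit {n : ℕ} (M : Matrix (Fin n) (Fin n) ℝ) (hM : ∀ i j, M i j = M j i) (z : ℂ)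
    (hz : 0 < z.im) : IsUnit (shiftMat M z).det := by
  rw [isUnit_iff_ne_zero]
  intro h0
  obtain ⟨u, hu, h⟩ := Matrix.exists_mulVec_eq_zero_iff.mpr h0
  have h1 := im_quad M hM z u
  rw [h] at h1
  apply hu
  apply sum_normSq_eq_zero
  simp at h1
  rcases h1 with h1 | h1
  · exact absurd h1 hz.ne'
  · exact h1

lemma shift_transpose {n : ℕ} (M : Matrix (Fin n) (Fin n) ℝ) (hM : ∀ i j, M i j = M j i) (z : ℂ) :
    (shiftMat M z)ᵀ = shiftMat M z := by
  ext i j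
  simp [shiftMat, hM i j, Matrix.one_apply, eq_comm]

lemma res_symm {n : ℕ} (M : Matrix (Fin n) (Fin n) ℝ) (hM : ∀ i j, M i j = M j i) (z : ℂ)
    (i j : Fin n) : (shiftMat M z)⁻¹ i j = (shiftMat M z)⁻¹ j i := by
  have := Matrix.transpose_nonsing_inv (shiftMat M z)
  rw [shift_transpose M hM] at this
  rw [← congrFun (congrFun this j) i, Matrix.transpose_apply]

/-- Ward identity: the imaginary part of a diagonal resolvent entry. -/
lemma im_res {n : ℕ} (M : Matrix (Fin n) (Fin n) ℝ) (hM : ∀ i j, M i j = M j i) (z : ℂ)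
    (hz : 0 < z.im) (i : Fin n) :
    ((shiftMat M z)⁻¹ i i).im = z.im * ∑ k, Complex.normSq ((shiftMat M z)⁻¹ k i) := by
  have h := im_quad M hM z (fun k => (shiftMat M z)⁻¹ k i)
  have h2 : shiftMat M z *ᵥ (fun k => (shiftMat M z)⁻¹ k i) = Pi.single i 1 := by
    have h3 := Matrix.mul_nonsing_inv _ (shift_isUnit M hM z hz)
    ext k
    have := congrFun (congrFun h3 k) i
    rw [Matrix.mul_apply] at this
    simp only [Matrix.mulVec, dotProduct]
    rw [this, Matrix.one_apply, Pi.single_apply]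
  rw [h2, dotProduct_single] at h
  simp at h
  linarith

lemma sum_res_le {n : ℕ} (M : Matrix (Fin n) (Fin n) ℝ) (hM : ∀ i j, M i j = M j i) (z : ℂ)
    (hz : 0 < z.im) (i : Fin n) :
    ∑ k, Complex.normSq ((shiftMat M z)⁻¹ k i) ≤ 1 / z.im ^ 2 := by
  have h := im_res M hM z hz i
  set S := ∑ k, Complex.normSq ((shiftMat M z)⁻¹ k i) with hS
  have h1 : Complex.normSq ((shiftMat M z)⁻¹ i i) ≤ S :=
    Finset.single_le_sum (f := fun k => Complex.normSq ((shiftMat M z)⁻¹ k i))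
      (fun k _ => Complex.normSq_nonneg _) (Finset.mem_univ i)
  rw [Complex.normSq_apply, h] at h1
  have h0 : 0 ≤ S := Finset.sum_nonneg fun k _ => Complex.normSq_nonneg _
  rw [le_div_iff₀ (by positivity)]
  rcases h0.eq_or_lt with h0 | h0
  · rw [← h0]; simp
  · have h2 : (S * z.im ^ 2) * S ≤ 1 * S := by
      nlinarith [mul_self_nonneg ((shiftMat M z)⁻¹ i i).re]
    exact le_of_mul_le_mul_right h2 h0

/-- Changing one diagonal entry. -/
lemma one_step {n : ℕ} (M : Matrix (Fin n) (Fin n) ℝ) (hM : ∀ i j, M i j = M j i) (z : ℂ)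
    (hz : 0 < z.im) (i : Fin n) (d : ℝ) :
    ‖((shiftMat (M + Matrix.diagonal (Pi.single i d)) z)⁻¹).trace - ((shiftMat M z)⁻¹).trace‖
      ≤ 1 / z.im ∧
    ‖((shiftMat (M + Matrix.diagonal (Pi.single i d)) z)⁻¹).trace - ((shiftMat M z)⁻¹).trace‖
      ≤ |d| / z.im ^ 2 := by
  set M' := M + Matrix.diagonal (Pi.single i d) with hM'def
  have hM' : ∀ a b, M' a b = M' b a := by
    intro a b
    simp only [hM'def, Matrix.add_apply, hM a b, Matrix.diagonal_apply]
    by_cases hab : a = b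
    · subst hab; rfl
    · simp [hab, Ne.symm hab]
  set R := (shiftMat M z)⁻¹ with hR
  set R' := (shiftMat M' z)⁻¹ with hR'
  have hdiff : shiftMat M' z = shiftMat M z + Matrix.diagonal (Pi.single i (d : ℂ)) := by
    ext a b
    simp only [shiftMat, hM'def, Matrix.sub_apply, Matrix.add_apply, Matrix.map_apply,
      Matrix.diagonal_apply, Pi.single_apply]
    split_ifs <;> simp <;> ring
  have e1 : R * shiftMat M z = 1 := Matrix.nonsing_inv_mul _ (shift_isUnit M hM z hz)
  have e1' : shiftMat M' z * R' = 1 := Matrix.mul_nonsing_inv _ (shift_isUnit M' hM' z hz)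
  have key : R' = R - R * Matrix.diagonal (Pi.single i (d : ℂ)) * R' := by
    have : R * (shiftMat M' z) * R' = R := by rw [Matrix.mul_assoc, e1', Matrix.mul_one]
    rw [hdiff, Matrix.mul_add, e1, Matrix.add_mul, Matrix.one_mul] at this
    exact eq_sub_of_add_eq this
  have entry : ∀ a b, R' a b = R a b - d * R a i * R' i b := by
    intro a b
    conv_lhs => rw [key]
    rw [Matrix.sub_apply, Matrix.mul_apply, Finset.sum_eq_single i]
    · rw [Matrix.mul_diagonal, Pi.single_eq_same]; ring
    · intro k _ hk; simp [Matrix.mul_diagonal, hk]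
    · simp
  have sR : ∀ a b, R a b = R b a := res_symm M hM z
  have sR' : ∀ a b, R' a b = R' b a := res_symm M' hM' z
  have tr : R'.trace - R.trace = - d * ∑ k, R k i * R' k i := by
    simp only [Matrix.trace, Matrix.diag_apply]
    rw [← Finset.sum_sub_distrib, Finset.mul_sum]
    refine Finset.sum_congr rfl fun k _ => ?_
    rw [entry k k, sR' i k]; ring
  have hbd : ∀ P Q : Fin n → ℂ, ‖∑ k, P k * Q k‖ ≤
      ((∑ k, Complex.normSq (P k)) + ∑ k, Complex.normSq (Q k)) / 2 := by
    intro P Q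
    refine (norm_sum_le _ _).trans ?_
    rw [← Finset.sum_add_distrib, Finset.sum_div]
    refine Finset.sum_le_sum fun k _ => ?_
    rw [norm_mul, Complex.normSq_eq_norm_sq, Complex.normSq_eq_norm_sq]
    nlinarith [sq_nonneg (‖P k‖ - ‖Q k‖)]
  constructor
  · by_cases hd : d = 0
    · rw [tr, hd]; simp; exact hz.le
    have hcol : ∀ k, R' k i * (1 + d * R i i) = R k i := by
      intro k
      have h1 := entry i i
      have h2 := entry k i
      linear_combination (1 + d * R i i) * h2 - d * R k i * h1
    have htr : (R'.trace - R.trace) * (1 + d * R i i) = - d * ∑ k, R k i * R k i := by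
      rw [tr, mul_assoc, Finset.sum_mul]
      congr 1
      refine Finset.sum_congr rfl fun k _ => ?_
      rw [mul_assoc, hcol]
    set S := ∑ k, Complex.normSq (R k i) with hS
    have him : (R i i).im = z.im * S := im_res M hM z hz i
    have hS0 : 0 ≤ S := Finset.sum_nonneg fun k _ => Complex.normSq_nonneg _
    have hSne : S ≠ 0 := by
      intro h0
      have h1 := sum_normSq_eq_zero h0
      have h2 : (R * shiftMat M z) i i = 0 := by
        rw [Matrix.mul_apply]
        refine Finset.sum_eq_zero fun k _ => ?_
        have := congrFun h1 k
        simp only [Pi.zero_apply] at this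
        rw [sR i k, this, zero_mul]
      rw [e1] at h2
      simp at h2
    have hSpos : 0 < S := lt_of_le_of_ne hS0 (Ne.symm hSne)
    have hlow : |d| * (z.im * S) ≤ ‖1 + d * R i i‖ := by
      have h1 := Complex.abs_im_le_norm (1 + d * R i i)
      have h2 : (1 + d * R i i).im = d * (z.im * S) := by
        simp [him]
      rw [h2, abs_mul, abs_of_nonneg (mul_nonneg hz.le hS0)] at h1
      exact h1
    have hup : ‖R'.trace - R.trace‖ * ‖1 + d * R i i‖ ≤ |d| * S := by
      rw [← norm_mul, htr, norm_mul, norm_neg, Complex.norm_real, Real.norm_eq_abs]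
      refine mul_le_mul_of_nonneg_left ?_ (abs_nonneg d)
      have := hbd (fun k => R k i) (fun k => R k i)
      linarith
    have hdS : 0 < |d| * S := mul_pos (abs_pos.mpr hd) hSpos
    rw [le_div_iff₀ hz]
    refine le_of_mul_le_mul_right ?_ hdS
    calc ‖R'.trace - R.trace‖ * z.im * (|d| * S)
        = ‖R'.trace - R.trace‖ * (|d| * (z.im * S)) := by ring
      _ ≤ ‖R'.trace - R.trace‖ * ‖1 + d * R i i‖ :=
          mul_le_mul_of_nonneg_left hlow (norm_nonneg _)
      _ ≤ 1 * (|d| * S) := by rw [one_mul]; exact hup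
  · rw [tr, norm_mul, norm_neg, Complex.norm_real, Real.norm_eq_abs, div_eq_mul_one_div]
    refine mul_le_mul_of_nonneg_left ?_ (abs_nonneg d)
    have h1 := hbd (fun k => R k i) (fun k => R' k i)
    have h2 := sum_res_le M hM z hz i
    have h3 := sum_res_le M' hM' z hz i
    exact h1.trans (by linarith)

lemma many_step {n : ℕ} (M : Matrix (Fin n) (Fin n) ℝ) (hM : ∀ i j, M i j = M j i) (z : ℂ)
    (hz : 0 < z.im) (d c : Fin n → ℝ) (hc : ∀ i, 1 / z.im ≤ c i ∨ |d i| / z.im ^ 2 ≤ c i)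
    (T : Finset (Fin n)) :
    ‖((shiftMat (M + Matrix.diagonal (fun i => if i ∈ T then d i else 0)) z)⁻¹).trace
      - ((shiftMat M z)⁻¹).trace‖ ≤ ∑ i ∈ T, c i := by
  classical
  induction T using Finset.induction_on with
  | empty =>
    have : (Matrix.diagonal (fun i : Fin n => if i ∈ (∅ : Finset (Fin n)) then d i else 0)) = 0 := by
      ext a b; simp [Matrix.diagonal_apply]
    rw [this]; simp
  | insert a T ha ih =>
    set N := M + Matrix.diagonal (fun i => if i ∈ T then d i else 0) with hN
    have hNs : ∀ i j, N i j = N j i := by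
      intro i j
      simp only [hN, Matrix.add_apply, hM i j, Matrix.diagonal_apply]
      by_cases hab : i = j
      · subst hab; rfl
      · simp [hab, Ne.symm hab]
    have e : M + Matrix.diagonal (fun i => if i ∈ insert a T then d i else 0)
        = N + Matrix.diagonal (Pi.single a (d a)) := by
      rw [hN, add_assoc, Matrix.diagonal_add]
      congr 2
      funext i
      by_cases hi : i = a
      · subst hi; simp [ha]
      · simp [hi]
    rw [e, Finset.sum_insert ha]
    obtain ⟨h1, h2⟩ := one_step N hNs z hz a (d a)
    have h3 : ‖((shiftMat (N + Matrix.diagonal (Pi.single a (d a))) z)⁻¹).trace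
        - ((shiftMat N z)⁻¹).trace‖ ≤ c a := by
      rcases hc a with h | h
      · exact h1.trans h
      · exact h2.trans h
    refine (norm_sub_le_norm_sub_add_norm_sub _ ((shiftMat N z)⁻¹).trace _).trans ?_
    exact add_le_add h3 ih

/-- The deterministic comparison. -/
lemma det_bound {n : ℕ} (A₁ A₂ : Matrix (Fin n) (Fin n) ℝ) (hA : ∀ i j, A₁ i j = A₁ j i)
    (h0 : ∀ i j, A₂ i j = if i = j then 0 else A₁ i j) (z : ℂ) (hz : 0 < z.im) (β ε : ℝ)
    (hε : 0 < ε) (B : Finset (Fin n)) (hB : ∀ i, i ∉ B → |A₁ i i - β| ≤ ε)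
    (hcard : (B.card : ℝ) ≤ ε * n) :
    ‖stieltjesTransform A₁ (z + (β : ℂ)) - stieltjesTransform A₂ z‖
      ≤ ε * (1 / z.im + 1 / z.im ^ 2) := by
  classical
  have hA2 : ∀ i j, A₂ i j = A₂ j i := by
    intro i j
    rw [h0, h0, hA i j]
    simp [eq_comm]
  have hs : A₁.map (fun x : ℝ => (x : ℂ)) - (z + (β : ℂ)) • (1 : Matrix (Fin n) (Fin n) ℂ)
      = shiftMat (A₂ + Matrix.diagonal
        (fun i => if i ∈ (Finset.univ : Finset (Fin n)) then A₁ i i - β else 0)) z := by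
    ext i j
    simp only [shiftMat, Matrix.sub_apply, Matrix.add_apply, Matrix.map_apply,
      Matrix.diagonal_apply, h0, Matrix.smul_apply, Matrix.one_apply]
    by_cases hij : i = j
    · subst hij; simp; ring
    · simp [hij]
  have hm := many_step A₂ hA2 z hz (fun i => A₁ i i - β)
    (fun i => (if i ∈ B then 1 / z.im else 0) + ε / z.im ^ 2) (by
      intro i
      by_cases hi : i ∈ B
      · left; simp [hi]; positivity
      · right
        simp only [hi, if_false, zero_add]
        have := hB i hi
        gcongr) Finset.univ
  rw [← hs] at hm
  have hsum : ∑ i : Fin n, ((if i ∈ B then 1 / z.im else 0) + ε / z.im ^ 2)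
      = B.card * (1 / z.im) + n * (ε / z.im ^ 2) := by
    rw [Finset.sum_add_distrib]
    simp
  rw [hsum] at hm
  unfold stieltjesTransform
  rw [← mul_sub, norm_mul]
  change _ * ‖_ - ((shiftMat A₂ z)⁻¹).trace‖ ≤ _
  rcases Nat.eq_zero_or_pos n with hn | hn
  · subst hn
    simp; positivity
  have hn' : (0 : ℝ) < n := by exact_mod_cast hn
  rw [norm_inv, Complex.norm_natCast, inv_mul_le_iff₀ hn']
  refine hm.trans ?_
  have : (B.card : ℝ) * (1 / z.im) ≤ ε * n * (1 / z.im) := by gcongr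
  calc _ ≤ ε * n * (1 / z.im) + n * (ε / z.im ^ 2) := by linarith
    _ = _ := by ring

open scoped ENNReal in
/-- Union bound for the number of bad indices. -/
lemma prob_bound {Ω : Type*} [MeasurableSpace Ω] (μ : Measure Ω) {n m k : ℕ}
    (X : Fin n → Ω → (Fin m → ℝ)) (hX : iIndepFun X μ)
    (E : Set (Fin m → ℝ)) (hE : MeasurableSet E)
    (hq : ∀ i, μ (X i ⁻¹' E) ≤ (4⁻¹ : ℝ≥0∞) ^ (k + 1)) :
    μ {ω | ∃ B : Finset (Fin n), n ≤ (k + 1) * B.card ∧ ∀ i ∈ B, X i ω ∈ E}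
      ≤ (2⁻¹ : ℝ≥0∞) ^ n := by
  classical
  have hsub : {ω | ∃ B : Finset (Fin n), n ≤ (k + 1) * B.card ∧ ∀ i ∈ B, X i ω ∈ E}
      ⊆ ⋃ B ∈ (Finset.univ.filter fun B : Finset (Fin n) => n ≤ (k + 1) * B.card),
        ⋂ i ∈ B, X i ⁻¹' E := by
    rintro ω ⟨B, h1, h2⟩
    simp only [Set.mem_iUnion, Set.mem_iInter, Finset.mem_filter, Finset.mem_univ, true_and]
    exact ⟨B, h1, h2⟩
  refine (measure_mono hsub).trans ((measure_biUnion_finset_le _ _).trans ?_)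
  have hterm : ∀ B ∈ (Finset.univ.filter fun B : Finset (Fin n) => n ≤ (k + 1) * B.card),
      μ (⋂ i ∈ B, X i ⁻¹' E) ≤ (4⁻¹ : ℝ≥0∞) ^ n := by
    intro B hB
    rw [Finset.mem_filter] at hB
    rw [hX.measure_inter_preimage_eq_mul B (sets := fun _ => E) (fun _ _ => hE)]
    refine (Finset.prod_le_pow_card B _ _ (fun i _ => hq i)).trans ?_
    rw [← pow_mul]
    exact pow_le_pow_right_of_le_one' (by norm_num) hB.2
  refine (Finset.sum_le_card_nsmul _ _ _ hterm).trans ?_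
  rw [nsmul_eq_mul]
  have hc : ((Finset.univ.filter fun B : Finset (Fin n) => n ≤ (k + 1) * B.card).card : ℝ≥0∞)
      ≤ 2 ^ n := by
    have := Finset.card_filter_le (Finset.univ : Finset (Finset (Fin n)))
      (fun B => n ≤ (k + 1) * B.card)
    rw [Finset.card_univ, Fintype.card_finset, Fintype.card_fin] at this
    exact_mod_cast this
  calc _ ≤ (2 : ℝ≥0∞) ^ n * 4⁻¹ ^ n := by gcongr
    _ = 2⁻¹ ^ n := by
      rw [← mul_pow]
      congr 1
      rw [show (4 : ℝ≥0∞) = 2 * 2 by norm_num, ENNReal.mul_inv (by simp) (by simp), ← mul_assoc,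
        ENNReal.mul_inv_cancel (by simp) (by simp), one_mul]

end Helpers

/-- Lemma 3.2 (removing the diagonal): `X_1, …, X_n ∈ ℝ^p` iid, `g` symmetric measurable,
`f` continuous at `b = E g(X_1, X_1)`, and
`P(max_i |g(X_i,X_i) − b| > δ) → 0` for every fixed `δ > 0`.  If
`(A_1)_{ij} = f(g(X_i,X_j))` and `A_2` agrees with `A_1` off the diagonal but has zero
diagonal, then for every fixed `z` in the upper half-plane, almost surely
`|m_{A_1}(z + f(b)) − m_{A_2}(z)| → 0`. -/
theorem remove_diagonal
    {Ω : Type*} [MeasureSpace Ω] [IsProbabilityMeasure (ℙ : Measure Ω)]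
    -- the dimension p = p(n) → ∞
    (p : ℕ → ℕ) (hp : Tendsto (fun n => (p n : ℝ)) atTop atTop)
    -- the iid random vectors X n 1, ..., X n n in ℝ^(p n)
    (X : (n : ℕ) → Fin n → Ω → Fin (p n) → ℝ)
    (hXmeas : ∀ n i, Measurable (X n i))
    (ν : (n : ℕ) → Measure (Fin (p n) → ℝ))
    (hindep : ∀ n, iIndepFun (X n) ℙ)
    (hdist : ∀ n (i : Fin n), Measure.map (X n i) ℙ = ν n)
    -- the symmetric measurable kernel g
    (g : (n : ℕ) → (Fin (p n) → ℝ) → (Fin (p n) → ℝ) → ℝ)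
    (hgmeas : ∀ n, Measurable (fun v : (Fin (p n) → ℝ) × (Fin (p n) → ℝ) => g n v.1 v.2))
    (hgsymm : ∀ n x y, g n x y = g n y x)
    -- b = E g(X_i, X_i) and f is continuous at b
    (b : ℝ)
    (hb : ∀ n (i : Fin n), ∫ ω, g n (X n i ω) (X n i ω) ∂(ℙ : Measure Ω) = b)
    (f : ℝ → ℝ) (hf : ContinuousAt f b)
    -- concentration of the diagonal entries around b
    (hconc : ∀ δ : ℝ, 0 < δ → Tendsto (fun n =>
      (ℙ {ω | ∃ i : Fin n, δ < |g n (X n i ω) (X n i ω) - b|}).toReal) atTop (nhds 0))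
    -- the matrices A₁ (full) and A₂ (zero diagonal)
    (A₁ A₂ : (n : ℕ) → Ω → Matrix (Fin n) (Fin n) ℝ)
    (hA₁ : ∀ n ω i j, A₁ n ω i j = f (g n (X n i ω) (X n j ω)))
    (hA₂ : ∀ n ω i j, A₂ n ω i j = if i = j then 0 else f (g n (X n i ω) (X n j ω))) :
    ∀ z : ℂ, 0 < z.im →
      ∀ᵐ ω ∂(ℙ : Measure Ω),
        Tendsto (fun n =>
            ‖stieltjesTransform (A₁ n ω) (z + (f b : ℂ)) - stieltjesTransform (A₂ n ω) z‖)
          atTop (nhds 0) := by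
  intro z hz
  have main : ∀ k : ℕ, ∀ᵐ ω ∂(ℙ : Measure Ω), ∀ᶠ n in atTop,
      ‖stieltjesTransform (A₁ n ω) (z + (f b : ℂ)) - stieltjesTransform (A₂ n ω) z‖
        ≤ (1 / ((k : ℝ) + 1)) * (1 / z.im + 1 / z.im ^ 2) := by
    intro k
    have hε : (0 : ℝ) < 1 / ((k : ℝ) + 1) := by positivity
    obtain ⟨δ', hδ', hfδ⟩ := Metric.continuousAt_iff.mp hf _ hε
    set δ := δ' / 2 with hδdef
    have hδ : 0 < δ := by positivity
    set E : (n : ℕ) → Set (Fin (p n) → ℝ) := fun n => {x | δ < |g n x x - b|} with hE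
    have hEm : ∀ n, MeasurableSet (E n) := by
      intro n
      have h1 : Measurable (fun x : Fin (p n) → ℝ => g n x x) :=
        (hgmeas n).comp (measurable_id.prodMk measurable_id)
      exact measurableSet_lt measurable_const (by
        have := (h1.sub_const b).norm
        simpa [Real.norm_eq_abs] using this)
    have hsm : ∀ᶠ n in atTop, ∀ i : Fin n,
        (ℙ : Measure Ω) (X n i ⁻¹' E n) ≤ (4⁻¹ : ENNReal) ^ (k + 1) := by
      have hr : (0 : ℝ) < (4⁻¹ : ℝ) ^ (k + 1) := by positivity
      filter_upwards [(hconc δ hδ).eventually (gt_mem_nhds hr)] with n hn i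
      have h1 : (ℙ : Measure Ω) (X n i ⁻¹' E n)
          ≤ ℙ {ω | ∃ i : Fin n, δ < |g n (X n i ω) (X n i ω) - b|} :=
        measure_mono fun ω hω => ⟨i, hω⟩
      refine h1.trans ?_
      rw [← ENNReal.toReal_le_toReal (measure_ne_top _ _) (by simp)]
      simpa using hn.le
    obtain ⟨N, hN⟩ := eventually_atTop.mp hsm
    set s : ℕ → Set Ω := fun n => if N ≤ n then
      {ω | ∃ B : Finset (Fin n), n ≤ (k + 1) * B.card ∧ ∀ i ∈ B, X n i ω ∈ E n} else ∅ with hs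
    have hbd : ∀ n, (ℙ : Measure Ω) (s n) ≤ (2⁻¹ : ENNReal) ^ n := by
      intro n
      by_cases hn : N ≤ n
      · simp only [hs, hn, if_true]
        exact prob_bound _ (X n) (hindep n) (E n) (hEm n) (hN n hn)
      · simp [hs, hn]
    have hsum : ∑' n, (ℙ : Measure Ω) (s n) ≠ ⊤ := by
      refine ne_top_of_le_ne_top ?_ (ENNReal.tsum_le_tsum hbd)
      rw [ENNReal.tsum_geometric]
      simp
    filter_upwards [ae_eventually_notMem hsum] with ω hω
    filter_upwards [hω, eventually_ge_atTop N] with n hn hNn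
    classical
    simp only [hs, hNn, if_true, Set.mem_setOf_eq, not_exists, not_and] at hn
    refine det_bound (A₁ n ω) (A₂ n ω) ?_ ?_ z hz (f b) _ hε
      (Finset.univ.filter fun i => X n i ω ∈ E n) ?_ ?_
    · intro i j; rw [hA₁, hA₁, hgsymm]
    · intro i j; rw [hA₂, hA₁]
    · intro i hi
      simp only [Finset.mem_filter, Finset.mem_univ, true_and, hE, Set.mem_setOf_eq, not_lt] at hi
      rw [hA₁]
      have h1 : dist (g n (X n i ω) (X n i ω)) b < δ' := by
        rw [Real.dist_eq]; linarith
      have h2 := hfδ h1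
      rw [Real.dist_eq] at h2
      exact h2.le
    · have h1 : ¬ n ≤ (k + 1) * (Finset.univ.filter fun i => X n i ω ∈ E n).card := by
        intro hle
        exact hn _ hle (fun i hi => (Finset.mem_filter.mp hi).2)
      rw [not_le] at h1
      have h2 : ((k : ℝ) + 1) * ((Finset.univ.filter fun i => X n i ω ∈ E n).card : ℝ) ≤ n := by
        exact_mod_cast h1.le
      rw [one_div, ← div_eq_inv_mul, le_div_iff₀ (by positivity)]
      linarith
  rw [← ae_all_iff] at main
  filter_upwards [main] with ω hω
  have hC : 0 < 1 / z.im + 1 / z.im ^ 2 := by positivity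
  rw [Metric.tendsto_nhds]
  intro ε hε
  obtain ⟨k, hk⟩ := exists_nat_one_div_lt (div_pos hε hC)
  filter_upwards [hω k] with n hn
  rw [dist_zero_right, norm_norm]
  refine hn.trans_lt ?_
  rwa [lt_div_iff₀ hC] at hk
end

section
/- Let M be a p×n random matrix with independent entries, and let A be the n×n matrix with A_{ij}=F(M_i,M_j,p), where M_i denotes the i-th column of M and F:ℝ^p×ℝ^p×ℝ→ℝ is measurable, real-valued and symmetric in its first two variables; let Ã agree with A off the diagonal and have zero diagonal. Fix z with Im z>0. Then, as n→∞ (with any p=p(n)), almost surely |m_A(z)−E m_A(z)|→0 and almost surely |m_{Ã}(z)−E m_{Ã}(z)|→0. -/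
open MeasureTheory ProbabilityTheory Filter Matrix

lemma st_trace_bound {n : ℕ} (X : Matrix (Fin n) (Fin n) ℂ) (C : ℝ)
    (hX : ∀ v, ‖Matrix.toEuclideanLin X v‖ ≤ C * ‖v‖) : ‖X.trace‖ ≤ X.rank * C := by
  set T := Matrix.toEuclideanLin X with hT
  have htr : X.trace = LinearMap.trace ℂ _ T := by
    rw [hT, Matrix.toEuclideanLin_eq_toLin, Matrix.trace_toLin_eq]
  have hrk : X.rank = Module.finrank ℂ (LinearMap.range T) := by
    rw [hT, Matrix.toEuclideanLin_eq_toLin, ← Matrix.rank_eq_finrank_range_toLin]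
  rw [htr, hrk, ← LinearMap.trace_restrict_eq_of_forall_mem (LinearMap.range T) T (fun x => ⟨x, rfl⟩)]
  set b := stdOrthonormalBasis ℂ (LinearMap.range T)
  rw [LinearMap.trace_eq_sum_inner _ b]
  refine (norm_sum_le _ _).trans ?_
  refine (Finset.sum_le_sum (g := fun _ => C) fun i _ => ?_).trans (by simp)
  · refine (norm_inner_le_norm _ _).trans ?_
    have h1 : ‖b i‖ = 1 := b.norm_eq_one i
    rw [h1, one_mul]
    refine (hX (b i)).trans ?_
    rw [← Submodule.coe_norm, h1, mul_one]

noncomputable def stShift {n : ℕ} (A : Matrix (Fin n) (Fin n) ℝ) (z : ℂ) : Matrix (Fin n) (Fin n) ℂ :=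
  A.map (fun x : ℝ => (x : ℂ)) - z • (1 : Matrix (Fin n) (Fin n) ℂ)

lemma st_lower {n : ℕ} (A : Matrix (Fin n) (Fin n) ℝ) (hA : ∀ i j, A i j = A j i) (z : ℂ)
    (hz : 0 < z.im) (v : EuclideanSpace ℂ (Fin n)) :
    z.im * ‖v‖ ≤ ‖Matrix.toEuclideanLin (stShift A z) v‖ := by
  set S := Matrix.toEuclideanLin (A.map (fun x : ℝ => (x : ℂ))) with hS
  have hH : (A.map (fun x : ℝ => (x : ℂ))).IsHermitian := by
    ext i j
    simp [Matrix.conjTranspose_apply, hA i j]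
  have hsym : S.IsSymmetric := Matrix.isSymmetric_toEuclideanLin_iff.2 hH
  have heq : Matrix.toEuclideanLin (stShift A z) v = S v - z • v := by
    simp [stShift, hS, map_sub, Matrix.toLpLin_eq_toLin, Matrix.toLin_one]
  have him : (inner ℂ v (S v)).im = 0 := by
    have := hsym.im_inner_self_apply v
    simpa using this
  rw [heq]
  by_cases hv : ‖v‖ = 0
  · rw [hv]; simp
  have hpos : 0 < ‖v‖ := lt_of_le_of_ne (norm_nonneg _) (Ne.symm hv)
  have h1 : (inner ℂ v (S v - z • v)).im = - (z.im * ‖v‖ ^ 2) := by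
    rw [inner_sub_right, inner_smul_right, inner_self_eq_norm_sq_to_K, Complex.sub_im, him]
    norm_cast
    simp [Complex.mul_im, ← Complex.ofReal_pow]
  have h2 := (Complex.abs_im_le_norm _).trans (norm_inner_le_norm (𝕜 := ℂ) v (S v - z • v))
  rw [h1, abs_neg, abs_of_nonneg (by positivity)] at h2
  have : ‖v‖ * (z.im * ‖v‖) ≤ ‖v‖ * ‖S v - z • v‖ := by nlinarith
  exact le_of_mul_le_mul_left this hpos

lemma st_isUnit {n : ℕ} (A : Matrix (Fin n) (Fin n) ℝ) (hA : ∀ i j, A i j = A j i) (z : ℂ)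
    (hz : 0 < z.im) : IsUnit (stShift A z).det := by
  rw [isUnit_iff_ne_zero]
  intro h0
  obtain ⟨v, hv, hv0⟩ := Matrix.exists_mulVec_eq_zero_iff.2 h0
  have := st_lower A hA z hz (WithLp.toLp 2 v)
  have h2 : Matrix.toEuclideanLin (stShift A z) (WithLp.toLp 2 v) = 0 := by
    rw [Matrix.toLpLin_toLp, Matrix.toLin'_apply, hv0]; rfl
  rw [h2, norm_zero] at this
  have h3 : ‖WithLp.toLp 2 v‖ ≤ 0 := by
    by_contra hc
    push Not at hc
    nlinarith [mul_pos hz hc]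
  apply hv
  have := norm_le_zero_iff.1 h3
  simpa using this

lemma st_resolvent {n : ℕ} (A : Matrix (Fin n) (Fin n) ℝ) (hA : ∀ i j, A i j = A j i) (z : ℂ)
    (hz : 0 < z.im) (v : EuclideanSpace ℂ (Fin n)) :
    ‖Matrix.toEuclideanLin (stShift A z)⁻¹ v‖ ≤ 1 / z.im * ‖v‖ := by
  have h := st_lower A hA z hz (Matrix.toEuclideanLin (stShift A z)⁻¹ v)
  have h2 : Matrix.toEuclideanLin (stShift A z) (Matrix.toEuclideanLin (stShift A z)⁻¹ v) = v := by
    have : WithLp.toLp 2 (WithLp.ofLp v) = v := rfl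
    rw [← this, Matrix.toLpLin_toLp, Matrix.toLpLin_toLp, Matrix.toLin'_apply, Matrix.toLin'_apply,
      Matrix.mulVec_mulVec,
      Matrix.mul_nonsing_inv _ (st_isUnit A hA z hz), Matrix.one_mulVec]
  rw [h2] at h
  rw [one_div, inv_mul_eq_div, le_div_iff₀ hz]
  linarith

lemma st_bound {n : ℕ} (A : Matrix (Fin n) (Fin n) ℝ) (hA : ∀ i j, A i j = A j i) (z : ℂ)
    (hz : 0 < z.im) : ‖stieltjesTransform A z‖ ≤ 1 / z.im := by
  have h := st_trace_bound _ _ (st_resolvent A hA z hz)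
  have hr : ((stShift A z)⁻¹.rank : ℝ) ≤ n := by
    exact_mod_cast (by simpa using Matrix.rank_le_width (stShift A z)⁻¹)
  have h2 : ‖((stShift A z)⁻¹).trace‖ ≤ n * (1 / z.im) := h.trans (by gcongr)
  unfold stieltjesTransform
  rw [norm_mul, norm_inv, Complex.norm_natCast]
  change (n : ℝ)⁻¹ * ‖((stShift A z)⁻¹).trace‖ ≤ _
  rcases Nat.eq_zero_or_pos n with h0 | h0
  · subst h0; simp; positivity
  · have : (0 : ℝ) < n := by exact_mod_cast h0
    rw [inv_mul_le_iff₀ this]; exact h2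

lemma st_rank_add {n : ℕ} (X Y : Matrix (Fin n) (Fin n) ℂ) : (X + Y).rank ≤ X.rank + Y.rank := by
  unfold Matrix.rank
  rw [Matrix.mulVecLin_add]
  refine (Submodule.finrank_mono (LinearMap.range_add_le _ _)).trans ?_
  exact Submodule.finrank_add_le_finrank_add_finrank _ _

lemma st_diff {n : ℕ} (A B : Matrix (Fin n) (Fin n) ℝ) (hA : ∀ i j, A i j = A j i)
    (hB : ∀ i j, B i j = B j i) (i : Fin n) (hAB : ∀ j k, j ≠ i → k ≠ i → A j k = B j k) (z : ℂ)
    (hz : 0 < z.im) :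
    ‖stieltjesTransform A z - stieltjesTransform B z‖ ≤ (n : ℝ)⁻¹ * (4 / z.im) := by
  set R := (stShift A z)⁻¹ with hR
  set S := (stShift B z)⁻¹ with hS
  have hdiff : R - S = R * ((stShift B z - stShift A z) * S) := by
    rw [Matrix.sub_mul, Matrix.mul_sub, hS, Matrix.mul_nonsing_inv _ (st_isUnit B hB z hz), hR,
      ← Matrix.mul_assoc, Matrix.nonsing_inv_mul _ (st_isUnit A hA z hz)]
    simp
  have hD : stShift B z - stShift A z =
      Matrix.vecMulVec (Pi.single i 1) (fun k => ((B i k - A i k : ℝ) : ℂ)) +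
      Matrix.vecMulVec (fun j => if j = i then 0 else ((B j i - A j i : ℝ) : ℂ)) (Pi.single i 1) := by
    ext j k
    simp only [stShift, Matrix.sub_apply, Matrix.map_apply, Matrix.add_apply, Matrix.vecMulVec_apply,
      Pi.single_apply]
    by_cases hj : j = i
    · subst hj; simp
    · by_cases hk : k = i
      · subst hk; simp [hj]
      · simp [hj, hk, hAB j k hj hk]
  have hrk : (R - S).rank ≤ 2 := by
    rw [hdiff]
    refine (Matrix.rank_mul_le_right _ _).trans ((Matrix.rank_mul_le_left _ _).trans ?_)
    rw [hD]
    refine (st_rank_add _ _).trans ?_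
    have h1 := Matrix.rank_vecMulVec_le (Pi.single i 1) (fun k => ((B i k - A i k : ℝ) : ℂ))
    have h2 := Matrix.rank_vecMulVec_le (fun j => if j = i then 0 else ((B j i - A j i : ℝ) : ℂ)) (Pi.single i 1)
    omega
  have htb := st_trace_bound (R - S) (2 / z.im) (fun v => by
    rw [map_sub, LinearMap.sub_apply]
    refine (norm_sub_le _ _).trans ?_
    have h1 := st_resolvent A hA z hz v
    have h2 := st_resolvent B hB z hz v
    calc _ ≤ 1 / z.im * ‖v‖ + 1 / z.im * ‖v‖ := add_le_add h1 h2
      _ = _ := by ring)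
  have hrk' : ((R - S).rank : ℝ) ≤ 2 := by exact_mod_cast hrk
  have : ‖(R - S).trace‖ ≤ 4 / z.im := by
    refine htb.trans ?_
    calc _ ≤ 2 * (2 / z.im) := by gcongr
      _ = _ := by ring
  have he : stieltjesTransform A z - stieltjesTransform B z = (n : ℂ)⁻¹ * (R - S).trace := by
    rw [Matrix.trace_sub, mul_sub]; rfl
  rw [he, norm_mul, norm_inv, Complex.norm_natCast]
  gcongr

lemma st_measurable {α : Type*} [MeasurableSpace α] {n : ℕ} (B : α → Matrix (Fin n) (Fin n) ℝ)
    (hB : ∀ i j, Measurable fun a => B a i j) (z : ℂ) :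
    Measurable fun a => stieltjesTransform (B a) z := by
  let φ : (Fin n → Fin n → ℝ) → Matrix (Fin n) (Fin n) ℂ := fun x => stShift (Matrix.of x) z
  have hφ : Continuous φ := by
    refine continuous_matrix fun i j => ?_
    simp only [φ, stShift, Matrix.sub_apply, Matrix.map_apply, Matrix.of_apply]
    fun_prop
  have h1 : Measurable fun x => (φ x).det := hφ.matrix_det.measurable
  have h2 : Measurable fun x => (φ x).adjugate.trace := hφ.matrix_adjugate.matrix_trace.measurable
  have hBm : Measurable (fun a => (fun i j => B a i j : Fin n → Fin n → ℝ)) :=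
    measurable_pi_iff.2 fun i => measurable_pi_iff.2 fun j => hB i j
  have h3 : Measurable fun x => (n : ℂ)⁻¹ * (((φ x).det)⁻¹ * (φ x).adjugate.trace) :=
    (h1.inv.mul h2).const_mul _
  have := h3.comp hBm
  convert this using 1
  ext a
  simp only [Function.comp, stieltjesTransform]
  rw [Matrix.inv_def, Matrix.trace_smul, Ring.inverse_eq_inv, smul_eq_mul]
  rfl

lemma st_mcdiarmid {E : Type*} [MeasurableSpace E] (c t : ℝ) : ∀ (n : ℕ)
    (μ : Fin n → Measure E) (_ : ∀ i, IsProbabilityMeasure (μ i)) (g : (Fin n → E) → ℝ)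
    (_ : Measurable g) (_ : ∃ B, ∀ x, |g x| ≤ B)
    (_ : ∀ x i y, |g (Function.update x i y) - g x| ≤ c),
    ∫ x, Real.exp (t * (g x - ∫ y, g y ∂(Measure.pi μ))) ∂(Measure.pi μ)
      ≤ Real.exp (n * (c ^ 2 * t ^ 2 / 2)) := by
  intro n
  induction n with
  | zero =>
    intro μ hμ g hg hb hd
    have : ∀ x, g x = g default := fun x => congrArg g (Subsingleton.elim _ _)
    simp [this]
  | succ n ih =>
    intro μ hμ g hg ⟨B, hB⟩ hd
    have key : ∀ f : (Fin (n+1) → E) → ℝ, ∫ x, f x ∂(Measure.pi μ) =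
        ∫ z, f (Fin.cons z.1 z.2) ∂((μ 0).prod (Measure.pi fun j : Fin n => μ j.succ)) := by
      intro f
      have h := ((measurePreserving_piFinSuccAbove μ 0).symm).integral_comp' f
      rw [← h]
      simp_rw [MeasurableEquiv.piFinSuccAbove_symm_apply, Fin.insertNthEquiv,
        Fin.insertNth_zero', Fin.zero_succAbove]
      rfl
    set ν := Measure.pi fun j : Fin n => μ j.succ with hν
    have hcm : Measurable (fun z : E × (Fin n → E) => (Fin.cons z.1 z.2 : Fin (n+1) → E)) := by
      refine measurable_pi_iff.2 fun i => ?_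
      refine Fin.cases ?_ (fun j => ?_) i
      · simpa using measurable_fst
      · simp only [Fin.cons_succ]
        exact (measurable_pi_apply j).comp measurable_snd
    have hgm : Measurable (fun z : E × (Fin n → E) => g (Fin.cons z.1 z.2)) := hg.comp hcm
    have hne : Nonempty E := nonempty_of_isProbabilityMeasure (μ 0)
    obtain ⟨y0⟩ := hne
    have hc : 0 ≤ c := (abs_nonneg _).trans (hd (fun _ => y0) 0 y0)
    have hBi : ∀ x' : Fin n → E, Integrable (fun a => g (Fin.cons a x')) (μ 0) := fun x' =>
      Integrable.of_bound (hgm.comp measurable_prodMk_right).aestronglyMeasurable B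
        (ae_of_all _ fun a => hB _)
    set h : (Fin n → E) → ℝ := fun x' => ∫ a, g (Fin.cons a x') ∂(μ 0) with hh
    have hhm : Measurable h := by
      have := (hgm.stronglyMeasurable).integral_prod_left' (μ := μ 0)
      exact this.measurable
    have hhB : ∀ x, |h x| ≤ B := by
      intro x
      have := norm_integral_le_of_norm_le_const (μ := μ 0) (f := fun a => g (Fin.cons a x)) (C := B)
        (ae_of_all _ fun a => hB _)
      simpa using this
    have hhd : ∀ x i y, |h (Function.update x i y) - h x| ≤ c := by
      intro x i y
      rw [hh]
      simp only
      rw [← integral_sub (hBi _) (hBi _)]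
      have := norm_integral_le_of_norm_le_const (μ := μ 0)
        (f := fun a => g (Fin.cons a (Function.update x i y)) - g (Fin.cons a x)) (C := c)
        (ae_of_all _ fun a => by
          rw [Fin.cons_update]
          exact hd _ _ _)
      simpa using this
    have hih := ih (fun j => μ j.succ) (fun j => hμ _) h hhm ⟨B, hhB⟩ hhd
    have hbdexp : ∀ u B' : ℝ, |u| ≤ B' → Real.exp (t * u) ≤ Real.exp (|t| * B') := by
      intro u B' hu
      apply Real.exp_le_exp.2
      calc t * u ≤ |t * u| := le_abs_self _
        _ = |t| * |u| := abs_mul _ _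
        _ ≤ _ := by gcongr
    have hint : Integrable (fun z : E × (Fin n → E) => g (Fin.cons z.1 z.2)) ((μ 0).prod ν) :=
      Integrable.of_bound hgm.aestronglyMeasurable B (ae_of_all _ fun a => hB _)
    have hmean : ∫ y, g y ∂(Measure.pi μ) = ∫ x, h x ∂ν := by
      rw [key, integral_prod_symm _ hint]
    rw [key, hmean]
    set m := ∫ x, h x ∂ν with hm
    have hint2 : Integrable (fun z : E × (Fin n → E) => Real.exp (t * (g (Fin.cons z.1 z.2) - m)))
        ((μ 0).prod ν) := by
      refine Integrable.of_bound (((hgm.sub_const m).const_mul t).exp).aestronglyMeasurable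
        (Real.exp (|t| * (B + |m|))) (ae_of_all _ fun a => ?_)
      rw [Real.norm_eq_abs, Real.abs_exp]
      exact hbdexp _ _ ((abs_sub _ _).trans (by gcongr; exact hB _))
    rw [integral_prod_symm _ hint2]
    have hin : ∀ x', ∫ a, Real.exp (t * (g (Fin.cons a x') - m)) ∂(μ 0)
        ≤ Real.exp (c ^ 2 * t ^ 2 / 2) * Real.exp (t * (h x' - m)) := by
      intro x'
      have hs := hasSubgaussianMGF_of_mem_Icc (μ := μ 0) (X := fun a => g (Fin.cons a x'))
        (a := g (Fin.cons y0 x') - c) (b := g (Fin.cons y0 x') + c)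
        (hgm.comp measurable_prodMk_right).aemeasurable (ae_of_all _ fun a => by
          have := hd (Fin.cons y0 x') 0 a
          rw [Fin.update_cons_zero, abs_le] at this
          constructor <;> linarith [this.1, this.2])
      have h2 := hs.mgf_le t
      have hcc : (((‖g (Fin.cons y0 x') + c - (g (Fin.cons y0 x') - c)‖₊ / 2) ^ 2 : NNReal) : ℝ)
          = c ^ 2 := by
        push_cast
        rw [show g (Fin.cons y0 x') + c - (g (Fin.cons y0 x') - c) = 2 * c by ring,
          Real.norm_eq_abs, div_pow, sq_abs]
        ring
      rw [hcc] at h2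
      unfold mgf at h2
      calc ∫ a, Real.exp (t * (g (Fin.cons a x') - m)) ∂(μ 0)
          = ∫ a, Real.exp (t * (g (Fin.cons a x') - h x')) * Real.exp (t * (h x' - m)) ∂(μ 0) := by
            congr 1; ext a; rw [← Real.exp_add]; ring_nf
        _ = (∫ a, Real.exp (t * (g (Fin.cons a x') - h x')) ∂(μ 0)) * Real.exp (t * (h x' - m)) :=
            integral_mul_const _ _
        _ ≤ _ := by gcongr
    calc _ ≤ ∫ x', Real.exp (c ^ 2 * t ^ 2 / 2) * Real.exp (t * (h x' - m)) ∂ν := by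
            refine integral_mono hint2.integral_prod_right ?_ hin
            refine Integrable.const_mul ?_ _
            refine Integrable.of_bound (((hhm.sub_const m).const_mul t).exp).aestronglyMeasurable
              (Real.exp (|t| * (B + |m|))) (ae_of_all _ fun a => ?_)
            rw [Real.norm_eq_abs, Real.abs_exp]
            exact hbdexp _ _ ((abs_sub _ _).trans (by gcongr; exact hhB _))
      _ = Real.exp (c ^ 2 * t ^ 2 / 2) * ∫ x', Real.exp (t * (h x' - m)) ∂ν :=
            integral_const_mul _ _
      _ ≤ Real.exp (c ^ 2 * t ^ 2 / 2) * Real.exp (n * (c ^ 2 * t ^ 2 / 2)) := by gcongr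
      _ = _ := by rw [← Real.exp_add]; push_cast; ring_nf

lemma st_law {Ω : Type*} [MeasurableSpace Ω] (P : Measure Ω) [IsProbabilityMeasure P] {p n : ℕ}
    (M : Ω → Matrix (Fin p) (Fin n) ℝ) (hM : ∀ k l, Measurable fun ω => M ω k l)
    (hi : iIndepFun (fun kl : Fin p × Fin n => fun ω => M ω kl.1 kl.2) P) :
    ∃ ν : Fin n → Measure (Fin p → ℝ), (∀ i, IsProbabilityMeasure (ν i)) ∧
      P.map (fun ω i k => M ω k i) = Measure.pi ν := by
  have hi2 : iIndepFun (fun q : (_ : Fin n) × Fin p => fun ω => M ω q.2 q.1) P :=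
    hi.precomp (g := fun q : (_ : Fin n) × Fin p => (q.2, q.1)) (by
      rintro ⟨a, b⟩ ⟨c, d⟩ h
      simp only [Prod.mk.injEq] at h
      obtain ⟨rfl, rfl⟩ := h
      rfl)
  have hm : ∀ q : (_ : Fin n) × Fin p, Measurable (fun ω => M ω q.2 q.1) := fun q => hM _ _
  have hlaw := (iIndepFun_iff_map_fun_eq_infinitePi_map hm).1 hi2
  have : ∀ i k, IsProbabilityMeasure (P.map (fun ω => M ω k i)) :=
    fun i k => Measure.isProbabilityMeasure_map (hM k i).aemeasurable
  refine ⟨fun i => Measure.infinitePi fun k => P.map (fun ω => M ω k i), fun i => inferInstance, ?_⟩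
  have h2 := Measure.infinitePi_map_piCurry (X := fun (_ : Fin n) (_ : Fin p) => ℝ)
    (fun i k => P.map (fun ω => M ω k i))
  rw [← Measure.infinitePi_eq_pi, ← h2, ← hlaw, Measure.map_map (by fun_prop)
    (measurable_pi_iff.2 hm)]
  rfl

lemma st_fourth {Ω E : Type*} [MeasurableSpace Ω] [MeasurableSpace E] (P : Measure Ω)
    [IsProbabilityMeasure P] {n : ℕ} (hn : 0 < n) (X : Ω → Fin n → E) (hX : Measurable X)
    (ν : Fin n → Measure E) (hν : ∀ i, IsProbabilityMeasure (ν i)) (hlaw : P.map X = Measure.pi ν)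
    (g : (Fin n → E) → ℝ) (hg : Measurable g) (hb : ∃ B, ∀ x, |g x| ≤ B) (K : ℝ)
    (hd : ∀ x i y, |g (Function.update x i y) - g x| ≤ K / n) :
    ∫⁻ ω, ENNReal.ofReal ((g (X ω) - ∫ ω', g (X ω') ∂P) ^ 4) ∂P
      ≤ ENNReal.ofReal (48 * Real.exp (K ^ 2 / 2) / (n : ℝ) ^ 2) := by
  have hn' : (0 : ℝ) < n := by exact_mod_cast hn
  have hmean : ∫ ω', g (X ω') ∂P = ∫ x, g x ∂(Measure.pi ν) := by
    rw [← hlaw, integral_map hX.aemeasurable hg.aestronglyMeasurable]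
  set m := ∫ ω', g (X ω') ∂P with hm
  obtain ⟨B, hB⟩ := hb
  have hexp : ∀ t : ℝ, t ^ 2 = n → ∫ ω, Real.exp (t * (g (X ω) - m)) ∂P ≤ Real.exp (K ^ 2 / 2) := by
    intro t ht
    have h := st_mcdiarmid (K / n) t n ν hν g hg ⟨B, hB⟩ hd
    rw [← hmean, ← hlaw, integral_map hX.aemeasurable
      (((hg.sub_const m).const_mul t).exp).aestronglyMeasurable] at h
    refine h.trans (le_of_eq ?_)
    rw [ht]
    congr 1
    field_simp
  have hint : ∀ t : ℝ, Integrable (fun ω => Real.exp (t * (g (X ω) - m))) P := by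
    intro t
    refine Integrable.of_bound ((((hg.comp hX).sub_const m).const_mul t).exp).aestronglyMeasurable
      (Real.exp (|t| * (B + |m|))) (ae_of_all _ fun a => ?_)
    rw [Real.norm_eq_abs, Real.abs_exp]
    apply Real.exp_le_exp.2
    refine (le_abs_self _).trans ?_
    rw [abs_mul]
    gcongr
    exact (abs_sub _ _).trans (by gcongr; exact hB _)
  set s := Real.sqrt n with hs
  have hs2 : s ^ 2 = n := Real.sq_sqrt hn'.le
  have hpt : ∀ ω, (g (X ω) - m) ^ 4 ≤ 24 / (n : ℝ) ^ 2 *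
      (Real.exp (s * (g (X ω) - m)) + Real.exp (-s * (g (X ω) - m))) := by
    intro ω
    set u := g (X ω) - m
    have h1 := Real.pow_div_factorial_le_exp _ (abs_nonneg (s * u)) 4
    have h2 : Real.exp |s * u| ≤ Real.exp (s * u) + Real.exp (-s * u) := by
      rcases abs_choice (s * u) with h | h <;> rw [h]
      · linarith [Real.exp_pos (-s * u)]
      · rw [neg_mul]; linarith [Real.exp_pos (s * u)]
    have h3 : |s * u| ^ 4 = (n : ℝ) ^ 2 * u ^ 4 := by
      rw [← hs2, ← abs_pow, abs_of_nonneg (by positivity)]; ring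
    have h4 : ((Nat.factorial 4 : ℕ) : ℝ) = 24 := by norm_num [Nat.factorial]
    rw [h3, h4] at h1
    rw [div_mul_eq_mul_div, le_div_iff₀ (by positivity)]
    linarith [h1.trans h2]
  have hint2 := ((hint s).add (hint (-s))).const_mul (24 / (n : ℝ) ^ 2)
  calc _ ≤ ∫⁻ ω, ENNReal.ofReal (24 / (n : ℝ) ^ 2 *
      (Real.exp (s * (g (X ω) - m)) + Real.exp (-s * (g (X ω) - m)))) ∂P :=
        lintegral_mono fun ω => ENNReal.ofReal_le_ofReal (hpt ω)
    _ = ENNReal.ofReal (∫ ω, 24 / (n : ℝ) ^ 2 *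
      (Real.exp (s * (g (X ω) - m)) + Real.exp (-s * (g (X ω) - m))) ∂P) :=
        (ofReal_integral_eq_lintegral_ofReal hint2 (ae_of_all _ fun ω =>
          le_trans (by positivity) (hpt ω))).symm
    _ ≤ _ := by
      apply ENNReal.ofReal_le_ofReal
      rw [integral_const_mul, integral_add (hint s) (hint (-s))]
      have h1 := hexp s hs2
      have h2 := hexp (-s) (by rw [neg_sq, hs2])
      calc _ ≤ 24 / (n : ℝ) ^ 2 * (Real.exp (K ^ 2 / 2) + Real.exp (K ^ 2 / 2)) := by gcongr
        _ = _ := by ring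

lemma st_as {Ω : Type*} [MeasurableSpace Ω] (P : Measure Ω) (Y : ℕ → Ω → ℝ)
    (hY : ∀ n, Measurable (Y n)) (C : ℝ) (hC : 0 ≤ C)
    (h : ∀ n, 0 < n → ∫⁻ ω, ENNReal.ofReal ((Y n ω) ^ 4) ∂P ≤ ENNReal.ofReal (C / (n : ℝ) ^ 2)) :
    ∀ᵐ ω ∂P, Tendsto (fun n => Y n ω) atTop (nhds 0) := by
  have hsum : Summable fun n : ℕ => C / ((n + 1 : ℕ) : ℝ) ^ 2 := by
    have h0 : Summable fun n : ℕ => C * (1 / (n : ℝ) ^ 2) :=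
      (Real.summable_one_div_nat_pow.2 (by norm_num)).mul_left C
    have := (summable_nat_add_iff 1).2 h0
    simpa [div_eq_mul_inv] using this
  have hmeas : ∀ n, Measurable fun ω => ENNReal.ofReal ((Y (n + 1) ω) ^ 4) :=
    fun n => ((hY _).pow_const 4).ennreal_ofReal
  have hfin : ∫⁻ ω, ∑' n, ENNReal.ofReal ((Y (n + 1) ω) ^ 4) ∂P ≠ ⊤ := by
    rw [lintegral_tsum fun n => (hmeas n).aemeasurable]
    refine ne_top_of_le_ne_top ?_ (ENNReal.tsum_le_tsum fun n => h (n + 1) (Nat.succ_pos n))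
    rw [← ENNReal.ofReal_tsum_of_nonneg (fun n => by positivity) hsum]
    exact ENNReal.ofReal_ne_top
  filter_upwards [ae_lt_top (Measurable.ennreal_tsum hmeas) hfin] with ω hω
  have h1 := ENNReal.tendsto_atTop_zero_of_tsum_ne_top hω.ne
  have h2 : Tendsto (fun n => (Y (n + 1) ω) ^ 4) atTop (nhds 0) := by
    have := (ENNReal.tendsto_toReal ENNReal.zero_ne_top).comp h1
    simp only [ENNReal.toReal_zero] at this
    refine this.congr fun n => ?_
    exact ENNReal.toReal_ofReal (by positivity)
  have h3 : Tendsto (fun n => Y n ω ^ 4) atTop (nhds 0) := (tendsto_add_atTop_iff_nat 1).1 h2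
  have h4 := (h3.sqrt).sqrt
  simp only [Real.sqrt_zero] at h4
  refine (tendsto_zero_iff_abs_tendsto_zero _).2 (h4.congr fun n => ?_)
  rw [show Y n ω ^ 4 = (Y n ω ^ 2) ^ 2 by ring, Real.sqrt_sq (by positivity), Real.sqrt_sq_eq_abs]
  rfl

lemma st_main {Ω : Type*} [MeasurableSpace Ω] (P : Measure Ω) [IsProbabilityMeasure P]
    (p : ℕ → ℕ)
    (M : (n : ℕ) → Ω → Matrix (Fin (p n)) (Fin n) ℝ)
    (hM : ∀ n (k : Fin (p n)) (l : Fin n), Measurable (fun ω => M n ω k l))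
    (hi : ∀ n, iIndepFun (fun kl : Fin (p n) × Fin n => fun ω => M n ω kl.1 kl.2) P)
    (B : (n : ℕ) → (Fin n → Fin (p n) → ℝ) → Matrix (Fin n) (Fin n) ℝ)
    (hBm : ∀ n i j, Measurable fun x => B n x i j)
    (hBs : ∀ n x i j, B n x i j = B n x j i)
    (hBu : ∀ n x i y j k, j ≠ i → k ≠ i → B n (Function.update x i y) j k = B n x j k)
    (z : ℂ) (hz : 0 < z.im) :
    ∀ᵐ ω ∂P, Tendsto (fun n =>
      ‖stieltjesTransform (B n (fun i k => M n ω k i)) z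
        - ∫ ω', stieltjesTransform (B n (fun i k => M n ω' k i)) z ∂P‖) atTop (nhds 0) := by
  set X : (n : ℕ) → Ω → Fin n → Fin (p n) → ℝ := fun n ω i k => M n ω k i with hXdef
  have hX : ∀ n, Measurable (X n) := fun n =>
    measurable_pi_iff.2 fun i => measurable_pi_iff.2 fun k => hM n k i
  have hG : ∀ n, Measurable fun x => stieltjesTransform (B n x) z := fun n =>
    st_measurable (B n) (hBm n) z
  have hint : ∀ n, Integrable (fun ω => stieltjesTransform (B n (X n ω)) z) P := fun n =>
    Integrable.of_bound ((hG n).comp (hX n)).aestronglyMeasurable (1 / z.im)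
      (ae_of_all _ fun ω => st_bound _ (hBs n _) z hz)
  have hdiff : ∀ n x i y, ‖stieltjesTransform (B n (Function.update x i y)) z
      - stieltjesTransform (B n x) z‖ ≤ (4 / z.im) / n := by
    intro n x i y
    have := st_diff (B n (Function.update x i y)) (B n x) (hBs n _) (hBs n _) i
      (fun j k hj hk => hBu n x i y j k hj hk) z hz
    rwa [inv_mul_eq_div] at this
  have part : ∀ L : ℂ →L[ℝ] ℝ, (∀ w, |L w| ≤ ‖w‖) → ∀ᵐ ω ∂P, Tendsto (fun n =>
      L (stieltjesTransform (B n (X n ω)) z - ∫ ω', stieltjesTransform (B n (X n ω')) z ∂P))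
      atTop (nhds 0) := by
    intro L hL
    refine st_as P _ (fun n => L.measurable.comp (((hG n).comp (hX n)).sub_const _))
      (48 * Real.exp ((4 / z.im) ^ 2 / 2)) (by positivity) fun n hn => ?_
    obtain ⟨ν, hν, hlaw⟩ := st_law P (M n) (hM n) (hi n)
    have := st_fourth P hn (X n) (hX n) ν hν hlaw (fun x => L (stieltjesTransform (B n x) z))
      (L.measurable.comp (hG n)) ⟨1 / z.im, fun x => (hL _).trans (st_bound _ (hBs n _) z hz)⟩
      (4 / z.im) (fun x i y => by
        rw [← map_sub]
        exact (hL _).trans (hdiff n x i y))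
    rw [L.integral_comp_comm (hint n)] at this
    simpa only [map_sub] using this
  filter_upwards [part Complex.reCLM Complex.abs_re_le_norm,
    part Complex.imCLM Complex.abs_im_le_norm] with ω h1 h2
  have h3 := h1.abs.add h2.abs
  simp only [abs_zero, add_zero] at h3
  exact squeeze_zero (fun n => norm_nonneg _) (fun n => Complex.norm_le_abs_re_add_abs_im _) h3

/-- Lemma 3.3 (concentration of the Stieltjes transform): let `M` be a `p × n` random
matrix with independent entries, `A_{ij} = F(M_i, M_j, p)` where `M_i` is the `i`-th
column of `M` and `F` is measurable, real valued and symmetric in its first two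
variables, and let `Atil` agree with `A` off the diagonal and have zero diagonal.  Then for
any fixed `z` in the upper half-plane, almost surely `|m_A(z) − E m_A(z)| → 0` and
almost surely `|m_{Atil}(z) − E m_{Atil}(z)| → 0` as `n → ∞`. -/
theorem stieltjes_transform_concentration
    {Ω : Type*} [MeasureSpace Ω] [IsProbabilityMeasure (ℙ : Measure Ω)]
    -- the dimension p = p(n)
    (p : ℕ → ℕ)
    -- the p × n random matrix M with independent entries
    (M : (n : ℕ) → Ω → Matrix (Fin (p n)) (Fin n) ℝ)
    (hMmeas : ∀ n (k : Fin (p n)) (l : Fin n), Measurable (fun ω => M n ω k l))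
    (hindep : ∀ n, iIndepFun
      (fun kl : Fin (p n) × Fin n => fun ω => M n ω kl.1 kl.2) ℙ)
    -- the kernel F, measurable and symmetric in its first two variables
    (F : (n : ℕ) → (Fin (p n) → ℝ) → (Fin (p n) → ℝ) → ℝ)
    (hFmeas : ∀ n, Measurable (fun v : (Fin (p n) → ℝ) × (Fin (p n) → ℝ) => F n v.1 v.2))
    (hFsymm : ∀ n x y, F n x y = F n y x)
    -- the matrices A and Atil (the latter with zero diagonal)
    (A Atil : (n : ℕ) → Ω → Matrix (Fin n) (Fin n) ℝ)
    (hA : ∀ n ω i j, A n ω i j = F n (fun k => M n ω k i) (fun k => M n ω k j))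
    (hAtil : ∀ n ω i j, Atil n ω i j = if i = j then 0 else A n ω i j)
    -- a fixed point z in the upper half-plane
    (z : ℂ) (hz : 0 < z.im) :
    (∀ᵐ ω ∂(ℙ : Measure Ω),
        Tendsto (fun n =>
            ‖stieltjesTransform (A n ω) z - ∫ ω', stieltjesTransform (A n ω') z ∂(ℙ : Measure Ω)‖)
          atTop (nhds 0)) ∧
      (∀ᵐ ω ∂(ℙ : Measure Ω),
        Tendsto (fun n =>
            ‖stieltjesTransform (Atil n ω) z - ∫ ω', stieltjesTransform (Atil n ω') z ∂(ℙ : Measure Ω)‖)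
          atTop (nhds 0)) := by
  have hcol : ∀ n (i : Fin n), Measurable fun x : Fin n → Fin (p n) → ℝ => x i :=
    fun n i => measurable_pi_apply i
  have hFm : ∀ n (i j : Fin n), Measurable fun x : Fin n → Fin (p n) → ℝ => F n (x i) (x j) :=
    fun n i j => (hFmeas n).comp ((hcol n i).prodMk (hcol n j))
  constructor
  · have h := st_main (ℙ : Measure Ω) p M hMmeas hindep
      (fun n x => Matrix.of fun i j => F n (x i) (x j))
      (fun n i j => hFm n i j) (fun n x i j => hFsymm n _ _)
      (fun n x i y j k hj hk => by simp [Function.update_of_ne hj, Function.update_of_ne hk]) z hz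
    have e : ∀ n ω, A n ω = Matrix.of fun i j =>
        F n (fun k => M n ω k i) (fun k => M n ω k j) := by
      intro n ω; ext i j; simp [hA]
    simpa only [e] using h
  · have h := st_main (ℙ : Measure Ω) p M hMmeas hindep
      (fun n x => Matrix.of fun i j => if i = j then 0 else F n (x i) (x j))
      (fun n i j => by
        by_cases hij : i = j
        · simp [hij]
        · simpa [hij] using hFm n i j)
      (fun n x i j => by
        by_cases hij : i = j
        · simp [hij]
        · simp [hij, Ne.symm hij, hFsymm n (x i) (x j)])
      (fun n x i y j k hj hk => by simp [Function.update_of_ne hj, Function.update_of_ne hk]) z hz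
    have e : ∀ n ω, Atil n ω = Matrix.of fun i j => if i = j then 0 else
        F n (fun k => M n ω k i) (fun k => M n ω k j) := by
      intro n ω; ext i j; simp [hAtil, hA]
    simpa only [e] using h
end
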